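/- Let π_E(x) = #{γ ∈ SL₂(ℤ) : ν(γ) is a prime ≤ x}. Assume there exist constants c₂ ≥ c₁ > 0 and x₀ such that c₁·x/log x ≤ π_E(x) ≤ c₂·x/log x for all x ≥ x₀. Then for every continuous function f : (ℝ/ℤ)² → ℂ, (1/π_E(x)) · Σ_{γ ∈ SL₂(ℤ), ν(γ) prime ≤ x} f(θ(γ)) → ∫_{(ℝ/ℤ)²} f dμ as x → ∞. -/

import Mathlib

open Matrix Complex MeasureTheory Filter
open scoped BigOperators

noncomputable section

/-- `SL₂(ℤ)`, the group of 2×2 integer matrices of determinant 1. -/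
abbrev SL2Z := Matrix.SpecialLinearGroup (Fin 2) ℤ

/-- `ν(γ) = a² + b² + c² + d²`. -/
def nuH (γ : SL2Z) : ℤ := (γ.1 0 0) ^ 2 + (γ.1 0 1) ^ 2 + (γ.1 1 0) ^ 2 + (γ.1 1 1) ^ 2

/-- `z₁(γ) = (a + d) + (b - c)i ∈ ℤ[i]`. -/
def z1 (γ : SL2Z) : GaussianInt := ⟨γ.1 0 0 + γ.1 1 1, γ.1 0 1 - γ.1 1 0⟩

/-- `z₂(γ) = (a - d) - (b + c)i ∈ ℤ[i]`. -/
def z2 (γ : SL2Z) : GaussianInt := ⟨γ.1 0 0 - γ.1 1 1, -(γ.1 0 1 + γ.1 1 0)⟩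

/-- The pair of normalized Cartan angles
`θ(γ) = (arg(z₁z₂)/(2π), arg(z₁·conj z₂)/(2π)) mod ℤ²` on the 2-torus. -/
def theta (γ : SL2Z) : UnitAddCircle × UnitAddCircle :=
  ((Complex.arg (GaussianInt.toComplex (z1 γ) * GaussianInt.toComplex (z2 γ)) /
      (2 * Real.pi) : ℝ),
   (Complex.arg (GaussianInt.toComplex (z1 γ) *
      (starRingEnd ℂ) (GaussianInt.toComplex (z2 γ))) / (2 * Real.pi) : ℝ))

/-- `π_E(x) = #{γ ∈ SL₂(ℤ) : ν(γ) is a prime ≤ x}`. -/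
def piE (x : ℝ) : ℕ :=
  Nat.card {γ : SL2Z // ∃ p : ℕ, p.Prime ∧ (p : ℝ) ≤ x ∧ nuH γ = (p : ℤ)}

namespace CartanAngles

theorem prod_pow_div_dvd_factorial (N : ℕ) :
    ∏ p ∈ N.primesBelow, p ^ (N / p) ∣ N.factorial := by
  refine Finset.prod_dvd_of_isRelPrime ?_ ?_
  · intro p hp q hq hpq
    have hp' := Nat.prime_of_mem_primesBelow hp
    have hq' := Nat.prime_of_mem_primesBelow hq
    exact Nat.coprime_iff_isRelPrime.1
      (Nat.Coprime.pow _ _ ((Nat.coprime_primes hp' hq').2 hpq))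
  · intro p hp
    have hp' := Nat.prime_of_mem_primesBelow hp
    rw [hp'.pow_dvd_factorial_iff (b := Nat.log p N + 2) (by omega)]
    calc N / p = N / p ^ 1 := by simp
      _ ≤ _ := Finset.single_le_sum (f := fun i => N / p ^ i) (fun _ _ => Nat.zero_le _) (by simp)

theorem sum_log_div_primesBelow_le {N : ℕ} (hN : 1 ≤ N) :
    ∑ p ∈ N.primesBelow, Real.log p / p ≤ Real.log N + Real.log 4 := by
  have hN0 : (0 : ℝ) < N := by exact_mod_cast hN
  have h1 : ∑ p ∈ N.primesBelow, Real.log p * (N / p : ℕ) ≤ N * Real.log N := by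
    have : ∑ p ∈ N.primesBelow, Real.log p * (N / p : ℕ) =
        Real.log ((∏ p ∈ N.primesBelow, p ^ (N / p) : ℕ) : ℝ) := by
      push_cast
      rw [Real.log_prod]
      · exact Finset.sum_congr rfl fun p _ => by rw [Real.log_pow]; ring
      · intro p hp
        have := (Nat.prime_of_mem_primesBelow hp).pos
        positivity
    rw [this]
    have hle := Nat.le_of_dvd (Nat.factorial_pos N) (prod_pow_div_dvd_factorial N)
    have hpos : 0 < ∏ p ∈ N.primesBelow, p ^ (N / p) :=
      Finset.prod_pos fun p hp => pow_pos (Nat.prime_of_mem_primesBelow hp).pos _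
    calc Real.log ((∏ p ∈ N.primesBelow, p ^ (N / p) : ℕ) : ℝ)
        ≤ Real.log ((N : ℝ) ^ N) := by
          apply Real.log_le_log (by exact_mod_cast hpos)
          exact_mod_cast hle.trans (Nat.factorial_le_pow N)
      _ = N * Real.log N := by rw [Real.log_pow]
  have h2 : ∑ p ∈ N.primesBelow, Real.log p ≤ Real.log 4 * N := by
    refine le_trans ?_ (Chebyshev.theta_le_log4_mul_x (x := N) hN0.le)
    rw [Chebyshev.theta_eq_sum_primesLE_log]
    refine Finset.sum_le_sum_of_subset_of_nonneg ?_ ?_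
    · intro p hp
      have := Nat.mem_primesBelow.1 hp
      rw [Nat.mem_primesLE]
      exact ⟨this.1.le, this.2⟩
    · intro p _ _
      exact Real.log_natCast_nonneg p
  have h3 : N * ∑ p ∈ N.primesBelow, Real.log p / p ≤
      ∑ p ∈ N.primesBelow, Real.log p * (N / p : ℕ) + ∑ p ∈ N.primesBelow, Real.log p := by
    rw [Finset.mul_sum, ← Finset.sum_add_distrib]
    refine Finset.sum_le_sum fun p hp => ?_
    have hp0 : (0 : ℝ) < p := by exact_mod_cast (Nat.prime_of_mem_primesBelow hp).pos
    have h4 : (N : ℝ) / p ≤ (N / p : ℕ) + 1 := by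
      rw [← Nat.floor_div_eq_div (K := ℝ)]
      exact (Nat.lt_floor_add_one _).le
    have h5 := Real.log_natCast_nonneg p
    calc N * (Real.log p / p) = Real.log p * (N / p) := by ring
      _ ≤ Real.log p * ((N / p : ℕ) + 1) := by gcongr
      _ = _ := by ring
  have : N * ∑ p ∈ N.primesBelow, Real.log p / p ≤ N * (Real.log N + Real.log 4) := by linarith
  exact le_of_mul_le_mul_left this hN0

/-- Passing from Dirichlet series weights `p ^ (-σ)` with `σ = 1 + 1 / log N` to a sharp cutoff. -/
theorem sum_div_primesBelow_le_of_rpow {M : ℕ → ℝ} {B α C : ℝ} (hB : 0 ≤ B)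
    (hMB : ∀ p, p.Prime → M p ≤ B)
    (h : ∀ σ : ℝ, 1 < σ → σ ≤ 2 → ∀ N : ℕ,
      ∑ p ∈ N.primesBelow, M p * (p : ℝ) ^ (-σ) ≤ α * Real.log (1 / (σ - 1)) + C)
    {N : ℕ} (hN : 3 ≤ N) :
    ∑ p ∈ N.primesBelow, M p / p ≤ α * Real.log (Real.log N) + (C + B * (1 + Real.log 4)) := by
  have hN' : (3 : ℝ) ≤ N := by exact_mod_cast hN
  have hlog : 1 < Real.log N := by
    rw [Real.lt_log_iff_exp_lt (by linarith)]
    linarith [Real.exp_one_lt_d9]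
  set η : ℝ := 1 / Real.log N with hη
  have hη0 : 0 < η := by positivity
  have hη1 : η ≤ 1 := by
    rw [hη, div_le_one (by linarith)]; exact hlog.le
  have h1 := h (1 + η) (by linarith) (by linarith) N
  have h2 : α * Real.log (1 / (1 + η - 1)) = α * Real.log (Real.log N) := by
    rw [add_sub_cancel_left, hη, one_div_one_div]
  rw [h2] at h1
  have h3 : ∑ p ∈ N.primesBelow, M p / p ≤ ∑ p ∈ N.primesBelow, M p * (p : ℝ) ^ (-(1 + η)) +
      B * η * ∑ p ∈ N.primesBelow, Real.log p / p := by
    rw [Finset.mul_sum, ← Finset.sum_add_distrib]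
    refine Finset.sum_le_sum fun p hp => ?_
    have hpp := Nat.prime_of_mem_primesBelow hp
    have hp0 : (0 : ℝ) < p := by exact_mod_cast hpp.pos
    have e1 : (p : ℝ) ^ (-(1 + η)) = Real.exp (-(η * Real.log p)) / p := by
      rw [neg_add, Real.rpow_add hp0, Real.rpow_neg_one, Real.rpow_def_of_pos hp0]
      rw [show Real.log p * -η = -(η * Real.log p) by ring]; field_simp
    have e2 : 1 - η * Real.log p ≤ Real.exp (-(η * Real.log p)) := by
      linarith [Real.add_one_le_exp (-(η * Real.log p))]
    have e3 : 0 ≤ η * Real.log p := mul_nonneg hη0.le (Real.log_natCast_nonneg p)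
    have e4 : M p * (1 - Real.exp (-(η * Real.log p))) ≤ B * (η * Real.log p) :=
      mul_le_mul (hMB p hpp) (by linarith) (by
        rw [sub_nonneg]; exact Real.exp_le_one_iff.2 (by linarith)) hB
    rw [e1]
    have : M p / p = M p * (Real.exp (-(η * Real.log p)) / p) +
        (M p * (1 - Real.exp (-(η * Real.log p)))) / p := by field_simp; ring
    rw [this]
    have e5 : M p * (1 - Real.exp (-(η * Real.log p))) / p ≤ B * (η * Real.log p) / p := by gcongr
    have e6 : B * (η * Real.log p) / p = B * η * (Real.log p / p) := by ring
    linarith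
  have h4 : B * η * ∑ p ∈ N.primesBelow, Real.log p / p ≤ B * (1 + Real.log 4) := by
    have := sum_log_div_primesBelow_le (N := N) (by omega)
    calc B * η * ∑ p ∈ N.primesBelow, Real.log p / p ≤ B * η * (Real.log N + Real.log 4) := by gcongr
      _ = B * (η * Real.log N + η * Real.log 4) := by ring
      _ ≤ B * (1 + 1 * Real.log 4) := by
        have : η * Real.log N = 1 := by rw [hη]; field_simp
        rw [this]; gcongr
      _ = _ := by ring
  linarith

theorem half_rpow_le {t : ℝ} (h0 : 0 ≤ t) (h1 : t ≤ 1) : (1 / 2 : ℝ) ^ t ≤ 1 - t / 2 := by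
  have := rpow_one_add_le_one_add_mul_self (s := -1 / 2) (p := t) (by norm_num) h0 h1
  norm_num at this ⊢
  linarith

set_option maxHeartbeats 1000000 in
theorem tsum_rpow_neg_le {σ : ℝ} (h1 : 1 < σ) (h2 : σ ≤ 2) :
    ∑' n : ℕ, (n : ℝ) ^ (-σ) ≤ 2 / (σ - 1) := by
  have hs : Summable fun n : ℕ => (n : ℝ) ^ (-σ) := Real.summable_nat_rpow.2 (by linarith)
  set S := ∑' n : ℕ, (n : ℝ) ^ (-σ)
  have hev : ∀ n : ℕ, ((2 * n : ℕ) : ℝ) ^ (-σ) = (2 : ℝ) ^ (-σ) * (n : ℝ) ^ (-σ) := fun n => by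
    push_cast
    rw [Real.mul_rpow (by norm_num) (by positivity)]
  have hse : Summable fun n : ℕ => ((2 * n : ℕ) : ℝ) ^ (-σ) := by
    simp_rw [hev]; exact hs.mul_left _
  have hso : Summable fun n : ℕ => ((2 * n + 1 : ℕ) : ℝ) ^ (-σ) :=
    hs.comp_injective (i := fun n => 2 * n + 1) (fun a b h => by simpa using h)
  have hE : ∑' n : ℕ, ((2 * n : ℕ) : ℝ) ^ (-σ) = (2 : ℝ) ^ (-σ) * S := by
    simp_rw [hev]; rw [tsum_mul_left]
  have hO : ∑' n : ℕ, ((2 * n + 1 : ℕ) : ℝ) ^ (-σ) ≤ 1 + (2 : ℝ) ^ (-σ) * S := by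
    rw [← hE, hso.tsum_eq_zero_add]
    refine add_le_add (by simp) ?_
    have hse' : Summable fun n : ℕ => ((2 * (n + 1) : ℕ) : ℝ) ^ (-σ) :=
      (summable_nat_add_iff (f := fun n : ℕ => ((2 * n : ℕ) : ℝ) ^ (-σ)) 1).2 hse
    calc ∑' n : ℕ, ((2 * (n + 1) + 1 : ℕ) : ℝ) ^ (-σ)
        ≤ ∑' n : ℕ, ((2 * (n + 1) : ℕ) : ℝ) ^ (-σ) := by
          refine Summable.tsum_le_tsum (fun n => ?_)
            ((summable_nat_add_iff (f := fun n : ℕ => ((2 * n + 1 : ℕ) : ℝ) ^ (-σ)) 1).2 hso) hse'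
          refine Real.rpow_le_rpow_of_nonpos (by positivity) (by push_cast; linarith) (by linarith)
      _ ≤ ∑' n : ℕ, ((2 * n : ℕ) : ℝ) ^ (-σ) := by
          rw [hse.tsum_eq_zero_add]
          have : (0 : ℝ) ≤ ((2 * 0 : ℕ) : ℝ) ^ (-σ) := by positivity
          linarith
  have hsum : S = ∑' n : ℕ, ((2 * n : ℕ) : ℝ) ^ (-σ) + ∑' n : ℕ, ((2 * n + 1 : ℕ) : ℝ) ^ (-σ) :=
    (tsum_even_add_odd hse hso).symm
  have h2s : 2 * (2 : ℝ) ^ (-σ) ≤ 1 - (σ - 1) / 2 := by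
    have := half_rpow_le (t := σ - 1) (by linarith) (by linarith)
    have e : (1 / 2 : ℝ) ^ (σ - 1) = 2 * (2 : ℝ) ^ (-σ) := by
      rw [one_div, Real.inv_rpow (by norm_num), ← Real.rpow_neg (by norm_num), neg_sub,
        sub_eq_add_neg, Real.rpow_add (by norm_num), Real.rpow_one]
    linarith
  have hS0 : 0 ≤ S := tsum_nonneg fun n => by positivity
  rw [le_div_iff₀ (by linarith)]
  nlinarith

theorem exists_sum_inv_primesBelow_le :
    ∃ C : ℝ, ∀ N : ℕ, 3 ≤ N →
      ∑ p ∈ N.primesBelow, (1 : ℝ) / p ≤ Real.log (Real.log N) + C := by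
  refine ⟨_, fun N hN => (sum_div_primesBelow_le_of_rpow (M := fun _ => 1) (B := 1) (α := 1)
    (C := Real.log 2) zero_le_one (fun _ _ => le_rfl) ?_ hN).trans
    (by rw [one_mul])⟩
  intro σ h1 h2 N
  let f : ℕ →* ℝ :=
    { toFun := fun n => (n : ℝ) ^ (-σ)
      map_one' := by simp
      map_mul' := fun a b => by
        push_cast; exact Real.mul_rpow (by positivity) (by positivity) }
  have hf : ∀ n, f n = (n : ℝ) ^ (-σ) := fun _ => rfl
  have hs : Summable f := Real.summable_nat_rpow.2 (by linarith)
  have hprod := EulerProduct.prod_primesBelow_geometric_eq_tsum_smoothNumbers hs N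
  have hle : ∑' m : N.smoothNumbers, f m ≤ 2 / (σ - 1) := by
    refine le_trans ?_ (tsum_rpow_neg_le h1 h2)
    exact Summable.tsum_subtype_le f _ (fun n => by rw [hf]; positivity) hs
  have hlt : ∀ p ∈ N.primesBelow, f p < 1 := fun p hp =>
    (Real.norm_eq_abs _ ▸ le_abs_self (f p)).trans_lt
      (hs.norm_lt_one (Nat.prime_of_mem_primesBelow hp).one_lt)
  have h3 : Real.exp (∑ p ∈ N.primesBelow, f p) ≤ 2 / (σ - 1) := by
    rw [Real.exp_sum]
    refine le_trans (Finset.prod_le_prod (fun _ _ => (Real.exp_pos _).le) fun p hp => ?_)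
      (hprod ▸ hle)
    have := hlt p hp
    rw [le_inv_comm₀ (Real.exp_pos _) (by linarith), ← Real.exp_neg]
    linarith [Real.add_one_le_exp (-(f p))]
  have h4 := (Real.le_log_iff_exp_le (by apply div_pos <;> linarith)).2 h3
  simp only [one_mul]
  refine h4.trans (le_of_eq ?_)
  rw [← Real.log_mul (by apply ne_of_gt; apply div_pos <;> linarith) (by norm_num)]
  congr 1; ring

theorem prod_one_sub_inv_primesBelow_le {N : ℕ} (hN : 3 ≤ N) :
    ∏ p ∈ N.primesBelow, (1 - (1 : ℝ) / p) ≤ 1 / Real.log N := by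
  let f : ℕ →* ℝ :=
    { toFun := fun n => (n : ℝ)⁻¹
      map_one' := by simp
      map_mul' := fun a b => by push_cast; rw [mul_inv] }
  have hf : ∀ n, f n = (n : ℝ)⁻¹ := fun _ => rfl
  have hlt : ∀ {p : ℕ}, p.Prime → ‖f p‖ < 1 := fun {p} hp => by
    rw [hf, norm_inv, Real.norm_natCast]
    exact inv_lt_one_of_one_lt₀ (by exact_mod_cast hp.one_lt)
  obtain ⟨hs, hsum⟩ :=
    EulerProduct.summable_and_hasSum_smoothNumbers_prod_primesBelow_geometric hlt N
  have hN' : (3 : ℝ) ≤ N := by exact_mod_cast hN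
  have hlog : 0 < Real.log N := Real.log_pos (by linarith)
  have key : Real.log N ≤ ∏ p ∈ N.primesBelow, (1 - f p)⁻¹ := by
    have h1 : Real.log N ≤ ∑ n ∈ Finset.range (N - 1), ((n + 1 : ℕ) : ℝ)⁻¹ := by
      have := log_add_one_le_harmonic (N - 1)
      rw [Nat.sub_add_cancel (by omega)] at this
      simpa [harmonic] using this
    refine h1.trans ?_
    rw [← hsum.tsum_eq]
    let e : ℕ → N.smoothNumbers := fun n =>
      if h : n + 1 < N then ⟨n + 1, Nat.mem_smoothNumbers_of_lt (by omega) h⟩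
      else ⟨1, Nat.mem_smoothNumbers_of_lt (by omega) (by omega)⟩
    have he : ∀ n ∈ Finset.range (N - 1), (e n : ℕ) = n + 1 := fun n hn => by
      have : n + 1 < N := by have := Finset.mem_range.1 hn; omega
      simp [e, this]
    have hinj : Set.InjOn e (Finset.range (N - 1)) := fun a ha b hb hab => by
      have := congrArg Subtype.val hab
      rw [he a ha, he b hb] at this
      omega
    calc ∑ n ∈ Finset.range (N - 1), ((n + 1 : ℕ) : ℝ)⁻¹
        = ∑ n ∈ Finset.range (N - 1), f (e n) :=
          Finset.sum_congr rfl fun n hn => by rw [he n hn, hf]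
      _ = ∑ m ∈ (Finset.range (N - 1)).image e, f m :=
          (Finset.sum_image (f := fun m : N.smoothNumbers => f m) hinj).symm
      _ ≤ _ := hsum.summable.sum_le_tsum _ fun m _ => by rw [hf]; positivity
  rw [Finset.prod_inv_distrib] at key
  have hpos : 0 < ∏ p ∈ N.primesBelow, (1 - f p) := Finset.prod_pos fun p hp => by
    have := hlt (Nat.prime_of_mem_primesBelow hp)
    rw [Real.norm_eq_abs] at this
    linarith [le_abs_self (f p)]
  have := (le_inv_comm₀ hlog hpos).1 key
  simpa [hf] using this

/-- The angular character `z ↦ (z / |z|) ^ m` of the Gaussian integers. -/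
def angChar (m : ℤ) : GaussianInt →*₀ ℂ where
  toFun z := if z = 0 then 0 else ((z : ℂ) / ‖(z : ℂ)‖) ^ m
  map_zero' := by simp
  map_one' := by simp
  map_mul' x y := by
    by_cases hx : x = 0
    · simp [hx]
    by_cases hy : y = 0
    · simp [hy]
    simp only [mul_eq_zero, hx, hy, or_self, if_false, GaussianInt.toComplex_mul, norm_mul,
      Complex.ofReal_mul]
    rw [← mul_zpow, mul_div_mul_comm]

theorem angChar_apply {m : ℤ} {z : GaussianInt} (hz : z ≠ 0) :
    angChar m z = ((z : ℂ) / ‖(z : ℂ)‖) ^ m := if_neg hz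

theorem toComplex_ne_zero {z : GaussianInt} (hz : z ≠ 0) : (z : ℂ) ≠ 0 :=
  fun h => hz (GaussianInt.toComplex_eq_zero.1 h)

theorem norm_div_norm {z : ℂ} (hz : z ≠ 0) : ‖z / ‖z‖‖ = 1 := by
  rw [norm_div, Complex.norm_real, norm_norm, div_self (norm_ne_zero_iff.2 hz)]

theorem norm_angChar {m : ℤ} {z : GaussianInt} (hz : z ≠ 0) : ‖angChar m z‖ = 1 := by
  rw [angChar_apply hz, norm_zpow, norm_div_norm (toComplex_ne_zero hz), _root_.one_zpow]

theorem norm_angChar_le (m : ℤ) (z : GaussianInt) : ‖angChar m z‖ ≤ 1 := by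
  by_cases hz : z = 0
  · simp [hz]
  · exact (norm_angChar hz).le

theorem angChar_zero_apply {z : GaussianInt} (hz : z ≠ 0) : angChar 0 z = 1 := by
  rw [angChar_apply hz, zpow_zero]

theorem norm_cast_eq_sq (z : GaussianInt) : (z.norm : ℝ) = ‖(z : ℂ)‖ ^ 2 := by
  rw [GaussianInt.intCast_real_norm, Complex.normSq_eq_norm_sq]

theorem norm_eq_re_sq_add_im_sq (z : GaussianInt) : z.norm = z.re ^ 2 + z.im ^ 2 := by
  rw [Zsqrtd.norm_def]; ring

theorem one_le_norm {z : GaussianInt} (hz : z ≠ 0) : (1 : ℝ) ≤ z.norm := by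
  exact_mod_cast GaussianInt.norm_pos.2 hz

/-- Gaussian integers as pairs of integers. -/
def gaussianEquiv : GaussianInt ≃ (Fin 2 → ℤ) where
  toFun z := ![z.re, z.im]
  invFun v := ⟨v 0, v 1⟩
  left_inv z := by simp
  right_inv v := by ext i; fin_cases i <;> simp

theorem summable_norm_rpow {σ : ℝ} (hσ : 1 < σ) :
    Summable fun z : GaussianInt => (z.norm : ℝ) ^ (-σ) := by
  have h := (gaussianEquiv.summable_iff).2
    (EisensteinSeries.summable_one_div_norm_rpow (k := 2 * σ) (by linarith))
  refine Summable.of_nonneg_of_le (fun z => ?_) (fun z => ?_) h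
  · exact Real.rpow_nonneg (by exact_mod_cast GaussianInt.norm_nonneg z) _
  by_cases hz : z = 0
  · subst hz
    have : (0 : ℝ) ^ (-σ) = 0 := Real.zero_rpow (by linarith)
    simp [this]
    positivity
  have hx : (0 : ℝ) < ‖gaussianEquiv z‖ := by
    rw [norm_pos_iff]
    intro h0
    apply hz
    apply gaussianEquiv.injective
    rw [h0]; ext i; fin_cases i <;> simp [gaussianEquiv]
  have hle : ‖gaussianEquiv z‖ ^ 2 ≤ (z.norm : ℝ) := by
    rw [← Real.sqrt_le_sqrt_iff (by exact_mod_cast GaussianInt.norm_nonneg z),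
      Real.sqrt_sq hx.le]
    rw [pi_norm_le_iff_of_nonneg (Real.sqrt_nonneg _)]
    intro i
    apply Real.le_sqrt_of_sq_le
    rw [norm_eq_re_sq_add_im_sq]
    push_cast
    fin_cases i <;> simp [gaussianEquiv, Int.norm_eq_abs] <;> positivity
  simp only [Function.comp]
  calc (z.norm : ℝ) ^ (-σ) ≤ (‖gaussianEquiv z‖ ^ 2) ^ (-σ) :=
        Real.rpow_le_rpow_of_nonpos (by positivity) hle (by linarith)
    _ = ‖gaussianEquiv z‖ ^ (-(2 * σ)) := by
        rw [← Real.rpow_natCast, ← Real.rpow_mul hx.le]; congr 1; push_cast; ring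

/-- The terms of the `L`-series of an angular character. -/
def lTerm (m : ℤ) (σ : ℝ) (z : GaussianInt) : ℂ := angChar m z * ((z.norm : ℝ) ^ (-σ) : ℝ)

theorem lTerm_mul (m : ℤ) (σ : ℝ) (z w : GaussianInt) :
    lTerm m σ (z * w) = lTerm m σ z * lTerm m σ w := by
  unfold lTerm
  rw [map_mul, Zsqrtd.norm_mul]
  push_cast
  rw [Real.mul_rpow (by exact_mod_cast GaussianInt.norm_nonneg z)
    (by exact_mod_cast GaussianInt.norm_nonneg w)]
  push_cast; ring

theorem norm_lTerm_le (m : ℤ) (σ : ℝ) (z : GaussianInt) :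
    ‖lTerm m σ z‖ ≤ (z.norm : ℝ) ^ (-σ) := by
  have h : 0 ≤ (z.norm : ℝ) ^ (-σ) :=
    Real.rpow_nonneg (by exact_mod_cast GaussianInt.norm_nonneg z) _
  unfold lTerm
  rw [norm_mul, Complex.norm_real, Real.norm_of_nonneg h]
  exact mul_le_of_le_one_left h (norm_angChar_le m z)

theorem norm_lTerm_le_one (m : ℤ) {σ : ℝ} (hσ : 0 < σ) (z : GaussianInt) : ‖lTerm m σ z‖ ≤ 1 := by
  by_cases hz : z = 0
  · simp [hz, lTerm]
  refine (norm_lTerm_le m σ z).trans ?_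
  exact Real.rpow_le_one_of_one_le_of_nonpos (one_le_norm hz) (by linarith)

theorem summable_lTerm (m : ℤ) {σ : ℝ} (hσ : 1 < σ) : Summable fun z => ‖lTerm m σ z‖ :=
  Summable.of_nonneg_of_le (fun _ => norm_nonneg _) (norm_lTerm_le m σ) (summable_norm_rpow hσ)

/-- The (unnormalised) `L`-value of an angular character. -/
def lValue (m : ℤ) (σ : ℝ) : ℂ := ∑' z, lTerm m σ z

theorem norm_pow_sub_pow_le {u v : ℂ} (hu : ‖u‖ = 1) (hv : ‖v‖ = 1) (n : ℕ) :
    ‖u ^ n - v ^ n‖ ≤ n * ‖u - v‖ := by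
  induction n with
  | zero => simp
  | succ n ih =>
    have : u ^ (n + 1) - v ^ (n + 1) = u ^ n * (u - v) + (u ^ n - v ^ n) * v := by ring
    rw [this]
    refine (norm_add_le _ _).trans ?_
    rw [norm_mul, norm_mul, norm_pow, hu, hv, one_pow, one_mul, mul_one]
    push_cast
    linarith [ih]

theorem norm_zpow_sub_zpow_le {u v : ℂ} (hu : ‖u‖ = 1) (hv : ‖v‖ = 1) (m : ℤ) :
    ‖u ^ m - v ^ m‖ ≤ |(m : ℝ)| * ‖u - v‖ := by
  have hu0 : u ≠ 0 := by rw [← norm_ne_zero_iff, hu]; norm_num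
  have hv0 : v ≠ 0 := by rw [← norm_ne_zero_iff, hv]; norm_num
  obtain ⟨n, rfl | rfl⟩ := m.eq_nat_or_neg
  · simpa using norm_pow_sub_pow_le hu hv n
  · have : u ^ (-(n : ℤ)) - v ^ (-(n : ℤ)) = (v ^ n - u ^ n) / (u ^ n * v ^ n) := by
      rw [_root_.zpow_neg, _root_.zpow_neg, zpow_natCast, zpow_natCast]; field_simp
    rw [this, norm_div, norm_mul, norm_pow, norm_pow, hu, hv, norm_sub_rev]
    simpa using norm_pow_sub_pow_le hu hv n

theorem norm_normalize_sub_le {z w : ℂ} (hz : z ≠ 0) (hw : w ≠ 0) :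
    ‖z / ‖z‖ - w / ‖w‖‖ ≤ 2 * ‖z - w‖ / ‖z‖ := by
  have hz' : (0 : ℝ) < ‖z‖ := norm_pos_iff.2 hz
  have hw' : (0 : ℝ) < ‖w‖ := norm_pos_iff.2 hw
  have hzc : (‖z‖ : ℂ) ≠ 0 := by exact_mod_cast hz'.ne'
  have hwc : (‖w‖ : ℂ) ≠ 0 := by exact_mod_cast hw'.ne'
  have : z / ‖z‖ - w / ‖w‖ = (z - w) / ‖z‖ + (w / ‖w‖) * ((‖w‖ - ‖z‖ : ℝ) : ℂ) / ‖z‖ := by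
    push_cast; field_simp; ring
  rw [this]
  refine (norm_add_le _ _).trans ?_
  rw [norm_div, norm_div, norm_mul, norm_div_norm hw, one_mul, Complex.norm_real,
    Complex.norm_real, norm_norm, Real.norm_eq_abs]
  have : |‖w‖ - ‖z‖| ≤ ‖z - w‖ := by rw [norm_sub_rev]; exact abs_norm_sub_norm_le w z
  rw [← add_div]
  gcongr
  linarith

theorem abs_rpow_neg_sub_le {r t s : ℝ} (hr : 0 < r) (ht : r / 2 ≤ t) (hs0 : 0 ≤ s) (hs : s ≤ 4) :
    |t ^ (-s) - r ^ (-s)| ≤ 4 * (r / 2) ^ (-s - 1) * |t - r| := by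
  have h : ∀ x ∈ Set.Ici (r / 2), HasDerivWithinAt (fun x : ℝ => x ^ (-s)) (-s * x ^ (-s - 1))
      (Set.Ici (r / 2)) x := fun x hx => by
    have : 0 < x := lt_of_lt_of_le (by linarith) hx
    exact (Real.hasDerivAt_rpow_const (Or.inl this.ne')).hasDerivWithinAt
  have hb : ∀ x ∈ Set.Ici (r / 2), ‖-s * x ^ (-s - 1)‖ ≤ 4 * (r / 2) ^ (-s - 1) := fun x hx => by
    have hx0 : 0 < x := lt_of_lt_of_le (by linarith : (0 : ℝ) < r / 2) hx
    rw [norm_mul, Real.norm_eq_abs, abs_neg, abs_of_nonneg hs0,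
      Real.norm_of_nonneg (Real.rpow_nonneg hx0.le _)]
    refine mul_le_mul hs ?_ (Real.rpow_nonneg hx0.le _) (by norm_num)
    have hr2 : 0 < r / 2 := by linarith
    exact Real.rpow_le_rpow_of_nonpos hr2 hx (by linarith)
  have := (convex_Ici (r / 2)).norm_image_sub_le_of_norm_hasDerivWithin_le h hb
    (x := r) (y := t) (by simp; linarith) ht
  simpa [Real.norm_eq_abs] using this

theorem norm_rpow_eq (z : GaussianInt) (σ : ℝ) : (z.norm : ℝ) ^ (-σ) = ‖(z : ℂ)‖ ^ (-(2 * σ)) := by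
  rw [norm_cast_eq_sq, ← Real.rpow_natCast, ← Real.rpow_mul (_root_.norm_nonneg _)]
  congr 1; push_cast; ring

/-- Smoothness of `lTerm` under small translations. -/
theorem norm_lTerm_add_sub_le (m : ℤ) {σ : ℝ} (h1 : 1 < σ) (h2 : σ ≤ 2) {z : GaussianInt}
    (hz : z ≠ 0) {b : GaussianInt} (hb : ‖(b : ℂ)‖ ≤ 4) :
    ‖lTerm m σ (z + b) - lTerm m σ z‖ ≤ (1024 + 8 * |(m : ℝ)|) * (z.norm : ℝ) ^ (-(3 / 2 : ℝ)) := by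
  have hz0 := toComplex_ne_zero hz
  set r := ‖(z : ℂ)‖ with hr
  have hr0 : 0 < r := norm_pos_iff.2 hz0
  have e32 : (z.norm : ℝ) ^ (-(3 / 2 : ℝ)) = r ^ (-3 : ℝ) := by
    rw [norm_rpow_eq, ← hr]; norm_num
  have hr1 : 1 ≤ r := by
    have := one_le_norm hz
    rw [norm_cast_eq_sq] at this
    nlinarith
  rw [e32]
  by_cases hr8 : r < 8
  · have : (1 / 512 : ℝ) ≤ r ^ (-3 : ℝ) := by
      rw [Real.rpow_neg hr0.le, one_div]
      apply inv_anti₀ (by positivity)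
      calc r ^ (3 : ℝ) = r ^ (3 : ℕ) := by rw [← Real.rpow_natCast]; norm_num
        _ ≤ 8 ^ 3 := by gcongr
        _ = 512 := by norm_num
    have h3 := norm_sub_le (lTerm m σ (z + b)) (lTerm m σ z)
    have h4 := norm_lTerm_le_one m (by linarith : 0 < σ) (z + b)
    have h5 := norm_lTerm_le_one m (by linarith : 0 < σ) z
    have h6 : 0 ≤ |(m : ℝ)| := abs_nonneg _
    nlinarith
  push Not at hr8
  have hdist : ‖((z + b : GaussianInt) : ℂ) - z‖ ≤ 4 := by
    rw [GaussianInt.toComplex_add, add_sub_cancel_left]; exact hb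
  set t := ‖((z + b : GaussianInt) : ℂ)‖ with htdef
  have htr : |t - r| ≤ 4 := (abs_norm_sub_norm_le _ _).trans hdist
  have ht : r / 2 ≤ t := by have := (abs_le.1 htr).1; linarith
  have hzb : z + b ≠ 0 := fun h => by
    rw [h, GaussianInt.toComplex_zero, norm_zero] at htdef; linarith
  have hzb0 := toComplex_ne_zero hzb
  have hA : ‖angChar m (z + b) - angChar m z‖ ≤ 8 * |(m : ℝ)| / r := by
    rw [angChar_apply hzb, angChar_apply hz, norm_sub_rev]
    refine (norm_zpow_sub_zpow_le (norm_div_norm hz0) (norm_div_norm hzb0) m).trans ?_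
    have h3 := norm_normalize_sub_le hz0 hzb0
    rw [norm_sub_rev (z : ℂ)] at h3
    calc |(m : ℝ)| * _ ≤ |(m : ℝ)| * (2 * 4 / r) := by
          gcongr; exact h3.trans (by gcongr)
      _ = _ := by ring
  have hB : |((z + b).norm : ℝ) ^ (-σ) - (z.norm : ℝ) ^ (-σ)| ≤ 1024 * r ^ (-3 : ℝ) := by
    rw [norm_rpow_eq, norm_rpow_eq]
    refine (abs_rpow_neg_sub_le hr0 ht (by linarith) (by linarith)).trans ?_
    have e1 : (r / 2) ^ (-(2 * σ) - 1) ≤ 32 * r ^ (-3 : ℝ) := by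
      rw [div_eq_mul_inv, Real.mul_rpow hr0.le (by norm_num), mul_comm]
      gcongr
      · rw [Real.inv_rpow (by norm_num), ← Real.rpow_neg (by norm_num)]
        calc (2 : ℝ) ^ (-(-(2 * σ) - 1)) ≤ 2 ^ (5 : ℝ) := by
              apply Real.rpow_le_rpow_of_exponent_le <;> linarith
          _ = 32 := by norm_num
      · linarith
    have : 0 ≤ r ^ (-3 : ℝ) := by positivity
    calc 4 * (r / 2) ^ (-(2 * σ) - 1) * |t - r| ≤ 4 * (32 * r ^ (-3 : ℝ)) * 4 := by gcongr
      _ ≤ _ := by linarith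
  have hzr : (z.norm : ℝ) ^ (-σ) ≤ r ^ (-2 : ℝ) := by
    rw [norm_rpow_eq]
    exact Real.rpow_le_rpow_of_exponent_le hr1 (by linarith)
  have hz1 : 0 ≤ (z.norm : ℝ) ^ (-σ) := by rw [norm_rpow_eq]; positivity
  have split : lTerm m σ (z + b) - lTerm m σ z =
      angChar m (z + b) * (((z + b).norm : ℝ) ^ (-σ) - (z.norm : ℝ) ^ (-σ) : ℝ) +
      (angChar m (z + b) - angChar m z) * ((z.norm : ℝ) ^ (-σ) : ℝ) := by
    unfold lTerm; push_cast; ring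
  rw [split]
  refine (norm_add_le _ _).trans ?_
  rw [norm_mul, norm_mul, Complex.norm_real, Complex.norm_real, Real.norm_eq_abs,
    Real.norm_of_nonneg hz1, norm_angChar hzb, one_mul, add_mul]
  refine add_le_add hB ?_
  calc ‖angChar m (z + b) - angChar m z‖ * (z.norm : ℝ) ^ (-σ)
      ≤ (8 * |(m : ℝ)| / r) * r ^ (-2 : ℝ) := by gcongr
    _ = 8 * |(m : ℝ)| * r ^ (-3 : ℝ) := by
      rw [show (-3 : ℝ) = -1 + -2 by norm_num, Real.rpow_add hr0, Real.rpow_neg_one]; ring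

/-- Division by `2 + i` with remainder in `{0, …, 4}`. -/
def divTwoAddI : Fin 5 × GaussianInt ≃ GaussianInt :=
  Equiv.ofBijective (fun x => ⟨2, 1⟩ * x.2 + ⟨x.1, 0⟩) (by
    constructor
    · rintro ⟨j, a, b⟩ ⟨j', a', b'⟩ h
      simp only [Zsqrtd.ext_iff, Zsqrtd.re_add, Zsqrtd.re_mul, Zsqrtd.im_add, Zsqrtd.im_mul] at h
      obtain ⟨h1, h2⟩ := h
      have := j.2
      have := j'.2
      have : (j : ℕ) = j' := by omega
      simp only [Prod.mk.injEq, Fin.ext_iff, Zsqrtd.ext_iff]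
      omega
    · rintro ⟨x, y⟩
      refine ⟨(⟨((x - 2 * y) % 5).toNat, by omega⟩, ⟨(2 * (x - (x - 2 * y) % 5) + y) / 5,
        (2 * y - (x - (x - 2 * y) % 5)) / 5⟩), ?_⟩
      simp only [Zsqrtd.ext_iff, Zsqrtd.re_add, Zsqrtd.re_mul, Zsqrtd.im_add, Zsqrtd.im_mul]
      omega)

theorem divTwoAddI_apply (j : Fin 5) (z : GaussianInt) :
    divTwoAddI (j, z) = ⟨2, 1⟩ * z + ⟨j, 0⟩ := rfl

theorem exists_norm_lValue_mul_le (m : ℤ) : ∃ C : ℝ, 0 < C ∧ ∀ σ : ℝ, 1 < σ → σ ≤ 2 →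
    ‖lValue m σ * (1 - 5 * lTerm m σ ⟨2, 1⟩)‖ ≤ C := by
  have hs32 := summable_norm_rpow (σ := 3 / 2) (by norm_num)
  set T := ∑' z : GaussianInt, (z.norm : ℝ) ^ (-(3 / 2 : ℝ)) with hT
  have hT0 : 0 ≤ T := tsum_nonneg fun z =>
    Real.rpow_nonneg (by exact_mod_cast GaussianInt.norm_nonneg z) _
  refine ⟨5 * ((1024 + 8 * |(m : ℝ)|) * T + 1), by positivity, fun σ h1 h2 => ?_⟩
  have hs := (summable_lTerm m h1).of_norm
  have hinj : ∀ j : Fin 5, Function.Injective fun z => divTwoAddI (j, z) := fun j z w h => by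
    simpa using h
  have hsj : ∀ j : Fin 5, Summable fun z => lTerm m σ (divTwoAddI (j, z)) := fun j =>
    hs.comp_injective (hinj j)
  have hsp : Summable fun c => lTerm m σ (divTwoAddI c) := (divTwoAddI.summable_iff).2 hs
  have hS : lValue m σ = ∑ j : Fin 5, ∑' z, lTerm m σ (divTwoAddI (j, z)) := by
    unfold lValue
    rw [← divTwoAddI.tsum_eq, Summable.tsum_prod' hsp hsj, tsum_fintype]
  have hα : ∀ z, lTerm m σ (⟨2, 1⟩ * z) = lTerm m σ ⟨2, 1⟩ * lTerm m σ z := fun z => lTerm_mul ..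
  have hsα : Summable fun z => lTerm m σ (⟨2, 1⟩ * z) := by
    simp_rw [hα]; exact hs.mul_left _
  have hdiff : lValue m σ * (1 - 5 * lTerm m σ ⟨2, 1⟩) =
      ∑ j : Fin 5, ∑' z, (lTerm m σ (divTwoAddI (j, z)) - lTerm m σ (⟨2, 1⟩ * z)) := by
    have : ∀ j : Fin 5, ∑' z, (lTerm m σ (divTwoAddI (j, z)) - lTerm m σ (⟨2, 1⟩ * z)) =
        ∑' z, lTerm m σ (divTwoAddI (j, z)) - lTerm m σ ⟨2, 1⟩ * lValue m σ := fun j => by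
      rw [(hsj j).tsum_sub hsα]
      congr 1
      simp_rw [hα]; rw [tsum_mul_left]; rfl
    simp_rw [this]
    rw [Finset.sum_sub_distrib, ← hS]
    simp; ring
  rw [hdiff]
  refine (norm_sum_le _ _).trans ?_
  have hj : ∀ j : Fin 5, ‖∑' z, (lTerm m σ (divTwoAddI (j, z)) - lTerm m σ (⟨2, 1⟩ * z))‖ ≤
      (1024 + 8 * |(m : ℝ)|) * T + 1 := by
    intro j
    have hsum0 : HasSum (fun z : GaussianInt => if z = 0 then (1 : ℝ) else 0) 1 :=
      hasSum_ite_eq 0 1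
    have hsumB : HasSum (fun z : GaussianInt => (1024 + 8 * |(m : ℝ)|) *
        (z.norm : ℝ) ^ (-(3 / 2 : ℝ)) + if z = 0 then (1 : ℝ) else 0)
        ((1024 + 8 * |(m : ℝ)|) * T + 1) := (hs32.hasSum.mul_left _).add hsum0
    refine tsum_of_norm_bounded hsumB fun z => ?_
    by_cases hz : z = 0
    · subst hz
      have e : lTerm m σ 0 = 0 := by simp [lTerm]
      have e2 : ((0 : ℤ) : ℝ) ^ (-(3 / 2 : ℝ)) = 0 := by
        rw [Int.cast_zero]; exact Real.zero_rpow (by norm_num)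
      simp only [mul_zero, e, sub_zero, Zsqrtd.norm_zero, e2, if_true, zero_add]
      exact norm_lTerm_le_one m (by linarith) _
    · rw [if_neg hz, add_zero, divTwoAddI_apply]
      have hαz : (⟨2, 1⟩ : GaussianInt) * z ≠ 0 := mul_ne_zero (by
        intro h; have := congrArg Zsqrtd.im h; simp at this) hz
      have hb : ‖((⟨(j : ℕ), 0⟩ : GaussianInt) : ℂ)‖ ≤ 4 := by
        rw [GaussianInt.toComplex_def']
        have : (j : ℕ) ≤ 4 := by omega
        simpa using (by exact_mod_cast this : ((j : ℕ) : ℝ) ≤ 4)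
      refine (norm_lTerm_add_sub_le m h1 h2 hαz hb).trans ?_
      refine mul_le_mul_of_nonneg_left ?_ (by positivity)
      rw [Zsqrtd.norm_mul]
      have hz1 := one_le_norm hz
      have hz0 : (0 : ℝ) < (z.norm : ℝ) := by linarith
      have h32 : (-(3 / 2) : ℝ) ≤ 0 := by norm_num
      refine Real.rpow_le_rpow_of_nonpos hz0 ?_ h32
      have : (⟨2, 1⟩ : GaussianInt).norm = 5 := by simp [Zsqrtd.norm_def]
      rw [this]; push_cast
      linarith [one_le_norm hz]
  calc _ ≤ ∑ _j : Fin 5, ((1024 + 8 * |(m : ℝ)|) * T + 1) := Finset.sum_le_sum fun j _ => hj j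
    _ = _ := by simp; ring

theorem angChar_two_add_I_ne_one {m : ℤ} (hm : m ≠ 0) : angChar m ⟨2, 1⟩ ≠ 1 := by
  have h40 : (4 : ZMod 5) ≠ 0 := by decide
  have key : ∀ n : ℕ, n ≠ 0 → angChar n ⟨2, 1⟩ ≠ 1 := by
    intro n hn h
    have hne : (⟨2, 1⟩ : GaussianInt) ≠ 0 := by
      intro h; have := congrArg Zsqrtd.im h; simp at this
    rw [angChar_apply hne, zpow_natCast, div_pow, div_eq_one_iff_eq] at h
    swap
    · exact pow_ne_zero n (by exact_mod_cast norm_ne_zero_iff.2 (toComplex_ne_zero hne))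
    have h2 : (((⟨2, 1⟩ : GaussianInt) ^ n * ⟨2, 1⟩ ^ n : GaussianInt) : ℂ) =
        (((5 : GaussianInt) ^ n : GaussianInt) : ℂ) := by
      rw [map_mul, map_pow, h, ← mul_pow, ← sq, ← Complex.ofReal_pow, ← norm_cast_eq_sq]
      rw [map_pow, map_ofNat]; simp [Zsqrtd.norm_def]
    have h3 := GaussianInt.toComplex_injective h2
    have h5 : (5 : GaussianInt) = ⟨2, 1⟩ * ⟨2, -1⟩ := by
      rw [Zsqrtd.ext_iff]; constructor <;> norm_num
    rw [h5, mul_pow] at h3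
    have h4 := mul_left_cancel₀ (pow_ne_zero n hne) h3
    have hf : ∃ φ : GaussianInt →+* ZMod 5, φ ⟨2, 1⟩ = 4 ∧ φ ⟨2, -1⟩ = 0 := by
      refine ⟨Zsqrtd.lift ⟨2, by decide⟩, ?_, ?_⟩ <;> simp [Zsqrtd.lift] <;> decide
    obtain ⟨φ, h6, h7⟩ := hf
    have h8 := congrArg φ h4
    rw [map_pow, map_pow, h6, h7, zero_pow hn] at h8
    have : Fact (Nat.Prime 5) := ⟨by norm_num⟩
    exact h40 (pow_eq_zero_iff hn |>.1 h8)
  obtain ⟨n, rfl | rfl⟩ := m.eq_nat_or_neg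
  · exact key n (by simpa using hm)
  · intro h
    have hne : (⟨2, 1⟩ : GaussianInt) ≠ 0 := by
      intro h; have := congrArg Zsqrtd.im h; simp at this
    apply key n (by simpa using hm)
    rw [angChar_apply hne, _root_.zpow_neg, inv_eq_one] at h
    rw [angChar_apply hne, h]

theorem five_mul_lTerm (m : ℤ) (σ : ℝ) :
    5 * lTerm m σ ⟨2, 1⟩ = ((5 : ℝ) ^ (1 - σ) : ℝ) * angChar m ⟨2, 1⟩ := by
  unfold lTerm
  have : (⟨2, 1⟩ : GaussianInt).norm = 5 := by simp [Zsqrtd.norm_def]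
  rw [this, sub_eq_add_neg, Real.rpow_add (by norm_num), Real.rpow_one]
  push_cast; ring

/-- The `L`-value of a nontrivial angular character stays bounded as `σ → 1`. -/
theorem exists_norm_lValue_le {m : ℤ} (hm : m ≠ 0) :
    ∃ C : ℝ, 0 < C ∧ ∀ σ : ℝ, 1 < σ → σ ≤ 2 → ‖lValue m σ‖ ≤ C := by
  obtain ⟨C, hC, h⟩ := exists_norm_lValue_mul_le m
  set ω := angChar m ⟨2, 1⟩ with hω
  have hne : (⟨2, 1⟩ : GaussianInt) ≠ 0 := by
    intro h; have := congrArg Zsqrtd.im h; simp at this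
  have hω1 : ‖ω‖ = 1 := norm_angChar hne
  have hpos : 0 < ‖1 - ω‖ := norm_pos_iff.2 (sub_ne_zero.2 (angChar_two_add_I_ne_one hm).symm)
  refine ⟨C * 2 / ‖1 - ω‖, by positivity, fun σ h1 h2 => ?_⟩
  have := h σ h1 h2
  rw [five_mul_lTerm, ← hω, norm_mul] at this
  set t := (5 : ℝ) ^ (1 - σ) with ht
  have ht0 : 0 < t := by positivity
  have ht1 : t ≤ 1 := Real.rpow_le_one_of_one_le_of_nonpos (by norm_num) (by linarith)
  have h3 : ‖(t : ℂ) * ω‖ = t := by rw [norm_mul, hω1, Complex.norm_real, Real.norm_of_nonneg ht0.le, mul_one]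
  have h4 : 1 - t ≤ ‖1 - (t : ℂ) * ω‖ := by
    have := norm_sub_norm_le (1 : ℂ) ((t : ℂ) * ω)
    rwa [h3, norm_one] at this
  have h5 : ‖1 - ω‖ ≤ ‖1 - (t : ℂ) * ω‖ + (1 - t) := by
    have : 1 - ω = (1 - (t : ℂ) * ω) + -((1 - t : ℝ) : ℂ) * ω := by push_cast; ring
    rw [this]
    refine (norm_add_le _ _).trans ?_
    rw [norm_mul, hω1, norm_neg, Complex.norm_real, Real.norm_of_nonneg (by linarith), mul_one]
  rw [le_div_iff₀ hpos]
  nlinarith [_root_.norm_nonneg (lValue m σ)]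

/-- The `L`-value of the trivial angular character is `O(1 / (σ - 1))`. -/
theorem exists_norm_lValue_zero_le :
    ∃ C : ℝ, 0 < C ∧ ∀ σ : ℝ, 1 < σ → σ ≤ 2 → ‖lValue 0 σ‖ ≤ C / (σ - 1) := by
  obtain ⟨C, hC, h⟩ := exists_norm_lValue_mul_le 0
  have hne : (⟨2, 1⟩ : GaussianInt) ≠ 0 := by
    intro h; have := congrArg Zsqrtd.im h; simp at this
  refine ⟨2 * C, by positivity, fun σ h1 h2 => ?_⟩
  have := h σ h1 h2
  rw [five_mul_lTerm, angChar_zero_apply hne, mul_one, norm_mul, ← Complex.ofReal_one,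
    ← Complex.ofReal_sub, Complex.norm_real] at this
  have ht : (5 : ℝ) ^ (1 - σ) ≤ 1 - (σ - 1) / 2 := by
    refine le_trans ?_ (half_rpow_le (t := σ - 1) (by linarith) (by linarith))
    rw [one_div, Real.inv_rpow (by norm_num), ← Real.rpow_neg (by norm_num), neg_sub]
    exact Real.rpow_le_rpow_of_nonpos (by norm_num) (by norm_num) (by linarith)
  rw [le_div_iff₀ (by linarith)]
  have h3 : (σ - 1) / 2 ≤ ‖1 - (5 : ℝ) ^ (1 - σ)‖ := by
    rw [Real.norm_eq_abs]
    exact le_trans (by linarith) (le_abs_self _)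
  nlinarith [_root_.norm_nonneg (lValue 0 σ)]

/-- The Gaussian integers of norm `n`. -/
def normFiber (n : ℕ) : Finset GaussianInt :=
  ((Finset.Icc (-n : ℤ) n ×ˢ Finset.Icc (-n : ℤ) n).image
    fun x => (⟨x.1, x.2⟩ : GaussianInt)).filter fun z => z.norm = n

theorem mem_normFiber {n : ℕ} {z : GaussianInt} : z ∈ normFiber n ↔ z.norm = n := by
  simp only [normFiber, Finset.mem_filter, Finset.mem_image, Finset.mem_product, Finset.mem_Icc,
    Prod.exists, and_iff_right_iff_imp]
  intro h
  rw [norm_eq_re_sq_add_im_sq] at h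
  refine ⟨z.re, z.im, ⟨⟨?_, ?_⟩, ?_, ?_⟩, rfl⟩ <;> nlinarith [sq_nonneg z.re, sq_nonneg z.im,
    sq_nonneg (z.re - 1), sq_nonneg (z.re + 1), sq_nonneg (z.im - 1), sq_nonneg (z.im + 1)]

theorem normFiber_one : normFiber 1 = {1, -1, ⟨0, 1⟩, ⟨0, -1⟩} := by decide

theorem card_normFiber_one : (normFiber 1).card = 4 := by decide

theorem mul_star_eq_norm (z : GaussianInt) : z * star z = (z.norm : GaussianInt) :=
  (Zsqrtd.norm_eq_mul_conj z).symm

theorem norm_star (z : GaussianInt) : (star z).norm = z.norm := Zsqrtd.norm_conj z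

theorem natCast_dvd_iff {a b : ℤ} : (a : GaussianInt) ∣ b ↔ a ∣ b :=
  Zsqrtd.intCast_dvd_intCast a b

theorem exists_mul_eq_of_norm_eq_mul {m n : ℕ} (h : m.Coprime n) {t : GaussianInt}
    (ht : t.norm = m * n) : ∃ z w : GaussianInt, z.norm = m ∧ z * w = t := by
  obtain ⟨x, y, hxy⟩ : ∃ x y : ℤ, x * m + y * n = 1 := by
    have := Nat.isCoprime_iff_coprime.2 h
    exact this
  set g := EuclideanDomain.gcd t (m : GaussianInt) with hg
  have hgt : g ∣ t := EuclideanDomain.gcd_dvd_left _ _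
  have hgm : g ∣ (m : GaussianInt) := EuclideanDomain.gcd_dvd_right _ _
  obtain ⟨w, hw⟩ := hgt
  refine ⟨g, w, ?_, hw.symm⟩
  have htt : t * star t = (m : GaussianInt) * n := by
    rw [mul_star_eq_norm, ht]; push_cast; rfl
  have h1 : (m : ℤ) ∣ g.norm := by
    rw [← natCast_dvd_iff, ← mul_star_eq_norm]
    have hb := EuclideanDomain.gcd_eq_gcd_ab t (m : GaussianInt)
    rw [← hg] at hb
    set a := EuclideanDomain.gcdA t (m : GaussianInt)
    set b := EuclideanDomain.gcdB t (m : GaussianInt)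
    refine ⟨a * star a * n + t * a * star b + star t * star a * b + m * b * star b, ?_⟩
    have hs : star (m : GaussianInt) = m := star_natCast m
    rw [hb]
    simp only [star_add, star_mul, hs]
    push_cast
    linear_combination (a * star a) * htt
  have h2 : g.norm ∣ (m : ℤ) := by
    rw [← natCast_dvd_iff, ← mul_star_eq_norm]
    have e : ((m : ℤ) : GaussianInt) = (m : GaussianInt) * m * x + t * star t * y := by
      have := congrArg (fun k : ℤ => (k : GaussianInt)) hxy
      push_cast at this ⊢
      linear_combination (-(m : GaussianInt)) * this - y * htt
    rw [e]
    have hgs : star g ∣ (m : GaussianInt) := by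
      obtain ⟨c, hc⟩ := hgm
      exact ⟨star c, by rw [mul_comm, ← star_mul, mul_comm, mul_comm c, ← hc, star_natCast]⟩
    refine dvd_add (Dvd.dvd.mul_right (mul_dvd_mul hgm hgs) _) (Dvd.dvd.mul_right ?_ _)
    exact ⟨w * star w, by rw [hw, star_mul]; ring⟩
  exact Int.dvd_antisymm (GaussianInt.norm_nonneg g) (by positivity) h2 h1

theorem associated_of_dvd_of_norm_eq {z w : GaussianInt} (h : z ∣ w) (hn : z.norm = w.norm)
    (hz : z ≠ 0) : ∃ u ∈ normFiber 1, w = z * u := by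
  obtain ⟨u, rfl⟩ := h
  refine ⟨u, mem_normFiber.2 ?_, rfl⟩
  rw [Zsqrtd.norm_mul] at hn
  have : z.norm ≠ 0 := (GaussianInt.norm_pos.2 hz).ne'
  push_cast
  have := mul_left_cancel₀ this (hn.symm.trans (mul_one _).symm)
  exact this

theorem isCoprime_of_norm {m n : ℕ} (h : m.Coprime n) {z w : GaussianInt} (hz : z.norm = m)
    (hw : w.norm = n) : IsCoprime z w := by
  obtain ⟨x, y, hxy⟩ : IsCoprime (m : ℤ) n := Nat.isCoprime_iff_coprime.2 h
  refine ⟨x * star z, y * star w, ?_⟩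
  have h1 := mul_star_eq_norm z
  have h2 := mul_star_eq_norm w
  rw [hz] at h1
  rw [hw] at h2
  have := congrArg (fun k : ℤ => (k : GaussianInt)) hxy
  push_cast at this h1 h2
  linear_combination this + x * h1 + y * h2

theorem card_filter_mul_eq {m n : ℕ} (hm : m ≠ 0) (hn : n ≠ 0) (h : m.Coprime n) {t : GaussianInt}
    (ht : t ∈ normFiber (m * n)) :
    ((normFiber m ×ˢ normFiber n).filter fun x => x.1 * x.2 = t).card = 4 := by
  have ht' := mem_normFiber.1 ht
  push_cast at ht'
  obtain ⟨z, w, hz, rfl⟩ := exists_mul_eq_of_norm_eq_mul h ht'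
  have hw : w.norm = n := by
    rw [Zsqrtd.norm_mul, hz] at ht'
    exact mul_left_cancel₀ (by exact_mod_cast hm) ht'
  have hz0 : z ≠ 0 := by rintro rfl; simp at hz; exact hm (by exact_mod_cast hz.symm)
  have hw0 : w ≠ 0 := by rintro rfl; simp at hw; exact hn (by exact_mod_cast hw.symm)
  rw [← card_normFiber_one]
  symm
  apply Finset.card_bij (fun u _ => (z * u, star u * w))
  · intro u hu
    have hu' := mem_normFiber.1 hu
    simp only [Finset.mem_filter, Finset.mem_product, mem_normFiber, Zsqrtd.norm_mul, norm_star,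
      hu', hz, hw]
    refine ⟨⟨by simp, by simp⟩, ?_⟩
    have := mul_star_eq_norm u
    rw [hu'] at this
    push_cast at this
    linear_combination (z * w) * this
  · intro u _ v _ huv
    exact mul_left_cancel₀ hz0 (Prod.ext_iff.1 huv).1
  · rintro ⟨z', w'⟩ hx
    simp only [Finset.mem_filter, Finset.mem_product, mem_normFiber] at hx
    obtain ⟨⟨hz', hw'⟩, he⟩ := hx
    have hd : z ∣ z' := by
      refine (isCoprime_of_norm h hz hw').dvd_of_dvd_mul_right ?_
      rw [he]; exact dvd_mul_right _ _
    obtain ⟨u, hu, rfl⟩ := associated_of_dvd_of_norm_eq hd (hz.trans hz'.symm) hz0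
    refine ⟨u, hu, ?_⟩
    have := mul_star_eq_norm u
    rw [mem_normFiber.1 hu] at this
    push_cast at this
    rw [mul_assoc] at he
    have := mul_left_cancel₀ hz0 he
    ext1
    · rfl
    · show star u * w = w'
      rw [← this]
      linear_combination w' * mul_star_eq_norm u + w' * congrArg (fun k : ℤ => (k : GaussianInt)) (mem_normFiber.1 hu)

/-- The sum of `ψ` over the Gaussian integers of norm `n`. -/
def normSum (ψ : GaussianInt → ℂ) (n : ℕ) : ℂ := ∑ z ∈ normFiber n, ψ z

theorem normSum_mul_normSum {ψ : GaussianInt → ℂ} (hψ : ∀ z w, ψ (z * w) = ψ z * ψ w) {m n : ℕ}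
    (hm : m ≠ 0) (hn : n ≠ 0) (h : m.Coprime n) :
    normSum ψ m * normSum ψ n = 4 * normSum ψ (m * n) := by
  unfold normSum
  rw [Finset.sum_mul_sum, ← Finset.sum_product', Finset.mul_sum,
    ← Finset.sum_fiberwise_of_maps_to (s := normFiber m ×ˢ normFiber n) (t := normFiber (m * n))
      (g := fun x => x.1 * x.2)]
  · refine Finset.sum_congr rfl fun t ht => ?_
    rw [Finset.sum_congr rfl (g := fun _ => ψ t), Finset.sum_const, card_filter_mul_eq hm hn h ht]
    · simp
    · intro x hx
      rw [← hψ, (Finset.mem_filter.1 hx).2]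
  · rintro ⟨z, w⟩ hx
    simp only [Finset.mem_product, mem_normFiber] at hx ⊢
    rw [Zsqrtd.norm_mul, hx.1, hx.2]; push_cast; rfl

theorem norm_normSum_le {ψ : GaussianInt → ℂ} (hψ : ∀ z, ‖ψ z‖ ≤ 1) (n : ℕ) :
    ‖normSum ψ n‖ ≤ (normFiber n).card := by
  refine (norm_sum_le _ _).trans ?_
  simpa using Finset.sum_le_sum fun z (_ : z ∈ normFiber n) => hψ z

open scoped Classical in
theorem card_filter_dvd_le {π : GaussianInt} (hπ : π ≠ 0) {a b : ℕ}
    (hπa : π.norm * (b : ℤ) = a) :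
    ((normFiber a).filter fun z => π ∣ z).card ≤ (normFiber b).card := by
  have : (normFiber a).filter (fun z => π ∣ z) ⊆ (normFiber b).image (fun z => π * z) := by
    intro z hz
    simp only [Finset.mem_filter, mem_normFiber] at hz
    obtain ⟨hz, w, rfl⟩ := hz
    simp only [Finset.mem_image, mem_normFiber]
    refine ⟨w, ?_, rfl⟩
    rw [Zsqrtd.norm_mul, ← hπa] at hz
    exact mul_left_cancel₀ (GaussianInt.norm_pos.2 hπ).ne' hz
  exact (Finset.card_le_card this).trans Finset.card_image_le

open scoped Classical in
theorem card_filter_dvd_eq_le {w : GaussianInt} (hw : w ≠ 0) {a : ℕ} (hwa : w.norm = a) :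
    ((normFiber a).filter fun z => z ∣ w).card ≤ 4 := by
  have : (normFiber a).filter (fun z => z ∣ w) ⊆ (normFiber 1).image (fun u => w * star u) := by
    intro z hz
    simp only [Finset.mem_filter, mem_normFiber] at hz
    obtain ⟨hz, hd⟩ := hz
    have hz0 : z ≠ 0 := by rintro rfl; exact hw (zero_dvd_iff.1 hd)
    obtain ⟨u, hu, rfl⟩ := associated_of_dvd_of_norm_eq hd (hz.trans hwa.symm) hz0
    refine Finset.mem_image.2 ⟨u, hu, ?_⟩
    rw [mul_assoc, mul_star_eq_norm, mem_normFiber.1 hu]; simp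
  refine (Finset.card_le_card this).trans (Finset.card_image_le.trans ?_)
  rw [card_normFiber_one]

open scoped Classical in
theorem card_normFiber_prime_pow_le {q : ℕ} (hq : q.Prime) (j : ℕ) :
    (normFiber (q ^ j)).card ≤ 4 * (j + 1) := by
  have hq0 : (q : GaussianInt) ≠ 0 := by exact_mod_cast hq.ne_zero
  have hqn : ((q : GaussianInt)).norm = (q : ℤ) ^ 2 := by
    rw [Zsqrtd.norm_natCast]; ring
  have hqu : ¬ IsUnit (q : GaussianInt) := by
    rw [← Zsqrtd.norm_eq_one_iff, hqn]
    have := hq.one_lt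
    intro h
    rw [Int.natAbs_pow, Int.natAbs_natCast] at h
    nlinarith
  obtain ⟨π, hπ, hπq⟩ := WfDvdMonoid.exists_irreducible_factor hqu hq0
  have hπp : Prime π := hπ.prime
  have hπ0 := hπ.ne_zero
  obtain ⟨ρ, hρ⟩ := hπq
  have hpq : π.norm * ρ.norm = (q : ℤ) ^ 2 := by rw [← hqn, hρ, Zsqrtd.norm_mul]
  have hπn1 : π.norm ≠ 1 := by
    intro h
    exact hπ.not_isUnit (Zsqrtd.norm_eq_one_iff.1 (by rw [h]; rfl))
  have hcases : π.norm = q ∨ π.norm = (q : ℤ) ^ 2 := by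
    have hd : π.norm.natAbs ∣ q ^ 2 := by
      have : π.norm ∣ ((q ^ 2 : ℕ) : ℤ) := ⟨ρ.norm, by push_cast; exact hpq.symm⟩
      exact Int.natAbs_dvd_natAbs.2 this
    obtain ⟨i, hi, he⟩ := (Nat.dvd_prime_pow hq).1 hd
    have hnn := GaussianInt.norm_nonneg π
    have he' : π.norm = (q : ℤ) ^ i := by
      have : (π.norm.natAbs : ℤ) = ((q ^ i : ℕ) : ℤ) := by rw [he]
      push_cast at this
      rwa [abs_of_nonneg hnn] at this
    interval_cases i
    · simp at he'; exact absurd he' hπn1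
    · left; simpa using he'
    · right; exact he'
  have hcop : ∀ (j : ℕ) (z : GaussianInt), z.norm = ((q ^ j : ℕ) : ℤ) → ¬ π ∣ z → z ∣ ρ ^ j := by
    intro j z hz hnd
    have h1 : z ∣ π ^ j * ρ ^ j := by
      rw [← mul_pow, ← hρ]
      exact ⟨star z, by rw [mul_star_eq_norm, hz]; push_cast; rfl⟩
    exact (((Irreducible.coprime_iff_not_dvd hπ).2 hnd).symm.pow_right).dvd_of_dvd_mul_left h1
  have hsplit : ∀ j, (normFiber (q ^ j)).card = ((normFiber (q ^ j)).filter fun z => π ∣ z).card +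
      ((normFiber (q ^ j)).filter fun z => ¬ π ∣ z).card := fun j =>
    (Finset.card_filter_add_card_filter_not _).symm
  rcases hcases with h | h
  · have hρn : ρ.norm = q := by
      rw [h, sq] at hpq
      exact mul_left_cancel₀ (by exact_mod_cast hq.ne_zero) hpq
    have hρ0 : ρ ≠ 0 := by rintro rfl; exact hq0 (by rw [hρ, mul_zero])
    induction j with
    | zero => simp [card_normFiber_one]
    | succ j ih =>
      have h1 : ((normFiber (q ^ (j + 1))).filter fun z => π ∣ z).card ≤ (normFiber (q ^ j)).card :=
        card_filter_dvd_le hπ0 (by rw [h]; push_cast; ring)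
      have h2 : ((normFiber (q ^ (j + 1))).filter fun z => ¬ π ∣ z).card ≤ 4 := by
        refine le_trans (Finset.card_le_card ?_)
          (card_filter_dvd_eq_le (w := ρ ^ (j + 1)) (pow_ne_zero _ hρ0) (a := q ^ (j + 1)) ?_)
        · intro z hz
          rw [Finset.mem_filter] at hz ⊢
          exact ⟨hz.1, hcop _ z (mem_normFiber.1 hz.1) hz.2⟩
        · have := map_pow (Zsqrtd.normMonoidHom (d := -1)) ρ (j + 1)
          simp only [Zsqrtd.normMonoidHom, MonoidHom.coe_mk, OneHom.coe_mk] at this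
          rw [this, hρn]; push_cast; rfl
      rw [hsplit]
      omega
  · have hρn : ρ.norm = 1 := by
      rw [h] at hpq
      have : ((q : ℤ) ^ 2) ≠ 0 := by exact_mod_cast pow_ne_zero 2 hq.ne_zero
      exact mul_left_cancel₀ this (hpq.trans (mul_one _).symm)
    have hρu : IsUnit ρ := Zsqrtd.norm_eq_one_iff.1 (by rw [hρn]; rfl)
    have hnone : ∀ j, ((normFiber (q ^ (j + 1))).filter fun z => ¬ π ∣ z) = ∅ := by
      intro j
      rw [Finset.filter_eq_empty_iff]
      intro z hz hnd
      have hu : IsUnit z := isUnit_of_dvd_unit (hcop _ z (mem_normFiber.1 hz) hnd) (hρu.pow _)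
      have h1 := Zsqrtd.norm_eq_one_iff.2 hu
      rw [mem_normFiber.1 hz, Int.natAbs_natCast] at h1
      exact (Nat.one_lt_pow (Nat.succ_ne_zero j) hq.one_lt).ne' h1
    induction j using Nat.strong_induction_on with
    | _ j ih =>
      match j, ih with
      | 0, _ => simp [card_normFiber_one]
      | 1, _ =>
        rw [hsplit, hnone, Finset.card_empty, add_zero, Finset.filter_eq_empty_iff.2]
        · simp
        rintro z hz ⟨w, rfl⟩
        have := mem_normFiber.1 hz
        rw [Zsqrtd.norm_mul, h] at this
        push_cast at this
        have hw := GaussianInt.norm_nonneg w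
        have hq1 : (2 : ℤ) ≤ q := by exact_mod_cast hq.two_le
        have h3 : (q : ℤ) * (q * w.norm) = q * 1 := by linear_combination this
        have h4 := mul_left_cancel₀ (by omega) h3
        rcases Int.eq_one_or_neg_one_of_mul_eq_one h4 with h5 | h5 <;> omega
      | (j + 2), ih =>
        have h1 : ((normFiber (q ^ (j + 2))).filter fun z => π ∣ z).card ≤
            (normFiber (q ^ j)).card :=
          card_filter_dvd_le hπ0 (by rw [h]; push_cast; ring)
        rw [hsplit, hnone, Finset.card_empty]
        have := ih j (by omega)
        omega

/-- A representative of the class of associates of a Gaussian integer. -/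
def assocRep (z : GaussianInt) : GaussianInt := Quot.out (Associates.mk z)

theorem associated_assocRep (z : GaussianInt) : Associated (assocRep z) z :=
  Associates.mk_quot_out z

theorem assocRep_eq {z w : GaussianInt} (h : Associated z w) : assocRep z = assocRep w := by
  unfold assocRep; rw [Associates.mk_eq_mk_iff_associated.2 h]

open scoped Classical in
/-- The Gaussian primes of norm at most `X`. -/
def primesNormLe (X : ℕ) : Finset GaussianInt :=
  ((Finset.range (X + 1)).biUnion normFiber).filter Prime

theorem mem_primesNormLe {X : ℕ} {z : GaussianInt} :
    z ∈ primesNormLe X ↔ Prime z ∧ z.norm ≤ X := by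
  simp only [primesNormLe, Finset.mem_filter, Finset.mem_biUnion, Finset.mem_range, mem_normFiber]
  constructor
  · rintro ⟨⟨n, hn, h⟩, hz⟩
    exact ⟨hz, by omega⟩
  · rintro ⟨hz, h⟩
    have := GaussianInt.norm_nonneg z
    exact ⟨⟨z.norm.toNat, by omega, by omega⟩, hz⟩

open scoped Classical in
/-- Representatives of the Gaussian primes of norm at most `X` up to units. -/
def primeRepsNormLe (X : ℕ) : Finset GaussianInt := (primesNormLe X).image assocRep

open scoped Classical in
/-- Sieving a completely multiplicative function by finitely many primes. -/
theorem tsum_sieve {f : GaussianInt → ℂ} (hmul : ∀ z w, f (z * w) = f z * f w)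
    (hs : Summable fun z => ‖f z‖) (P : Finset GaussianInt) (hP : ∀ π ∈ P, Prime π)
    (hP' : ∀ π ∈ P, ∀ ρ ∈ P, Associated π ρ → π = ρ) :
    ∑' z, (if ∀ π ∈ P, ¬ π ∣ z then f z else 0) = (∑' z, f z) * ∏ π ∈ P, (1 - f π) := by
  have hsum : ∀ Q : GaussianInt → Prop, Summable fun z => if Q z then f z else 0 := fun Q =>
    Summable.of_norm_bounded hs fun z => by split_ifs <;> simp
  induction P using Finset.induction_on with
  | empty => simp
  | insert π P hπP ih =>
    have ih' := ih (fun ρ hρ => hP ρ (Finset.mem_insert_of_mem hρ))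
      (fun ρ hρ τ hτ => hP' ρ (Finset.mem_insert_of_mem hρ) τ (Finset.mem_insert_of_mem hτ))
    have hπ := hP π (Finset.mem_insert_self _ _)
    set g : GaussianInt → ℂ := fun z => if ∀ ρ ∈ P, ¬ ρ ∣ z then f z else 0 with hg
    have hgπ : ∀ z, g (π * z) = f π * g z := by
      intro z
      have : (∀ ρ ∈ P, ¬ ρ ∣ π * z) ↔ ∀ ρ ∈ P, ¬ ρ ∣ z := by
        refine forall₂_congr fun ρ hρ => not_congr ⟨fun h => ?_, fun h => h.mul_left _⟩
        have hρp := hP ρ (Finset.mem_insert_of_mem hρ)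
        refine (hρp.dvd_or_dvd h).resolve_left fun h => hπP ?_
        have := hP' ρ (Finset.mem_insert_of_mem hρ) π (Finset.mem_insert_self _ _)
          (hρp.associated_of_dvd hπ h)
        rwa [this] at hρ
      simp only [hg, this, hmul]
      split_ifs <;> simp
    have h1 : ∑' z, (if π ∣ z then g z else 0) = f π * ∑' z, g z := by
      have hinj : Function.Injective fun z => π * z := fun z w h => mul_left_cancel₀ hπ.ne_zero h
      rw [← tsum_mul_left, ← hinj.tsum_eq]
      · refine tsum_congr fun z => ?_
        rw [if_pos (dvd_mul_right _ _), hgπ]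
      · intro z hz
        rw [Function.mem_support] at hz
        obtain ⟨w, hw⟩ : π ∣ z := by by_contra h; simp [h] at hz
        exact ⟨w, hw.symm⟩
    have h2 : ∀ z, (if ∀ ρ ∈ insert π P, ¬ ρ ∣ z then f z else 0) =
        g z - if π ∣ z then g z else 0 := by
      intro z
      simp only [hg, Finset.forall_mem_insert]
      by_cases h : π ∣ z <;> simp [h]
    have hs2 : Summable fun z => if π ∣ z then g z else 0 := by
      have := hsum fun z => π ∣ z ∧ ∀ ρ ∈ P, ¬ ρ ∣ z
      refine this.congr fun z => ?_
      by_cases h : π ∣ z <;> simp [h, hg]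
    have hs1 : Summable g := Summable.of_norm_bounded hs fun z => by
      simp only [hg]; split_ifs <;> simp
    rw [tsum_congr h2, Summable.tsum_sub hs1 hs2, h1, ih', Finset.prod_insert hπP]
    ring

theorem norm_one_sub_le_exp (w : ℂ) : ‖1 - w‖ ≤ Real.exp (-w.re + ‖w‖ ^ 2 / 2) := by
  have h : ‖1 - w‖ ^ 2 ≤ Real.exp (-w.re + ‖w‖ ^ 2 / 2) ^ 2 := by
    rw [← Real.exp_nat_mul]
    refine le_trans ?_ (Real.add_one_le_exp _)
    rw [← Complex.normSq_eq_norm_sq, ← Complex.normSq_eq_norm_sq, Complex.normSq_apply,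
      Complex.normSq_apply]
    simp
    nlinarith
  exact (pow_le_pow_iff_left₀ (_root_.norm_nonneg _) (Real.exp_pos _).le two_ne_zero).1 h

theorem isUnit_iff_mem_normFiber {z : GaussianInt} : IsUnit z ↔ z ∈ normFiber 1 := by
  rw [mem_normFiber, ← Zsqrtd.norm_eq_one_iff]
  have := GaussianInt.norm_nonneg z
  push_cast
  omega

theorem angChar_unit {m : ℤ} (hm : 4 ∣ m) {u : GaussianInt} (hu : u ∈ normFiber 1) :
    angChar m u = 1 := by
  obtain ⟨k, rfl⟩ := hm
  have hu0 : u ≠ 0 := (isUnit_iff_mem_normFiber.2 hu).ne_zero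
  rw [angChar_apply hu0, _root_.zpow_mul]
  have : ((u : ℂ) / ‖(u : ℂ)‖) ^ (4 : ℤ) = 1 := by
    rw [normFiber_one] at hu
    simp only [Finset.mem_insert, Finset.mem_singleton] at hu
    have e4 : ((4 : ℤ)) = ((4 : ℕ) : ℤ) := rfl
    rw [e4, zpow_natCast]
    rcases hu with rfl | rfl | rfl | rfl
    · simp
    · simp
      norm_num
    · rw [GaussianInt.toComplex_def']; simp
    · rw [GaussianInt.toComplex_def']; simp
      rw [Even.neg_pow (by decide)]; simp
  rw [this, _root_.one_zpow]

theorem prime_of_norm_prime {p : ℕ} (hp : p.Prime) {z : GaussianInt} (hz : z.norm = p) :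
    Prime z := by
  refine Irreducible.prime ⟨?_, fun a b h => ?_⟩
  · rw [← Zsqrtd.norm_eq_one_iff, hz, Int.natAbs_natCast]; exact hp.one_lt.ne'
  · rw [← Zsqrtd.norm_eq_one_iff, ← Zsqrtd.norm_eq_one_iff]
    have : a.norm.natAbs * b.norm.natAbs = p := by
      rw [← Int.natAbs_mul, ← Zsqrtd.norm_mul, ← h, hz, Int.natAbs_natCast]
    have := Nat.prime_mul_iff.1 (this ▸ hp)
    tauto

/-- The sum of `f` over Gaussian primes is bounded by the logarithm of its `L`-value. -/
theorem eventually_sum_primeReps_le {m : ℤ} (hm : 4 ∣ m) {σ : ℝ} (h1 : 1 < σ) :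
    ∀ᶠ X : ℕ in atTop, ∑ π ∈ primeRepsNormLe X, (lTerm m σ π).re ≤
      Real.log ‖lValue m σ‖ + ∑' z : GaussianInt, (z.norm : ℝ) ^ (-2 : ℝ) := by
  classical
  have hs := summable_lTerm m h1
  have hprime : ∀ X, ∀ π ∈ primeRepsNormLe X, Prime π := by
    intro X π hπ
    obtain ⟨z, hz, rfl⟩ := Finset.mem_image.1 hπ
    exact (associated_assocRep z).symm.prime (mem_primesNormLe.1 hz).1
  have hassoc : ∀ X, ∀ π ∈ primeRepsNormLe X, ∀ ρ ∈ primeRepsNormLe X, Associated π ρ → π = ρ := by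
    intro X π hπ ρ hρ h
    obtain ⟨z, hz, rfl⟩ := Finset.mem_image.1 hπ
    obtain ⟨w, hw, rfl⟩ := Finset.mem_image.1 hρ
    exact assocRep_eq ((associated_assocRep z).symm.trans (h.trans (associated_assocRep w)))
  have hlim : Tendsto (fun X : ℕ => ∑' z, if ∀ π ∈ primeRepsNormLe X, ¬ π ∣ z then lTerm m σ z
      else 0) atTop (nhds (∑' z, if IsUnit z then lTerm m σ z else 0)) := by
    refine tendsto_tsum_of_dominated_convergence hs (fun z => ?_) (Eventually.of_forall
      fun X z => by split_ifs <;> simp)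
    refine tendsto_const_nhds.congr' ?_
    filter_upwards [eventually_ge_atTop z.norm.toNat] with X hX
    by_cases hz : z = 0
    · subst hz; simp [lTerm]
    by_cases hu : IsUnit z
    · rw [if_pos hu, if_pos]
      exact fun π hπ hd => (hprime X π hπ).not_isUnit (isUnit_of_dvd_unit hd hu)
    · rw [if_neg hu, if_neg]
      push Not
      obtain ⟨π, hπ, hπz⟩ := WfDvdMonoid.exists_irreducible_factor hu hz
      refine ⟨assocRep π, Finset.mem_image_of_mem _ (mem_primesNormLe.2 ⟨hπ.prime, ?_⟩),
        (associated_assocRep π).dvd.trans hπz⟩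
      obtain ⟨w, rfl⟩ := hπz
      have hw : 0 < w.norm := GaussianInt.norm_pos.2 (right_ne_zero_of_mul hz)
      have hπ0 := GaussianInt.norm_nonneg π
      rw [Zsqrtd.norm_mul] at hX
      have : π.norm ≤ π.norm * w.norm := le_mul_of_one_le_right hπ0 hw
      omega
  have hval : (∑' z, if IsUnit z then lTerm m σ z else 0) = 4 := by
    rw [tsum_eq_sum (s := normFiber 1)]
    · rw [Finset.sum_congr rfl (g := fun _ => (1 : ℂ))]
      · rw [Finset.sum_const, card_normFiber_one]; norm_num
      · intro u hu
        rw [if_pos (isUnit_iff_mem_normFiber.2 hu), lTerm, angChar_unit hm hu,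
          mem_normFiber.1 hu]
        simp
    · intro z hz
      rw [if_neg (fun h => hz (isUnit_iff_mem_normFiber.1 h))]
  rw [hval] at hlim
  have hev : ∀ᶠ X : ℕ in atTop, 1 < ‖∑' z, if ∀ π ∈ primeRepsNormLe X, ¬ π ∣ z then lTerm m σ z
      else 0‖ := by
    refine hlim.norm.eventually_const_lt ?_
    norm_num
  filter_upwards [hev] with X hX
  rw [tsum_sieve (lTerm_mul m σ) hs _ (hprime X) (hassoc X), norm_mul, norm_prod] at hX
  have hL : 0 < ‖lValue m σ‖ := by
    rw [norm_pos_iff]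
    intro h
    rw [lValue] at h
    rw [h, norm_zero, zero_mul] at hX
    linarith
  have hprod : ∏ π ∈ primeRepsNormLe X, ‖1 - lTerm m σ π‖ ≤
      Real.exp (∑ π ∈ primeRepsNormLe X, (-(lTerm m σ π).re + ‖lTerm m σ π‖ ^ 2 / 2)) := by
    rw [Real.exp_sum]
    exact Finset.prod_le_prod (fun _ _ => _root_.norm_nonneg _) fun _ _ => norm_one_sub_le_exp _
  have h2 : 1 < ‖lValue m σ‖ *
      Real.exp (∑ π ∈ primeRepsNormLe X, (-(lTerm m σ π).re + ‖lTerm m σ π‖ ^ 2 / 2)) :=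
    hX.trans_le (mul_le_mul_of_nonneg_left hprod hL.le)
  have h3 := Real.log_pos h2
  rw [Real.log_mul hL.ne' (Real.exp_pos _).ne', Real.log_exp, Finset.sum_add_distrib,
    Finset.sum_neg_distrib] at h3
  have h4 : ∑ π ∈ primeRepsNormLe X, ‖lTerm m σ π‖ ^ 2 / 2 ≤
      ∑' z : GaussianInt, (z.norm : ℝ) ^ (-2 : ℝ) := by
    have hnn : ∀ z : GaussianInt, 0 ≤ (z.norm : ℝ) ^ (-2 : ℝ) := fun z =>
      Real.rpow_nonneg (by exact_mod_cast GaussianInt.norm_nonneg z) _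
    refine le_trans (Finset.sum_le_sum fun π hπ => ?_)
      ((summable_norm_rpow (σ := 2) (by norm_num)).sum_le_tsum _ fun z _ => hnn z)
    have hN := one_le_norm (hprime X π hπ).ne_zero
    have h5 : ‖lTerm m σ π‖ ≤ (π.norm : ℝ) ^ (-1 : ℝ) :=
      (norm_lTerm_le m σ π).trans (Real.rpow_le_rpow_of_exponent_le hN (by linarith))
    have h6 : (π.norm : ℝ) ^ (-2 : ℝ) = ((π.norm : ℝ) ^ (-1 : ℝ)) ^ 2 := by
      rw [← Real.rpow_natCast, ← Real.rpow_mul (by linarith)]; norm_num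
    rw [h6]
    have := pow_le_pow_left₀ (_root_.norm_nonneg _) h5 2
    have := sq_nonneg ‖lTerm m σ π‖
    linarith
  linarith

theorem sum_normFiber_le {W : GaussianInt → ℝ} (h0 : ∀ z, 0 ≤ W z)
    (hW : ∀ z w, Associated z w → W z = W w) {N X : ℕ} (hNX : N ≤ X) :
    ∑ p ∈ N.primesBelow, ∑ z ∈ normFiber p, W z ≤ 4 * ∑ π ∈ primeRepsNormLe X, W π := by
  classical
  rw [← Finset.sum_biUnion]
  · have hsub : N.primesBelow.biUnion normFiber ⊆ primesNormLe X := by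
      intro z hz
      obtain ⟨p, hp, hz⟩ := Finset.mem_biUnion.1 hz
      have hz' := mem_normFiber.1 hz
      have := Nat.lt_of_mem_primesBelow hp
      exact mem_primesNormLe.2 ⟨prime_of_norm_prime (Nat.prime_of_mem_primesBelow hp) hz',
        by omega⟩
    refine (Finset.sum_le_sum_of_subset_of_nonneg hsub fun z _ _ => h0 z).trans ?_
    rw [Finset.sum_congr rfl (fun z _ => hW z (assocRep z) (associated_assocRep z).symm),
      Finset.sum_comp W assocRep, Finset.mul_sum, ]
    refine Finset.sum_le_sum fun π _ => ?_
    rw [nsmul_eq_mul]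
    refine mul_le_mul_of_nonneg_right ?_ (h0 π)
    have : ((primesNormLe X).filter fun z => assocRep z = π) ⊆
        (normFiber 1).image (fun u => π * u) := by
      intro z hz
      obtain ⟨_, rfl⟩ := Finset.mem_filter.1 hz
      obtain ⟨u, hu⟩ := associated_assocRep z
      exact Finset.mem_image.2 ⟨u, isUnit_iff_mem_normFiber.1 u.isUnit, hu⟩
    have := (Finset.card_le_card this).trans Finset.card_image_le
    rw [card_normFiber_one] at this
    exact_mod_cast this
  · intro p _ q _ hpq
    rw [Function.onFun, Finset.disjoint_left]
    intro z hz hz'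
    rw [mem_normFiber] at hz hz'
    exact hpq (by omega)

theorem exists_sum_normFiber_rpow_le {a b : ℝ} (hb : 0 ≤ b) (hab : b ≤ a) {k : ℤ} (hk : 4 ∣ k)
    (hk0 : k ≠ 0) : ∃ C : ℝ, ∀ σ : ℝ, 1 < σ → σ ≤ 2 → ∀ N : ℕ,
      ∑ p ∈ N.primesBelow, (1 / 4 * ∑ z ∈ normFiber p, (a + b * (angChar k z).re)) *
        (p : ℝ) ^ (-σ) ≤ a * Real.log (1 / (σ - 1)) + C := by
  obtain ⟨C₀, hC₀, h₀⟩ := exists_norm_lValue_zero_le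
  obtain ⟨C₁, hC₁, h₁⟩ := exists_norm_lValue_le hk0
  set T := ∑' z : GaussianInt, (z.norm : ℝ) ^ (-2 : ℝ)
  refine ⟨a * (max (Real.log C₀) 0 + T) + b * (max (Real.log C₁) 0 + T), fun σ h1 h2 N => ?_⟩
  set W : GaussianInt → ℝ := fun z => a * (lTerm 0 σ z).re + b * (lTerm k σ z).re with hW
  have ht0 : ∀ z : GaussianInt, (lTerm 0 σ z).re = (z.norm : ℝ) ^ (-σ) := by
    intro z
    by_cases hz : z = 0
    · subst hz; simp [lTerm]
      rw [Real.zero_rpow (by linarith)]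
    · rw [lTerm, angChar_zero_apply hz, one_mul, Complex.ofReal_re]
  have hW0 : ∀ z, 0 ≤ W z := by
    intro z
    have h3 := (abs_le.1 ((Complex.abs_re_le_norm _).trans (norm_lTerm_le k σ z))).1
    have h4 : 0 ≤ (z.norm : ℝ) ^ (-σ) :=
      Real.rpow_nonneg (by exact_mod_cast GaussianInt.norm_nonneg z) _
    simp only [hW, ht0]
    nlinarith
  have hinv : ∀ j : ℤ, 4 ∣ j → ∀ z w, Associated z w → lTerm j σ z = lTerm j σ w := by
    rintro j hj z w ⟨u, rfl⟩
    have hu := isUnit_iff_mem_normFiber.1 u.isUnit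
    rw [lTerm_mul]
    simp [lTerm, angChar_unit hj hu, mem_normFiber.1 hu]
  have hWinv : ∀ z w, Associated z w → W z = W w := fun z w h => by
    simp only [hW, hinv 0 (dvd_zero _) z w h, hinv k hk z w h]
  have hev := (eventually_sum_primeReps_le (m := 0) (dvd_zero _) h1).and
    ((eventually_sum_primeReps_le hk h1).and (eventually_ge_atTop N))
  obtain ⟨X, hX0, hX1, hNX⟩ := hev.exists
  have hmain := sum_normFiber_le hW0 hWinv hNX
  have hleft : ∑ p ∈ N.primesBelow, (1 / 4 * ∑ z ∈ normFiber p, (a + b * (angChar k z).re)) *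
        (p : ℝ) ^ (-σ) = 1 / 4 * ∑ p ∈ N.primesBelow, ∑ z ∈ normFiber p, W z := by
    rw [Finset.mul_sum]
    refine Finset.sum_congr rfl fun p _ => ?_
    rw [mul_assoc, Finset.sum_mul]
    congr 1
    refine Finset.sum_congr rfl fun z hz => ?_
    simp only [hW, ht0]
    rw [lTerm, Complex.re_mul_ofReal, mem_normFiber.1 hz]
    push_cast; ring
  rw [hleft]
  have hσ : 0 < σ - 1 := by linarith
  have hl0 : Real.log ‖lValue 0 σ‖ ≤ Real.log (1 / (σ - 1)) + max (Real.log C₀) 0 := by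
    by_cases hz : ‖lValue 0 σ‖ = 0
    · rw [hz, Real.log_zero]
      exact add_nonneg (Real.log_nonneg (by rw [le_div_iff₀ hσ]; linarith)) (le_max_right _ _)
    · refine le_trans ?_ (add_le_add le_rfl (le_max_left _ _))
      rw [← Real.log_mul (by positivity) hC₀.ne']
      refine Real.log_le_log (lt_of_le_of_ne (_root_.norm_nonneg _) (Ne.symm hz)) ?_
      convert h₀ σ h1 h2 using 1; ring
  have hl1 : Real.log ‖lValue k σ‖ ≤ max (Real.log C₁) 0 := by
    by_cases hz : ‖lValue k σ‖ = 0
    · rw [hz]; simp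
    · exact (Real.log_le_log (lt_of_le_of_ne (_root_.norm_nonneg _) (Ne.symm hz))
        (h₁ σ h1 h2)).trans (le_max_left _ _)
  have e : ∑ π ∈ primeRepsNormLe X, W π = a * ∑ π ∈ primeRepsNormLe X, (lTerm 0 σ π).re +
      b * ∑ π ∈ primeRepsNormLe X, (lTerm k σ π).re := by
    rw [Finset.mul_sum, Finset.mul_sum, ← Finset.sum_add_distrib]
  have h5 := mul_le_mul_of_nonneg_left (hX0.trans (add_le_add hl0 le_rfl)) (hb.trans hab)
  have h6 := mul_le_mul_of_nonneg_left (hX1.trans (add_le_add hl1 le_rfl)) hb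
  rw [e] at hmain
  linarith

/-- The character modulo `2` of the Gaussian integers taking the value `ε` at `i`. -/
def parityChar (ε : ℝ) (z : GaussianInt) : ℝ :=
  if Even (z.re + z.im) then 0 else if Even z.re then ε else 1

theorem parityChar_mul {ε : ℝ} (hε : ε ^ 2 = 1) (z w : GaussianInt) :
    parityChar ε (z * w) = parityChar ε z * parityChar ε w := by
  unfold parityChar
  have h1 : Even ((z * w).re + (z * w).im) ↔ Even (z.re + z.im) ∨ Even (w.re + w.im) := by
    rw [Zsqrtd.re_mul, Zsqrtd.im_mul]
    simp only [parity_simps]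
    tauto
  have h2 : Even (z * w).re ↔ ((Even z.re ∨ Even w.re) ↔ (Even z.im ∨ Even w.im)) := by
    rw [Zsqrtd.re_mul]
    simp only [parity_simps]
    tauto
  by_cases a : Even z.re <;> by_cases b : Even z.im <;> by_cases c : Even w.re <;>
    by_cases d : Even w.im <;>
    simp only [h1, h2, a, b, c, d, parity_simps, iff_true, iff_false, not_true_eq_false,
      or_true, or_false, or_self, if_true, if_false, mul_zero,
      zero_mul, mul_one, one_mul] <;> linarith [hε]

theorem parityChar_star (ε : ℝ) (z : GaussianInt) : parityChar ε (star z) = parityChar ε z := by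
  unfold parityChar; simp [parity_simps]

theorem parityChar_neg (ε : ℝ) (z : GaussianInt) : parityChar ε (-z) = parityChar ε z := by
  unfold parityChar; simp [parity_simps]

theorem abs_parityChar_le {ε : ℝ} (hε : ε ^ 2 = 1) (z : GaussianInt) :
    |parityChar ε z| ≤ parityChar 1 z := by
  unfold parityChar
  split_ifs
  · simp
  · exact abs_le_one_iff_mul_self_le_one.2 (by nlinarith)
  · simp

theorem parityChar_one_nonneg (z : GaussianInt) : 0 ≤ parityChar 1 z := by
  unfold parityChar; split_ifs <;> simp

theorem parityChar_one_le (z : GaussianInt) : parityChar 1 z ≤ 1 := by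
  unfold parityChar; split_ifs <;> simp

/-- The product of an angular and a parity character. -/
def twistChar (ε : ℝ) (m : ℤ) (z : GaussianInt) : ℂ := parityChar ε z * angChar m z

theorem twistChar_mul {ε : ℝ} (hε : ε ^ 2 = 1) (m : ℤ) (z w : GaussianInt) :
    twistChar ε m (z * w) = twistChar ε m z * twistChar ε m w := by
  unfold twistChar
  rw [parityChar_mul hε, map_mul]; push_cast; ring

theorem angChar_star (m : ℤ) (z : GaussianInt) :
    angChar m (star z) = (starRingEnd ℂ) (angChar m z) := by
  by_cases hz : z = 0
  · simp [hz]
  rw [angChar_apply hz, angChar_apply (star_ne_zero.2 hz), GaussianInt.toComplex_star, map_zpow₀,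
    map_div₀, Complex.conj_ofReal, Complex.norm_conj]

theorem twistChar_star (ε : ℝ) (m : ℤ) (z : GaussianInt) :
    twistChar ε m (star z) = (starRingEnd ℂ) (twistChar ε m z) := by
  unfold twistChar
  rw [parityChar_star, angChar_star, map_mul, Complex.conj_ofReal]

theorem norm_twistChar_le {ε : ℝ} (hε : ε ^ 2 = 1) (m : ℤ) (z : GaussianInt) :
    ‖twistChar ε m z‖ ≤ parityChar 1 z := by
  unfold twistChar
  rw [norm_mul, Complex.norm_real, Real.norm_eq_abs]
  exact (mul_le_of_le_one_right (abs_nonneg _) (norm_angChar_le m z)).trans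
    (abs_parityChar_le hε z)

/-- The normalised absolute value of the sum of a twisted character over Gaussian integers of
norm `n`. -/
def twistSum (ε : ℝ) (m : ℤ) (n : ℕ) : ℝ := ‖normSum (twistChar ε m) n‖ / 4

theorem twistSum_one_zero (n : ℕ) :
    twistSum 1 0 n = (∑ z ∈ normFiber n, parityChar 1 z) / 4 := by
  have : normSum (twistChar 1 0) n = ((∑ z ∈ normFiber n, parityChar 1 z : ℝ) : ℂ) := by
    unfold normSum
    push_cast
    refine Finset.sum_congr rfl fun z _ => ?_
    by_cases hz : z = 0
    · subst hz; simp [twistChar, parityChar]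
    · rw [twistChar, angChar_zero_apply hz, mul_one]
  rw [twistSum, this, Complex.norm_real, Real.norm_of_nonneg]
  exact Finset.sum_nonneg fun z _ => parityChar_one_nonneg z

theorem twistSum_nonneg (ε : ℝ) (m : ℤ) (n : ℕ) : 0 ≤ twistSum ε m n := by
  unfold twistSum; positivity

theorem twistSum_le {ε : ℝ} (hε : ε ^ 2 = 1) (m : ℤ) (n : ℕ) :
    twistSum ε m n ≤ twistSum 1 0 n := by
  rw [twistSum_one_zero, twistSum]
  gcongr
  exact (norm_sum_le _ _).trans (Finset.sum_le_sum fun z _ => norm_twistChar_le hε m z)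

theorem twistSum_le_card {ε : ℝ} (hε : ε ^ 2 = 1) (m : ℤ) (n : ℕ) :
    twistSum ε m n ≤ (normFiber n).card / 4 := by
  rw [twistSum]
  gcongr
  exact norm_normSum_le (fun z => (norm_twistChar_le hε m z).trans (parityChar_one_le z)) n

/-- Multiplicative functions supported on odd numbers, bounded by the divisor function at prime
powers, whose values at primes are `α` on logarithmic average. -/
structure IsTame (F : ℕ → ℝ) (α : ℝ) : Prop where
  nonneg : ∀ n, 0 ≤ F n
  map_one : F 1 = 1
  map_mul : ∀ m n, m ≠ 0 → n ≠ 0 → m.Coprime n → F (m * n) = F m * F n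
  map_even : ∀ n, Even n → F n = 0
  prime_pow_le : ∀ q, q.Prime → ∀ j : ℕ, F (q ^ j) ≤ j + 1
  sum_le : ∃ C, ∀ N : ℕ, 3 ≤ N → ∑ p ∈ N.primesBelow, F p / p ≤ α * Real.log (Real.log N) + C

theorem normSum_twistChar_even (ε : ℝ) (m : ℤ) {n : ℕ} (hn : Even n) :
    normSum (twistChar ε m) n = 0 := by
  refine Finset.sum_eq_zero fun z hz => ?_
  have h := mem_normFiber.1 hz
  rw [norm_eq_re_sq_add_im_sq] at h
  have : Even (z.re ^ 2 + z.im ^ 2) := by rw [h]; exact_mod_cast hn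
  have : Even (z.re + z.im) := by
    simp only [parity_simps] at this ⊢
    simpa using this
  simp [twistChar, parityChar, this]

theorem isTame_twistSum {ε : ℝ} (hε : ε ^ 2 = 1) {m : ℤ} (hone : twistSum ε m 1 = 1)
    {a b : ℝ} (hb : 0 ≤ b) (hab : b ≤ a) (hab1 : a + b ≤ 1) {k : ℤ} (hk : 4 ∣ k) (hk0 : k ≠ 0)
    (hle : ∀ n, twistSum ε m n ≤ 1 / 4 * ∑ z ∈ normFiber n, (a + b * (angChar k z).re)) :
    IsTame (twistSum ε m) a where
  nonneg := twistSum_nonneg ε m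
  map_one := hone
  map_mul m' n hm hn h := by
    have := congrArg norm (normSum_mul_normSum (twistChar_mul hε m) hm hn h)
    rw [norm_mul, norm_mul] at this
    unfold twistSum
    norm_num at this
    linarith
  map_even n hn := by rw [twistSum, normSum_twistChar_even ε m hn]; simp
  prime_pow_le q hq j := by
    refine (twistSum_le_card hε m _).trans ?_
    have := card_normFiber_prime_pow_le hq j
    rw [div_le_iff₀ (by norm_num)]
    have h2 : ((normFiber (q ^ j)).card : ℝ) ≤ ((4 * (j + 1) : ℕ) : ℝ) := by exact_mod_cast this
    push_cast at h2
    linarith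
  sum_le := by
    obtain ⟨C, hC⟩ := exists_sum_normFiber_rpow_le hb hab hk hk0
    refine ⟨C + 2 * (1 + Real.log 4), fun N hN => ?_⟩
    refine le_trans (Finset.sum_le_sum fun p _ => ?_)
      (sum_div_primesBelow_le_of_rpow (M := fun p => 1 / 4 * ∑ z ∈ normFiber p,
        (a + b * (angChar k z).re)) (B := 2) (by norm_num) (fun p hp => ?_) hC hN)
    · exact div_le_div_of_nonneg_right (hle p) (by positivity)
    · have h1 : ∑ z ∈ normFiber p, (a + b * (angChar k z).re) ≤ ∑ z ∈ normFiber p, 1 := by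
        refine Finset.sum_le_sum fun z _ => ?_
        have := (Complex.re_le_norm _).trans (norm_angChar_le k z)
        nlinarith
      have h2 := card_normFiber_prime_pow_le hp 1
      rw [pow_one] at h2
      have h3 : ((normFiber p).card : ℝ) ≤ 8 := by exact_mod_cast h2
      simp only [Finset.sum_const, nsmul_eq_mul, mul_one] at h1
      linarith

theorem isTame_twistSum_one_zero : IsTame (twistSum 1 0) 1 := by
  refine isTame_twistSum (by norm_num) ?_ (a := 1) (b := 0) le_rfl (by norm_num) (by norm_num)
    (k := 4) dvd_rfl (by norm_num) fun n => ?_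
  · rw [twistSum_one_zero, normFiber_one]
    have h : ∀ z ∈ ({1, -1, ⟨0, 1⟩, ⟨0, -1⟩} : Finset GaussianInt), parityChar 1 z = 1 := by
      intro z hz
      simp only [Finset.mem_insert, Finset.mem_singleton] at hz
      rcases hz with rfl | rfl | rfl | rfl <;> simp [parityChar]
    rw [Finset.sum_congr rfl h, ← normFiber_one, Finset.sum_const, card_normFiber_one]
    norm_num
  · refine (twistSum_le_card (by norm_num) 0 n).trans_eq ?_
    simp; ring

theorem twistSum_eq_zero_or_isTame {ε : ℝ} (hε : ε ^ 2 = 1) {m : ℤ} (hm : m ≠ 0) :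
    (∀ n, n ≠ 0 → twistSum ε m n = 0) ∨ IsTame (twistSum ε m) (3 / 4) := by
  rcases Int.even_or_odd m with he | ho
  · by_cases h1 : normSum (twistChar ε m) 1 = 0
    · left
      intro n hn
      have := normSum_mul_normSum (twistChar_mul hε m) one_ne_zero hn (Nat.coprime_one_left n)
      rw [h1, zero_mul, one_mul] at this
      have h2 : normSum (twistChar ε m) n = 0 := by
        rcases mul_eq_zero.1 this.symm with h | h
        · norm_num at h
        · exact h
      rw [twistSum, h2]; simp
    · right
      refine isTame_twistSum hε ?_ (a := 3 / 4) (b := 1 / 4) (by norm_num) (by norm_num)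
        (by norm_num) (k := 2 * m) ?_ (by omega) fun n => ?_
      · have := normSum_mul_normSum (twistChar_mul hε m) one_ne_zero one_ne_zero
          (Nat.coprime_one_left 1)
        rw [one_mul] at this
        have := mul_right_cancel₀ h1 this
        rw [twistSum, this]; norm_num
      · obtain ⟨c, rfl⟩ := he; exact ⟨c, by ring⟩
      · have hreal : (normSum (twistChar ε m) n).im = 0 := by
          rw [← Complex.conj_eq_iff_im, normSum, map_sum]
          refine Finset.sum_bij (fun z _ => star z) (fun z hz => ?_) (fun z _ w _ h => ?_)
            (fun z hz => ⟨star z, ?_, star_star z⟩) fun z _ => (twistChar_star ε m z).symm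
          · rw [mem_normFiber, norm_star]; exact mem_normFiber.1 hz
          · exact star_injective h
          · rw [mem_normFiber, norm_star]; exact mem_normFiber.1 hz
        have hnorm : ‖normSum (twistChar ε m) n‖ ≤ ∑ z ∈ normFiber n, |(twistChar ε m z).re| := by
          have e : normSum (twistChar ε m) n = ((normSum (twistChar ε m) n).re : ℂ) := by
            apply Complex.ext <;> simp [hreal]
          rw [e, Complex.norm_real, normSum, Complex.re_sum]
          exact Finset.abs_sum_le_sum_abs _ _
        rw [twistSum, div_eq_inv_mul, one_div]
        gcongr
        refine hnorm.trans (Finset.sum_le_sum fun z _ => ?_)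
        by_cases hz : z = 0
        · subst hz; simp [twistChar]; norm_num
        have h3 := norm_angChar (m := m) hz
        have h4 : angChar (2 * m) z = angChar m z * angChar m z := by
          rw [angChar_apply hz, angChar_apply hz, ← zpow_add₀, two_mul]
          exact div_ne_zero (toComplex_ne_zero hz)
            (by exact_mod_cast norm_ne_zero_iff.2 (toComplex_ne_zero hz))
        have h5 : (angChar m z).re ^ 2 + (angChar m z).im ^ 2 = 1 := by
          rw [← Complex.normSq_add_mul_I, Complex.re_add_im, Complex.normSq_eq_norm_sq, h3]
          norm_num
        rw [twistChar, Complex.re_ofReal_mul, abs_mul, h4, Complex.mul_re]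
        have h6 := (abs_parityChar_le hε z).trans (parityChar_one_le z)
        have h7 := mul_le_of_le_one_left (abs_nonneg (angChar m z).re) h6
        refine h7.trans ?_
        nlinarith [sq_abs (angChar m z).re, sq_nonneg (|(angChar m z).re| - 1)]
  · left
    intro n _
    have : normSum (twistChar ε m) n = -normSum (twistChar ε m) n := by
      conv_rhs => rw [normSum, ← Finset.sum_neg_distrib]
      refine Finset.sum_bij (fun z _ => -z) (fun z hz => ?_) (fun z _ w _ h => neg_injective h)
        (fun z hz => ⟨-z, ?_, neg_neg z⟩) fun z hz => ?_
      · rw [mem_normFiber, Zsqrtd.norm_neg]; exact mem_normFiber.1 hz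
      · rw [mem_normFiber, Zsqrtd.norm_neg]; exact mem_normFiber.1 hz
      · by_cases hz : z = 0
        · subst hz; simp [twistChar]
        rw [twistChar, twistChar, parityChar_neg, angChar_apply hz,
          angChar_apply (neg_ne_zero.2 hz), GaussianInt.toComplex_neg, norm_neg, neg_div,
          ho.neg_zpow]
        ring
    have h0 : normSum (twistChar ε m) n = 0 := by
      have := self_eq_neg.1 this; exact this
    rw [twistSum, h0]; simp

theorem abs_card_modEq_sub_le {M : ℕ} (hM : 0 < M) (c X : ℕ) :
    |((((Finset.range X).filter fun m => m ≡ c [MOD M]).card : ℕ) : ℝ) - (X : ℝ) / M| ≤ 1 := by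
  have h1 := Nat.count_modEq_card X hM c
  rw [Nat.count_eq_card_filter_range] at h1
  rw [h1]
  have h2 : (X : ℝ) / M = ((X / M : ℕ) : ℝ) + ((X % M : ℕ) : ℝ) / M := by
    have : (M : ℝ) ≠ 0 := by positivity
    field_simp
    exact_mod_cast (Nat.div_add_mod X M).symm
  have h3 : ((X % M : ℕ) : ℝ) / M < 1 := by
    rw [div_lt_one (by positivity)]
    exact_mod_cast Nat.mod_lt X hM
  have h4 : (0 : ℝ) ≤ ((X % M : ℕ) : ℝ) / M := by positivity
  rw [h2, abs_le]
  push_cast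
  split_ifs <;> constructor <;> linarith

theorem prime_dvd_triple_iff {q : ℕ} (hq : q.Prime) (h2 : q ≠ 2) (m : ℕ) :
    q ∣ m * (m + 2) * (m + 4) ↔ m ≡ 0 [MOD q] ∨ m ≡ q - 2 [MOD q] ∨ m ≡ 2 * q - 4 [MOD q] := by
  have hq3 : 3 ≤ q := by have := hq.two_le; omega
  have e1 : m ≡ q - 2 [MOD q] ↔ q ∣ m + 2 := by
    rw [← Nat.modEq_zero_iff_dvd]
    constructor
    · intro h
      have := h.add_right 2
      rw [show q - 2 + 2 = q by omega] at this
      exact this.trans (by simp [Nat.ModEq])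
    · intro h
      apply Nat.ModEq.add_right_cancel' 2
      rw [show q - 2 + 2 = q by omega]
      exact h.trans (by simp [Nat.ModEq])
  have e2 : m ≡ 2 * q - 4 [MOD q] ↔ q ∣ m + 4 := by
    rw [← Nat.modEq_zero_iff_dvd]
    constructor
    · intro h
      have := h.add_right 4
      rw [show 2 * q - 4 + 4 = 2 * q by omega] at this
      exact this.trans (by simp [Nat.ModEq])
    · intro h
      apply Nat.ModEq.add_right_cancel' 4
      rw [show 2 * q - 4 + 4 = 2 * q by omega]
      exact h.trans (by simp [Nat.ModEq])
  rw [e1, e2, hq.dvd_mul, hq.dvd_mul, Nat.modEq_zero_iff_dvd, or_assoc]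

theorem not_dvd_two_four {q : ℕ} (hq : q.Prime) (h2 : q ≠ 2) : ¬ q ∣ 2 ∧ ¬ q ∣ 4 := by
  have : ¬ q ∣ 2 := fun h => h2 ((Nat.prime_dvd_prime_iff_eq hq Nat.prime_two).1 h)
  refine ⟨this, fun h => this ?_⟩
  exact hq.dvd_of_dvd_pow (n := 2) (by simpa using h)

theorem residues_distinct {q : ℕ} (hq : q.Prime) (h2 : q ≠ 2) (m : ℕ) :
    ¬ (m ≡ 0 [MOD q] ∧ m ≡ q - 2 [MOD q]) ∧ ¬ (m ≡ 0 [MOD q] ∧ m ≡ 2 * q - 4 [MOD q]) ∧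
      ¬ (m ≡ q - 2 [MOD q] ∧ m ≡ 2 * q - 4 [MOD q]) := by
  obtain ⟨n2, n4⟩ := not_dvd_two_four hq h2
  have hq3 : 3 ≤ q := by have := hq.two_le; omega
  refine ⟨fun ⟨h, h'⟩ => n2 ?_, fun ⟨h, h'⟩ => n4 ?_, fun ⟨h, h'⟩ => n2 ?_⟩
  · have := (h.symm.trans h').add_right 2
    rw [show q - 2 + 2 = q by omega] at this
    exact Nat.modEq_zero_iff_dvd.1 (by simpa using this.trans (by simp [Nat.ModEq] : q ≡ 0 [MOD q]))
  · have := (h.symm.trans h').add_right 4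
    rw [show 2 * q - 4 + 4 = 2 * q by omega] at this
    exact Nat.modEq_zero_iff_dvd.1
      (by simpa using this.trans (by simp [Nat.ModEq] : 2 * q ≡ 0 [MOD q]))
  · have := (h.symm.trans h').add_right 4
    rw [show 2 * q - 4 + 4 = 2 * q by omega, show q - 2 + 4 = q + 2 by omega] at this
    have h5 : 2 + q ≡ 0 [MOD q] := by
      rw [add_comm]; exact this.trans (by simp [Nat.ModEq] : 2 * q ≡ 0 [MOD q])
    exact (Nat.dvd_add_iff_left dvd_rfl).2 (Nat.modEq_zero_iff_dvd.1 h5)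

/-- Counting `m < X` in a residue class for which every prime of `E` divides `m (m+2) (m+4)`. -/
theorem abs_card_dvd_triple_sub_le (X : ℕ) (E : Finset ℕ) :
    ∀ (M c : ℕ), 0 < M → (∀ q ∈ E, q.Prime ∧ q ≠ 2 ∧ q.Coprime M) →
    |((((Finset.range X).filter fun m => m ≡ c [MOD M] ∧
        ∀ q ∈ E, q ∣ m * (m + 2) * (m + 4)).card : ℕ) : ℝ) - (X : ℝ) / M * ∏ q ∈ E, (3 : ℝ) / q|
      ≤ 3 ^ E.card := by
  induction E using Finset.induction_on with
  | empty =>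
    intro M c hM _
    simpa using abs_card_modEq_sub_le hM c X
  | insert q E hqE ih =>
    intro M c hM hE
    obtain ⟨hq, hq2, hqM⟩ := hE q (Finset.mem_insert_self _ _)
    have hE' : ∀ p ∈ E, p.Prime ∧ p ≠ 2 ∧ p.Coprime (M * q) := fun p hp => by
      obtain ⟨h1, h2, h3⟩ := hE p (Finset.mem_insert_of_mem hp)
      refine ⟨h1, h2, h3.mul_right ((Nat.coprime_primes h1 hq).2 ?_)⟩
      rintro rfl; exact hqE hp
    have hMq : 0 < M * q := Nat.mul_pos hM hq.pos
    have split : ∀ r : ℕ, ∃ c' : ℕ, ∀ m, (m ≡ c [MOD M] ∧ m ≡ r [MOD q]) ↔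
        m ≡ c' [MOD (M * q)] := fun r => by
      obtain ⟨c', h1, h2⟩ := Nat.chineseRemainder hqM.symm c r
      refine ⟨c', fun m => ⟨fun ⟨a, b⟩ => ?_, fun h => ⟨?_, ?_⟩⟩⟩
      · exact (Nat.modEq_and_modEq_iff_modEq_mul hqM.symm).1 ⟨a.trans h1.symm, b.trans h2.symm⟩
      · exact (Nat.ModEq.of_mul_right q h).trans h1
      · exact (Nat.ModEq.of_mul_left M h).trans h2
    obtain ⟨c0, h0⟩ := split 0
    obtain ⟨c1, h1⟩ := split (q - 2)
    obtain ⟨c2, h2⟩ := split (2 * q - 4)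
    have key : ((Finset.range X).filter fun m => m ≡ c [MOD M] ∧
        ∀ p ∈ insert q E, p ∣ m * (m + 2) * (m + 4)).card =
        ((Finset.range X).filter fun m => m ≡ c0 [MOD (M * q)] ∧
          ∀ p ∈ E, p ∣ m * (m + 2) * (m + 4)).card +
        ((Finset.range X).filter fun m => m ≡ c1 [MOD (M * q)] ∧
          ∀ p ∈ E, p ∣ m * (m + 2) * (m + 4)).card +
        ((Finset.range X).filter fun m => m ≡ c2 [MOD (M * q)] ∧
          ∀ p ∈ E, p ∣ m * (m + 2) * (m + 4)).card := by
      rw [← Finset.card_union_of_disjoint, ← Finset.card_union_of_disjoint]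
      · congr 1
        ext m
        simp only [Finset.mem_filter, Finset.mem_union, Finset.forall_mem_insert, ← h0, ← h1, ← h2,
          prime_dvd_triple_iff hq hq2]
        tauto
      · rw [Finset.disjoint_left]
        intro m
        obtain ⟨d1, d2, d3⟩ := residues_distinct hq hq2 m
        simp only [Finset.mem_filter, Finset.mem_union, ← h0, ← h1, ← h2]
        tauto
      · rw [Finset.disjoint_left]
        intro m
        obtain ⟨d1, d2, d3⟩ := residues_distinct hq hq2 m
        simp only [Finset.mem_filter, ← h0, ← h1]
        tauto
    rw [key, Finset.prod_insert hqE, Finset.card_insert_of_notMem hqE]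
    have i0 := ih (M * q) c0 hMq hE'
    have i1 := ih (M * q) c1 hMq hE'
    have i2 := ih (M * q) c2 hMq hE'
    have e : (X : ℝ) / M * (3 / q * ∏ p ∈ E, (3 : ℝ) / p) =
        3 * ((X : ℝ) / ((M * q : ℕ) : ℝ) * ∏ p ∈ E, (3 : ℝ) / p) := by
      have : (M : ℝ) ≠ 0 := by positivity
      have : (q : ℝ) ≠ 0 := by exact_mod_cast hq.ne_zero
      push_cast
      field_simp
    rw [e, abs_le]
    rw [abs_le] at i0 i1 i2
    push_cast at *
    rw [pow_succ]
    constructor <;> linarith [i0.1, i0.2, i1.1, i1.2, i2.1, i2.2]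

/-- Bonferroni's inequality. -/
theorem one_le_sum_neg_one_pow (D : Finset ℕ) (k : ℕ) :
    (if D = ∅ then (1 : ℝ) else 0) ≤
      ∑ E ∈ D.powerset with E.card ≤ 2 * k, (-1 : ℝ) ^ E.card := by
  have h1 : ∑ E ∈ D.powerset with E.card ≤ 2 * k, (-1 : ℝ) ^ E.card =
      ∑ j ∈ Finset.range (2 * k + 1), (-1 : ℝ) ^ j * (D.card.choose j : ℝ) := by
    rw [Finset.sum_filter]
    rw [Finset.sum_powerset_apply_card (fun j => if j ≤ 2 * k then (-1 : ℝ) ^ j else 0)]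
    have : ∀ j, D.card.choose j • (if j ≤ 2 * k then (-1 : ℝ) ^ j else 0) =
        if j ≤ 2 * k then (-1 : ℝ) ^ j * (D.card.choose j : ℝ) else 0 := fun j => by
      split_ifs <;> simp [mul_comm]
    simp_rw [this]
    rw [← Finset.sum_filter]
    refine Finset.sum_subset_zero_on_sdiff ?_ ?_ (fun _ _ => rfl)
    · intro j
      simp only [Finset.mem_filter, Finset.mem_range]
      omega
    · intro j
      simp only [Finset.mem_sdiff, Finset.mem_range, Finset.mem_filter]
      intro h
      rw [Nat.choose_eq_zero_of_lt (by omega)]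
      simp
  rw [h1]
  rcases Nat.eq_zero_or_pos D.card with h | h
  · rw [h, Finset.sum_range_succ']
    have : ∑ i ∈ Finset.range (2 * k), (-1 : ℝ) ^ (i + 1) * ((Nat.choose 0 (i + 1) : ℕ) : ℝ) = 0 :=
      Finset.sum_eq_zero fun i _ => by simp
    rw [this]
    simp [Finset.card_eq_zero.1 h]
  · have hne : D ≠ ∅ := by rintro rfl; simp at h
    rw [if_neg hne]
    obtain ⟨n, hn⟩ := Nat.exists_eq_succ_of_ne_zero h.ne'
    have h2 := Int.alternating_sum_range_choose_eq_choose (n := n) (m := 2 * k)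
    have h3 : ∑ j ∈ Finset.range (2 * k + 1), (-1 : ℝ) ^ j * (D.card.choose j : ℝ) =
        (n.choose (2 * k) : ℝ) := by
      rw [hn]
      have := congrArg (Int.cast : ℤ → ℝ) h2
      push_cast at this
      rw [this]
      simp
    rw [h3]; positivity

theorem sum_small_powerset_pow_le (P : Finset ℕ) (k : ℕ) {W : ℝ} (hW : 1 ≤ W)
    (hP : (P.card : ℝ) ≤ W) :
    ∑ E ∈ P.powerset with E.card ≤ 2 * k, (3 : ℝ) ^ E.card ≤ Real.exp 3 * W ^ (2 * k) := by
  have hW0 : 0 < W := by linarith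
  calc ∑ E ∈ P.powerset with E.card ≤ 2 * k, (3 : ℝ) ^ E.card
      ≤ ∑ E ∈ P.powerset with E.card ≤ 2 * k, W ^ (2 * k) * ∏ _q ∈ E, (3 / W) := by
        refine Finset.sum_le_sum fun E hE => ?_
        have hE := (Finset.mem_filter.1 hE).2
        rw [Finset.prod_const, div_pow, ← mul_div_assoc, le_div_iff₀ (by positivity), mul_comm]
        gcongr
    _ ≤ ∑ E ∈ P.powerset, W ^ (2 * k) * ∏ _q ∈ E, (3 / W) :=
        Finset.sum_le_sum_of_subset_of_nonneg (Finset.filter_subset _ _)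
          fun E _ _ => by positivity
    _ = W ^ (2 * k) * ∏ _q ∈ P, (1 + 3 / W) := by
        rw [Finset.prod_one_add, Finset.mul_sum]
    _ ≤ W ^ (2 * k) * Real.exp 3 := by
        gcongr
        rw [Finset.prod_const]
        calc (1 + 3 / W) ^ P.card ≤ Real.exp (3 / W) ^ P.card := by
              gcongr; linarith [Real.add_one_le_exp (3 / W)]
          _ = Real.exp (P.card * (3 / W)) := by rw [← Real.exp_nat_mul]
          _ ≤ Real.exp 3 := by
              apply Real.exp_le_exp.2
              rw [← mul_div_assoc, div_le_iff₀ hW0]; linarith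
    _ = _ := mul_comm _ _

/-- Brun's pure sieve for the triple `m, m + 2, m + 4`. -/
theorem card_sifted_le (X M c k : ℕ) (hM : 0 < M) (P : Finset ℕ)
    (hP : ∀ q ∈ P, q.Prime ∧ q ≠ 2 ∧ q.Coprime M) {W : ℝ} (hW : 1 ≤ W) (hPW : (P.card : ℝ) ≤ W) :
    ((((Finset.range X).filter fun m => m ≡ c [MOD M] ∧
        ∀ q ∈ P, ¬ q ∣ m * (m + 2) * (m + 4)).card : ℕ) : ℝ) ≤
      (X : ℝ) / M * (∏ q ∈ P, (1 - (3 : ℝ) / q) +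
        Real.exp (-(2 * k)) * ∏ q ∈ P, (1 + 3 * Real.exp 1 / q)) +
      Real.exp 3 * W ^ (2 * k) := by
  set R := (Finset.range X).filter fun m => m ≡ c [MOD M] with hR
  set S := P.powerset.filter fun E => E.card ≤ 2 * k with hS
  have hfil : ((Finset.range X).filter fun m => m ≡ c [MOD M] ∧
        ∀ q ∈ P, ¬ q ∣ m * (m + 2) * (m + 4)) =
      R.filter fun m => P.filter (fun q => q ∣ m * (m + 2) * (m + 4)) = ∅ := by
    ext m
    simp [hR, Finset.filter_eq_empty_iff, and_assoc]
  have hbonf : ((((Finset.range X).filter fun m => m ≡ c [MOD M] ∧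
        ∀ q ∈ P, ¬ q ∣ m * (m + 2) * (m + 4)).card : ℕ) : ℝ) ≤
      ∑ E ∈ S, (-1 : ℝ) ^ E.card * (((Finset.range X).filter fun m => m ≡ c [MOD M] ∧
        ∀ q ∈ E, q ∣ m * (m + 2) * (m + 4)).card : ℝ) := by
    rw [hfil, Finset.card_filter]
    push_cast
    calc ∑ m ∈ R, (if P.filter (fun q => q ∣ m * (m + 2) * (m + 4)) = ∅ then (1 : ℝ) else 0)
        ≤ ∑ m ∈ R, ∑ E ∈ (P.filter (fun q => q ∣ m * (m + 2) * (m + 4))).powerset with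
            E.card ≤ 2 * k, (-1 : ℝ) ^ E.card :=
          Finset.sum_le_sum fun m _ => one_le_sum_neg_one_pow _ k
      _ = ∑ m ∈ R, ∑ E ∈ S, if (∀ q ∈ E, q ∣ m * (m + 2) * (m + 4)) then (-1 : ℝ) ^ E.card
            else 0 := by
          refine Finset.sum_congr rfl fun m _ => ?_
          rw [← Finset.sum_filter]
          refine Finset.sum_congr ?_ fun _ _ => rfl
          ext E
          simp only [hS, Finset.mem_filter, Finset.mem_powerset, Finset.subset_iff]
          constructor
          · rintro ⟨h1, h2⟩
            exact ⟨⟨fun q hq => (h1 hq).1, h2⟩, fun q hq => (h1 hq).2⟩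
          · rintro ⟨⟨h1, h2⟩, h3⟩
            exact ⟨fun q hq => ⟨h1 hq, h3 q hq⟩, h2⟩
      _ = _ := by
          rw [Finset.sum_comm]
          refine Finset.sum_congr rfl fun E _ => ?_
          rw [← Finset.sum_filter, Finset.sum_const, nsmul_eq_mul, mul_comm]
          congr 3
          ext m; simp [hR, and_assoc]
  have hcount : ∑ E ∈ S, (-1 : ℝ) ^ E.card * (((Finset.range X).filter fun m => m ≡ c [MOD M] ∧
        ∀ q ∈ E, q ∣ m * (m + 2) * (m + 4)).card : ℝ) ≤
      ∑ E ∈ S, ((X : ℝ) / M * ((-1 : ℝ) ^ E.card * ∏ q ∈ E, (3 : ℝ) / q) + 3 ^ E.card) := by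
    refine Finset.sum_le_sum fun E hE => ?_
    have hEP : E ⊆ P := Finset.mem_powerset.1 (Finset.mem_filter.1 hE).1
    have := abs_card_dvd_triple_sub_le X E M c hM fun q hq => hP q (hEP hq)
    rw [abs_le] at this
    rcases neg_one_pow_eq_or ℝ E.card with h | h <;> (rw [h]; linarith [this.1, this.2])
  have hmain : ∑ E ∈ S, ((-1 : ℝ) ^ E.card * ∏ q ∈ E, (3 : ℝ) / q) ≤
      ∏ q ∈ P, (1 - (3 : ℝ) / q) + Real.exp (-(2 * k)) * ∏ q ∈ P, (1 + 3 * Real.exp 1 / q) := by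
    have e1 : ∏ q ∈ P, (1 - (3 : ℝ) / q) =
        ∑ E ∈ P.powerset, (-1 : ℝ) ^ E.card * ∏ q ∈ E, (3 : ℝ) / q := by
      simp_rw [sub_eq_add_neg]
      rw [Finset.prod_one_add]
      refine Finset.sum_congr rfl fun E _ => ?_
      rw [← Finset.prod_const, ← Finset.prod_mul_distrib]
      exact Finset.prod_congr rfl fun q _ => by ring
    rw [e1, Finset.prod_one_add, Finset.mul_sum, ← Finset.sum_add_distrib, hS, Finset.sum_filter]
    refine Finset.sum_le_sum fun E _ => ?_
    have hpos : (0 : ℝ) ≤ ∏ q ∈ E, (3 : ℝ) / q := Finset.prod_nonneg fun q _ => by positivity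
    have e2 : Real.exp (-(2 * k)) * ∏ q ∈ E, (3 * Real.exp 1 / q) =
        Real.exp ((E.card : ℝ) - 2 * k) * ∏ q ∈ E, (3 : ℝ) / q := by
      have : ∏ q ∈ E, (3 * Real.exp 1 / (q : ℝ)) =
          Real.exp E.card * ∏ q ∈ E, (3 : ℝ) / q := by
        rw [← Real.exp_one_pow, ← Finset.prod_const, ← Finset.prod_mul_distrib]
        exact Finset.prod_congr rfl fun q _ => by ring
      rw [this, ← mul_assoc, ← Real.exp_add]
      congr 2; ring
    rw [e2]
    split_ifs with h
    · linarith [mul_nonneg (Real.exp_pos ((E.card : ℝ) - 2 * k)).le hpos]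
    · have : (1 : ℝ) ≤ Real.exp ((E.card : ℝ) - 2 * k) := by
        apply Real.one_le_exp
        have : 2 * k < E.card := by omega
        have : ((2 * k : ℕ) : ℝ) ≤ E.card := by exact_mod_cast this.le
        push_cast at this; linarith
      have h2 : (-1 : ℝ) ≤ (-1 : ℝ) ^ E.card := by
        rcases neg_one_pow_eq_or ℝ E.card with h | h <;> rw [h] <;> norm_num
      nlinarith [mul_nonneg (sub_nonneg.2 this) hpos, mul_nonneg (sub_nonneg.2 h2) hpos]
  refine hbonf.trans (hcount.trans ?_)
  rw [Finset.sum_add_distrib, ← Finset.mul_sum]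
  gcongr
  exact sum_small_powerset_pow_le P k hW hPW

/-- The cube of `M / φ(M)`. -/
def cubeRatio (M : ℕ) : ℝ := ∏ q ∈ M.primeFactors, ((1 - 1 / (q : ℝ))⁻¹) ^ 3

theorem one_sub_inv_prime_pos {q : ℕ} (hq : q.Prime) : 0 < 1 - 1 / (q : ℝ) := by
  have : (2 : ℝ) ≤ q := by exact_mod_cast hq.two_le
  have h : 1 / (q : ℝ) ≤ 1 / 2 := one_div_le_one_div_of_le (by norm_num) this
  linarith

theorem one_le_inv_one_sub_inv {q : ℕ} (hq : q.Prime) : 1 ≤ (1 - 1 / (q : ℝ))⁻¹ := by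
  rw [one_le_inv₀ (one_sub_inv_prime_pos hq)]
  have : (0 : ℝ) ≤ 1 / (q : ℝ) := by positivity
  linarith

theorem one_le_cubeRatio (M : ℕ) : 1 ≤ cubeRatio M := by
  refine Finset.one_le_prod fun q hq => ?_
  exact one_le_pow₀ (one_le_inv_one_sub_inv (Nat.prime_of_mem_primeFactors hq))

theorem cubeRatio_one : cubeRatio 1 = 1 := by simp [cubeRatio]

theorem cubeRatio_mul {a b : ℕ} (h : a.Coprime b) :
    cubeRatio (a * b) = cubeRatio a * cubeRatio b := by
  rw [cubeRatio, h.primeFactors_mul, Finset.prod_union h.disjoint_primeFactors]; rfl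

theorem cubeRatio_prime_pow {q j : ℕ} (hq : q.Prime) (hj : j ≠ 0) :
    cubeRatio (q ^ j) = ((1 - 1 / (q : ℝ))⁻¹) ^ 3 := by
  rw [cubeRatio, Nat.primeFactors_prime_pow hj hq, Finset.prod_singleton]

theorem prod_one_sub_inv_coprime_le {W M : ℕ} (hW : 3 ≤ W) (hM : 0 < M) :
    ∏ q ∈ W.primesBelow with q ≠ 2 ∧ ¬ q ∣ M, (1 - (3 : ℝ) / q) ≤
      8 * cubeRatio M / Real.log W ^ 3 := by
  have hlog : 0 < Real.log W := Real.log_pos (by exact_mod_cast (by omega : 1 < W))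
  set P := W.primesBelow.filter fun q => q ≠ 2 ∧ ¬ q ∣ M with hP
  set R := W.primesBelow.filter fun q => ¬ (q ≠ 2 ∧ ¬ q ∣ M) with hR
  have hpr : ∀ q ∈ W.primesBelow, q.Prime := fun q hq => Nat.prime_of_mem_primesBelow hq
  have hPp : ∀ q ∈ P, q.Prime := fun q hq => hpr q (Finset.mem_filter.1 hq).1
  have hRp : ∀ q ∈ R, q.Prime := fun q hq => hpr q (Finset.mem_filter.1 hq).1
  have h1 : ∏ q ∈ P, (1 - (3 : ℝ) / q) ≤ ∏ q ∈ P, (1 - 1 / (q : ℝ)) ^ 3 := by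
    refine Finset.prod_le_prod (fun q hq => ?_) fun q hq => ?_
    · have : 3 ≤ q := by
        have := (hPp q hq).two_le
        have := (Finset.mem_filter.1 hq).2.1
        omega
      have : (3 : ℝ) ≤ q := by exact_mod_cast this
      rw [sub_nonneg, div_le_one (by linarith)]; exact this
    · have h0 : (0 : ℝ) ≤ 1 / q := by positivity
      have h1 := (one_sub_inv_prime_pos (hPp q hq)).le
      rw [show (3 : ℝ) / q = 3 * (1 / q) by ring]
      nlinarith [mul_nonneg h0 h0, mul_nonneg (mul_nonneg h0 h0) h1]
  have h2 : ∏ q ∈ P, (1 - 1 / (q : ℝ)) =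
      (∏ q ∈ W.primesBelow, (1 - 1 / (q : ℝ))) * ∏ q ∈ R, (1 - 1 / (q : ℝ))⁻¹ := by
    rw [← Finset.prod_filter_mul_prod_filter_not W.primesBelow fun q => q ≠ 2 ∧ ¬ q ∣ M,
      ← hP, ← hR, mul_assoc, ← Finset.prod_mul_distrib]
    rw [Finset.prod_eq_one (s := R), mul_one]
    intro q hq
    exact mul_inv_cancel₀ (one_sub_inv_prime_pos (hRp q hq)).ne'
  have h3 : (∏ q ∈ R, (1 - 1 / (q : ℝ))⁻¹) ^ 3 ≤ 8 * cubeRatio M := by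
    rw [← Finset.prod_pow]
    have hsub : R ⊆ insert 2 (M.primeFactors.erase 2) := by
      intro q hq
      have := (Finset.mem_filter.1 hq).2
      simp only [Finset.mem_insert, Finset.mem_erase, Nat.mem_primeFactors]
      by_cases h : q = 2
      · exact Or.inl h
      · exact Or.inr ⟨h, hRp q hq, by tauto, hM.ne'⟩
    have hp' : ∀ q ∈ insert 2 (M.primeFactors.erase 2), q.Prime := by
      intro q hq
      rcases Finset.mem_insert.1 hq with rfl | h
      · exact Nat.prime_two
      · exact Nat.prime_of_mem_primeFactors (Finset.mem_of_mem_erase h)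
    calc ∏ q ∈ R, ((1 - 1 / (q : ℝ))⁻¹) ^ 3
        ≤ ∏ q ∈ insert 2 (M.primeFactors.erase 2), ((1 - 1 / (q : ℝ))⁻¹) ^ 3 :=
          Finset.prod_le_prod_of_subset_of_one_le hsub
            (fun q hq => pow_nonneg (inv_nonneg.2 (one_sub_inv_prime_pos (hRp q hq)).le) 3)
            fun q hq _ => one_le_pow₀ (one_le_inv_one_sub_inv (hp' q hq))
      _ = 8 * ∏ q ∈ M.primeFactors.erase 2, ((1 - 1 / (q : ℝ))⁻¹) ^ 3 := by
          rw [Finset.prod_insert (by simp)]; norm_num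
      _ ≤ 8 * cubeRatio M := by
          refine mul_le_mul_of_nonneg_left ?_ (by norm_num)
          exact Finset.prod_le_prod_of_subset_of_one_le (Finset.erase_subset _ _)
            (fun q hq => zero_le_one.trans (one_le_pow₀ (one_le_inv_one_sub_inv
              (Nat.prime_of_mem_primeFactors (Finset.mem_of_mem_erase hq)))))
            fun q hq _ => one_le_pow₀
              (one_le_inv_one_sub_inv (Nat.prime_of_mem_primeFactors hq))
  calc ∏ q ∈ P, (1 - (3 : ℝ) / q) ≤ (∏ q ∈ P, (1 - 1 / (q : ℝ))) ^ 3 := by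
        rw [← Finset.prod_pow]; exact h1
    _ ≤ (1 / Real.log W) ^ 3 * (8 * cubeRatio M) := by
        rw [h2, mul_pow]
        refine mul_le_mul ?_ h3 ?_ (by positivity)
        · exact pow_le_pow_left₀ (Finset.prod_nonneg fun q hq =>
            (one_sub_inv_prime_pos (hpr q hq)).le) (prod_one_sub_inv_primesBelow_le hW) 3
        · exact pow_nonneg (Finset.prod_nonneg fun q hq =>
            inv_nonneg.2 (one_sub_inv_prime_pos (hRp q hq)).le) 3
    _ = _ := by rw [div_pow]; ring

theorem exists_prod_one_add_le : ∃ C : ℝ, 0 < C ∧ ∀ W : ℕ, 3 ≤ W →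
    ∏ q ∈ W.primesBelow, (1 + 3 * Real.exp 1 / (q : ℝ)) ≤ C * Real.log W ^ 9 := by
  obtain ⟨C, hC⟩ := exists_sum_inv_primesBelow_le
  refine ⟨Real.exp (9 * C), Real.exp_pos _, fun W hW => ?_⟩
  have hlog : 0 < Real.log W := Real.log_pos (by exact_mod_cast (by omega : 1 < W))
  calc ∏ q ∈ W.primesBelow, (1 + 3 * Real.exp 1 / (q : ℝ))
      ≤ ∏ q ∈ W.primesBelow, Real.exp (9 * (1 / (q : ℝ))) := by
        refine Finset.prod_le_prod (fun q _ => by positivity) fun q _ => ?_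
        have h1 := Real.add_one_le_exp (9 * (1 / (q : ℝ)))
        have h2 : 3 * Real.exp 1 / (q : ℝ) ≤ 9 * (1 / (q : ℝ)) := by
          rw [mul_one_div]
          gcongr
          linarith [Real.exp_one_lt_d9]
        linarith
    _ = Real.exp (9 * ∑ q ∈ W.primesBelow, 1 / (q : ℝ)) := by
        rw [← Real.exp_sum, Finset.mul_sum]
    _ ≤ Real.exp (9 * (Real.log (Real.log W) + C)) := by
        gcongr
        exact hC W hW
    _ = _ := by
        rw [mul_add, Real.exp_add, mul_comm, show (9 : ℝ) * Real.log (Real.log W) =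
          ((9 : ℕ) : ℝ) * Real.log (Real.log W) by norm_num, Real.exp_nat_mul, Real.exp_log hlog]

/-- Sieve bound for `m, m + 2, m + 4` having no prime factor below `W` outside the divisors of the
modulus. -/
theorem exists_card_sifted_primesBelow_le : ∃ C : ℝ, 0 < C ∧ ∀ X M c k W : ℕ, 0 < M → 3 ≤ W →
    12 * Real.log (Real.log W) ≤ 2 * k →
    ((((Finset.range X).filter fun m => m ≡ c [MOD M] ∧
        ∀ q ∈ W.primesBelow.filter (fun q => q ≠ 2 ∧ ¬ q ∣ M),
          ¬ q ∣ m * (m + 2) * (m + 4)).card : ℕ) : ℝ) ≤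
      C * ((X : ℝ) / M * cubeRatio M / Real.log W ^ 3) + Real.exp 3 * (W : ℝ) ^ (2 * k) := by
  obtain ⟨C, hC0, hC⟩ := exists_prod_one_add_le
  refine ⟨8 + C, by positivity, fun X M c k W hM hW hk => ?_⟩
  have hlog : 0 < Real.log W := Real.log_pos (by exact_mod_cast (by omega : 1 < W))
  set P := W.primesBelow.filter (fun q => q ≠ 2 ∧ ¬ q ∣ M) with hP
  have hPp : ∀ q ∈ P, q.Prime ∧ q ≠ 2 ∧ q.Coprime M := fun q hq => by
    obtain ⟨h1, h2, h3⟩ := Finset.mem_filter.1 hq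
    have := Nat.prime_of_mem_primesBelow h1
    exact ⟨this, h2, (Nat.Prime.coprime_iff_not_dvd this).2 h3⟩
  have hcard : (P.card : ℝ) ≤ W := by
    have h1 : P.card ≤ (Finset.range W).card :=
      Finset.card_le_card ((Finset.filter_subset _ _).trans (Finset.filter_subset _ _))
    rw [Finset.card_range] at h1
    exact_mod_cast h1
  have hW1 : (1 : ℝ) ≤ W := by exact_mod_cast (by omega : 1 ≤ W)
  refine (card_sifted_le X M c k hM P hPp hW1 hcard).trans ?_
  refine add_le_add ?_ le_rfl
  have h1 := prod_one_sub_inv_coprime_le hW hM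
  have h2 : ∏ q ∈ P, (1 + 3 * Real.exp 1 / (q : ℝ)) ≤ C * Real.log W ^ 9 := by
    refine le_trans ?_ (hC W hW)
    refine Finset.prod_le_prod_of_subset_of_one_le (Finset.filter_subset _ _)
      (fun q _ => by positivity) fun q _ _ => ?_
    have : 0 ≤ 3 * Real.exp 1 / (q : ℝ) := by positivity
    linarith
  have h3 : Real.exp (-(2 * k)) ≤ 1 / Real.log W ^ 12 := by
    rw [one_div, ← Real.exp_log (pow_pos hlog 12), ← Real.exp_neg, Real.log_pow]
    apply Real.exp_le_exp.2
    push_cast; linarith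
  have h4 : Real.exp (-(2 * k)) * ∏ q ∈ P, (1 + 3 * Real.exp 1 / (q : ℝ)) ≤
      C * cubeRatio M / Real.log W ^ 3 := by
    calc _ ≤ 1 / Real.log W ^ 12 * (C * Real.log W ^ 9) :=
          mul_le_mul h3 h2 (Finset.prod_nonneg fun q _ => by positivity) (by positivity)
      _ = C * 1 / Real.log W ^ 3 := by field_simp
      _ ≤ _ := by gcongr; exact one_le_cubeRatio M
  calc (X : ℝ) / M * _ ≤ (X : ℝ) / M * (8 * cubeRatio M / Real.log W ^ 3 +
        C * cubeRatio M / Real.log W ^ 3) := by gcongr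
    _ = _ := by ring

theorem card_divisors_prime_pow {p : ℕ} (hp : p.Prime) (k : ℕ) :
    (p ^ k).divisors.card = k + 1 := by
  rw [Nat.divisors_prime_pow hp, Finset.card_map, Finset.card_range]

theorem card_divisors_mul_le (m n : ℕ) :
    (m * n).divisors.card ≤ m.divisors.card * n.divisors.card := by
  rw [Nat.divisors_mul]; exact Finset.card_mul_le

theorem IsTame.le_card_divisors {F : ℕ → ℝ} {α : ℝ} (hF : IsTame F α) (n : ℕ) :
    F n ≤ n.divisors.card := by
  induction n using Nat.recOnPosPrimePosCoprime with
  | prime_pow p n hp hn =>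
    rw [card_divisors_prime_pow hp]
    exact_mod_cast hF.prime_pow_le p hp n
  | zero => simp [hF.map_even 0 (by simp)]
  | one => simp [hF.map_one]
  | coprime a b ha hb hab iha ihb =>
    rw [hF.map_mul a b (by omega) (by omega) hab, hab.card_divisors_mul]
    push_cast
    exact mul_le_mul iha ihb (hF.nonneg _) (by positivity)

/-- Splitting off the smooth part of an integer. -/
theorem exists_smooth_mul_rough (z : ℕ) {n : ℕ} (hn : n ≠ 0) :
    ∃ a u, n = a * u ∧ a ∈ Nat.smoothNumbers z ∧ u ≠ 0 ∧ (∀ p, p.Prime → p ∣ u → z ≤ p) ∧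
      a.Coprime u := by
  suffices H : ∃ a u, n = a * u ∧ a ∈ Nat.smoothNumbers z ∧ u ≠ 0 ∧
      (∀ p, p.Prime → p ∣ u → z ≤ p) by
    obtain ⟨a, u, h1, h2, h3, h4⟩ := H
    refine ⟨a, u, h1, h2, h3, h4, ?_⟩
    rw [Nat.coprime_iff_gcd_eq_one]
    by_contra hg
    obtain ⟨p, hp, hpg⟩ := Nat.exists_prime_and_dvd hg
    have h5 := h4 p hp (hpg.trans (Nat.gcd_dvd_right _ _))
    have h6 := Nat.mem_smoothNumbers'.1 h2 p hp (hpg.trans (Nat.gcd_dvd_left _ _))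
    omega
  induction n using Nat.recOnMul with
  | zero => exact absurd rfl hn
  | one => exact ⟨1, 1, rfl, by simp [Nat.mem_smoothNumbers], one_ne_zero, fun p hp h =>
      absurd (Nat.dvd_one.1 h) hp.ne_one⟩
  | prime p hp =>
    rcases lt_or_ge p z with h | h
    · refine ⟨p, 1, (mul_one p).symm, ?_, one_ne_zero, fun q hq h =>
        absurd (Nat.dvd_one.1 h) hq.ne_one⟩
      rw [Nat.mem_smoothNumbers']
      intro q hq hqp
      rwa [(Nat.prime_dvd_prime_iff_eq hq hp).1 hqp]
    · refine ⟨1, p, (one_mul p).symm, by simp [Nat.mem_smoothNumbers], hp.ne_zero,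
        fun q hq hqp => ?_⟩
      rwa [(Nat.prime_dvd_prime_iff_eq hq hp).1 hqp]
  | mul a b iha ihb =>
    obtain ⟨a1, u1, e1, s1, n1, r1⟩ := iha (left_ne_zero_of_mul hn)
    obtain ⟨a2, u2, e2, s2, n2, r2⟩ := ihb (right_ne_zero_of_mul hn)
    refine ⟨a1 * a2, u1 * u2, by rw [e1, e2]; ring, Nat.mul_mem_smoothNumbers s1 s2,
      mul_ne_zero n1 n2, fun p hp h => ?_⟩
    rcases (Nat.Prime.dvd_mul hp).1 h with h | h
    exacts [r1 p hp h, r2 p hp h]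

theorem card_divisors_le_of_rough {z : ℕ} (hz : 2 ≤ z) {u : ℕ} (hu : u ≠ 0)
    (h : ∀ p, p.Prime → p ∣ u → z ≤ p) :
    (u.divisors.card : ℝ) ≤ Real.exp (Real.log 2 * (Real.log u / Real.log z)) := by
  have hz1 : (1 : ℝ) < z := by exact_mod_cast (by omega : 1 < z)
  have hlz : 0 < Real.log z := Real.log_pos hz1
  have hl2 : 0 < Real.log 2 := Real.log_pos (by norm_num)
  induction u using Nat.recOnMul with
  | zero => exact absurd rfl hu
  | one => simp
  | prime p hp =>
    have h1 := h p hp dvd_rfl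
    rw [hp.divisors, Finset.card_pair hp.one_lt.ne]
    have : Real.log z ≤ Real.log p :=
      Real.log_le_log (by linarith) (by exact_mod_cast h1)
    calc ((2 : ℕ) : ℝ) = Real.exp (Real.log 2 * 1) := by
          rw [mul_one, Real.exp_log (by norm_num)]; norm_num
      _ ≤ _ := by
          gcongr
          rwa [one_le_div hlz]
  | mul a b iha ihb =>
    have ha := left_ne_zero_of_mul hu
    have hb := right_ne_zero_of_mul hu
    have i1 := iha ha fun p hp hd => h p hp (hd.mul_right b)
    have i2 := ihb hb fun p hp hd => h p hp (hd.mul_left a)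
    calc ((a * b).divisors.card : ℝ) ≤ (a.divisors.card : ℝ) * b.divisors.card := by
          exact_mod_cast card_divisors_mul_le a b
      _ ≤ _ := mul_le_mul i1 i2 (by positivity) (Real.exp_pos _).le
      _ = _ := by
          rw [← Real.exp_add]
          push_cast
          rw [Real.log_mul (by exact_mod_cast ha) (by exact_mod_cast hb)]
          congr 1; ring

/-- Moments of the divisor function, with logarithmic weights. -/
theorem sum_card_divisors_pow_mul_le (N : ℕ) (g : ℕ → ℝ) (hg : ∀ n, 0 ≤ g n) (k : ℕ)
    (hgm : ∀ d e, 0 < e → 0 < d → g (d * e) = g d * g e) :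
    ∑ n ∈ Finset.Icc 1 N, (n.divisors.card : ℝ) ^ (k + 1) * g n ≤
      ∑ e ∈ Finset.Icc 1 N, (e.divisors.card : ℝ) ^ k * g e *
        ∑ d ∈ Finset.Icc 1 (N / e), (d.divisors.card : ℝ) ^ k * g d := by
  calc ∑ n ∈ Finset.Icc 1 N, (n.divisors.card : ℝ) ^ (k + 1) * g n
      = ∑ n ∈ Finset.Icc 1 N, ∑ x ∈ n.divisorsAntidiagonal, (n.divisors.card : ℝ) ^ k * g n := by
        refine Finset.sum_congr rfl fun n _ => ?_
        rw [Finset.sum_const, nsmul_eq_mul, ← Nat.map_div_right_divisors, Finset.card_map]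
        ring
    _ ≤ ∑ n ∈ Finset.Icc 1 N, ∑ x ∈ n.divisorsAntidiagonal,
          ((x.1.divisors.card : ℝ) ^ k * g x.1) * ((x.2.divisors.card : ℝ) ^ k * g x.2) := by
        refine Finset.sum_le_sum fun n _ => Finset.sum_le_sum fun x hx => ?_
        obtain ⟨h1, h2⟩ := Nat.mem_divisorsAntidiagonal.1 hx
        have e1 : x.1 ≠ 0 := by rintro h; rw [h, zero_mul] at h1; exact h2 h1.symm
        have e2 : x.2 ≠ 0 := by rintro h; rw [h, mul_zero] at h1; exact h2 h1.symm
        rw [← h1, hgm _ _ (Nat.pos_of_ne_zero e2) (Nat.pos_of_ne_zero e1)]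
        have h3 : ((x.1 * x.2).divisors.card : ℝ) ^ k ≤
            (x.1.divisors.card : ℝ) ^ k * (x.2.divisors.card : ℝ) ^ k := by
          rw [← mul_pow]
          gcongr
          exact_mod_cast card_divisors_mul_le _ _
        calc _ ≤ (x.1.divisors.card : ℝ) ^ k * (x.2.divisors.card : ℝ) ^ k * (g x.1 * g x.2) :=
              mul_le_mul_of_nonneg_right h3 (mul_nonneg (hg _) (hg _))
          _ = _ := by ring
    _ ≤ _ := by
        rw [Finset.sum_sigma']
        simp_rw [Finset.mul_sum]
        rw [Finset.sum_sigma']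
        refine le_of_eq ?_
        refine Finset.sum_bij' (fun x _ => ⟨x.2.1, x.2.2⟩) (fun x _ => ⟨x.1 * x.2, (x.1, x.2)⟩)
          ?_ ?_ ?_ ?_ ?_
        · rintro ⟨n, d, e⟩ h
          simp only [Finset.mem_sigma, Finset.mem_Icc, Nat.mem_divisorsAntidiagonal] at h ⊢
          obtain ⟨⟨h1, h2⟩, h3, h4⟩ := h
          have hd : 0 < d := Nat.pos_of_ne_zero (by rintro rfl; simp at h3; omega)
          have he : 0 < e := Nat.pos_of_ne_zero (by rintro rfl; simp at h3; omega)
          refine ⟨⟨hd, ?_⟩, he, ?_⟩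
          · nlinarith
          · rw [Nat.le_div_iff_mul_le hd]; nlinarith
        · rintro ⟨d, e⟩ h
          simp only [Finset.mem_sigma, Finset.mem_Icc, Nat.mem_divisorsAntidiagonal] at h ⊢
          obtain ⟨⟨h1, h2⟩, h3, h4⟩ := h
          rw [Nat.le_div_iff_mul_le h1] at h4
          have : 0 < d * e := Nat.mul_pos h1 h3
          refine ⟨⟨this, by nlinarith⟩, trivial, this.ne'⟩
        · rintro ⟨n, d, e⟩ h
          simp only [Finset.mem_sigma, Nat.mem_divisorsAntidiagonal] at h
          obtain ⟨_, rfl, _⟩ := h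
          rfl
        · rintro ⟨d, e⟩ h; rfl
        · rintro ⟨n, d, e⟩ h; rfl

theorem sum_card_divisors_pow_div_le (k N : ℕ) :
    ∑ n ∈ Finset.Icc 1 N, (n.divisors.card : ℝ) ^ k * (n : ℝ)⁻¹ ≤ (1 + Real.log N) ^ (2 ^ k) := by
  induction k with
  | zero =>
    simp only [pow_zero, one_mul, pow_one]
    have := harmonic_le_one_add_log N
    rw [harmonic_eq_sum_Icc] at this
    push_cast at this
    exact this
  | succ k ih =>
    refine (sum_card_divisors_pow_mul_le N (fun n => (n : ℝ)⁻¹) (fun n => by positivity) k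
      (fun d e _ _ => by push_cast; rw [mul_inv])).trans ?_
    have h0 : (0 : ℝ) ≤ Real.log N := Real.log_natCast_nonneg N
    calc _ ≤ ∑ e ∈ Finset.Icc 1 N, (e.divisors.card : ℝ) ^ k * (e : ℝ)⁻¹ *
          (1 + Real.log N) ^ (2 ^ k) := by
          refine Finset.sum_le_sum fun e he => ?_
          refine mul_le_mul_of_nonneg_left (le_trans ?_ ih) (by positivity)
          exact Finset.sum_le_sum_of_subset_of_nonneg
            (Finset.Icc_subset_Icc le_rfl (Nat.div_le_self _ _)) fun _ _ _ => by positivity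
      _ ≤ (1 + Real.log N) ^ (2 ^ k) * (1 + Real.log N) ^ (2 ^ k) := by
          rw [← Finset.sum_mul]
          exact mul_le_mul_of_nonneg_right ih (by positivity)
      _ = _ := by rw [← pow_add, pow_succ, mul_two]

theorem sum_card_divisors_pow_le (k N : ℕ) :
    ∑ n ∈ Finset.Icc 1 N, (n.divisors.card : ℝ) ^ k ≤ N * (1 + Real.log N) ^ (2 ^ k) := by
  refine le_trans ?_ (mul_le_mul_of_nonneg_left (sum_card_divisors_pow_div_le k N)
    (Nat.cast_nonneg N))
  rw [Finset.mul_sum]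
  refine Finset.sum_le_sum fun n hn => ?_
  obtain ⟨h1, h2⟩ := Finset.mem_Icc.1 hn
  have hn0 : (0 : ℝ) < n := by exact_mod_cast h1
  have : (1 : ℝ) ≤ N * (n : ℝ)⁻¹ := by
    rw [← div_eq_mul_inv, one_le_div hn0]; exact_mod_cast h2
  calc (n.divisors.card : ℝ) ^ k = (n.divisors.card : ℝ) ^ k * 1 := (mul_one _).symm
    _ ≤ (n.divisors.card : ℝ) ^ k * (N * (n : ℝ)⁻¹) := by gcongr
    _ = _ := by ring

theorem sum_primesBelow_inv_sq_le (N : ℕ) : ∑ q ∈ N.primesBelow, 1 / (q : ℝ) ^ 2 ≤ 1 := by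
  have h : ∀ n : ℕ, ∑ q ∈ Finset.range n, (if 2 ≤ q then 1 / (q : ℝ) ^ 2 else 0) ≤
      1 - 1 / ((max n 2 : ℕ) - 1 : ℝ) := by
    intro n
    induction n with
    | zero => norm_num
    | succ n ih =>
      rw [Finset.sum_range_succ]
      split_ifs with h2
      · rw [max_eq_left h2] at ih
        rw [max_eq_left (by omega)]
        have h3 : (2 : ℝ) ≤ n := by exact_mod_cast h2
        have h4 : 1 / (n : ℝ) ^ 2 ≤ 1 / ((n : ℝ) - 1) - 1 / n := by
          rw [div_sub_div _ _ (by linarith) (by linarith), div_le_div_iff₀ (by positivity)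
            (mul_pos (by linarith) (by linarith))]
          nlinarith
        push_cast
        rw [add_sub_cancel_right]
        linarith
      · rw [max_eq_right (by omega)] at ih ⊢
        linarith
  calc ∑ q ∈ N.primesBelow, 1 / (q : ℝ) ^ 2
      = ∑ q ∈ N.primesBelow, (if 2 ≤ q then 1 / (q : ℝ) ^ 2 else 0) :=
        Finset.sum_congr rfl fun q hq => by
          rw [if_pos (Nat.prime_of_mem_primesBelow hq).two_le]
    _ ≤ ∑ q ∈ Finset.range N, (if 2 ≤ q then 1 / (q : ℝ) ^ 2 else 0) :=
        Finset.sum_le_sum_of_subset_of_nonneg (Finset.filter_subset _ _)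
          fun q _ _ => by positivity
    _ ≤ _ := (h N).trans (by
        have : (2 : ℝ) ≤ (max N 2 : ℕ) := by exact_mod_cast le_max_right N 2
        have : 0 ≤ 1 / (((max N 2 : ℕ) : ℝ) - 1) := by
          apply div_nonneg zero_le_one; linarith
        linarith)

theorem summable_succ_mul_pow {x : ℝ} (h0 : 0 ≤ x) (h1 : x < 1) :
    Summable (fun j : ℕ => ((j : ℝ) + 1) * x ^ j) ∧
      HasSum (fun j : ℕ => ((j : ℝ) + 1) * x ^ j) (1 / (1 - x) ^ 2) := by
  have h := hasSum_choose_mul_geometric_of_norm_lt_one 1 (r := x)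
    (by rwa [Real.norm_eq_abs, abs_of_nonneg h0])
  have h2 : HasSum (fun j : ℕ => ((j : ℝ) + 1) * x ^ j) (1 / (1 - x) ^ 2) := by
    simpa using h
  exact ⟨h2.summable, h2⟩

theorem cubeRatio_prime_pow_le {q j : ℕ} (hq : q.Prime) (hq3 : 3 ≤ q) (hj : j ≠ 0) :
    cubeRatio (q ^ j) ≤ 1 + 8 / q := by
  rw [cubeRatio_prime_pow hq hj]
  have h3 : (3 : ℝ) ≤ q := by exact_mod_cast hq3
  have hx : 1 / (q : ℝ) ≤ 1 / 3 := one_div_le_one_div_of_le (by norm_num) h3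
  have hx0 : 0 < 1 / (q : ℝ) := by positivity
  rw [show (8 : ℝ) / q = 8 * (1 / q) by ring]
  set x := 1 / (q : ℝ)
  rw [inv_pow, inv_le_iff_one_le_mul₀ (pow_pos (by linarith) 3)]
  nlinarith [mul_nonneg hx0.le (sub_nonneg.2 hx), mul_nonneg (mul_nonneg hx0.le hx0.le)
    (sub_nonneg.2 hx), mul_nonneg (mul_nonneg (mul_nonneg hx0.le hx0.le) hx0.le) (sub_nonneg.2 hx)]

/-- The local factor at `q` of the series `∑ F(a) h(a) / a`. -/
theorem IsTame.local_factor_le {F : ℕ → ℝ} {α : ℝ} (hF : IsTame F α) {q : ℕ} (hq : q.Prime) :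
    Summable (fun j : ℕ => F (q ^ j) * cubeRatio (q ^ j) / ((q ^ j : ℕ) : ℝ)) ∧
      ∑' j : ℕ, F (q ^ j) * cubeRatio (q ^ j) / ((q ^ j : ℕ) : ℝ) ≤
        Real.exp (F q / q + 50 * (1 / (q : ℝ) ^ 2)) := by
  rcases eq_or_ne q 2 with rfl | h2
  · have h0 : ∀ j : ℕ, j ≠ 0 → F (2 ^ j) * cubeRatio (2 ^ j) / ((2 ^ j : ℕ) : ℝ) = 0 := by
      intro j hj
      rw [hF.map_even _ ((even_two).pow_of_ne_zero hj)]; simp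
    have h := hasSum_single 0 h0
    refine ⟨h.summable, ?_⟩
    rw [h.tsum_eq]
    simp only [pow_zero, hF.map_one, cubeRatio_one]
    rw [show ((1 : ℝ) * 1 / ((1 : ℕ) : ℝ)) = 1 by norm_num]
    apply Real.one_le_exp
    have := hF.nonneg 2
    positivity
  · have hq3 : 3 ≤ q := by have := hq.two_le; omega
    have h3 : (3 : ℝ) ≤ q := by exact_mod_cast hq3
    set x := 1 / (q : ℝ) with hx
    have hx0 : 0 < x := by positivity
    have hx3 : x ≤ 1 / 3 := one_div_le_one_div_of_le (by norm_num) h3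
    obtain ⟨hs, hsum⟩ := summable_succ_mul_pow hx0.le (by linarith : x < 1)
    have hterm : ∀ j : ℕ, F (q ^ j) * cubeRatio (q ^ j) / ((q ^ j : ℕ) : ℝ) ≤
        4 * (((j : ℝ) + 1) * x ^ j) := by
      intro j
      have hc : cubeRatio (q ^ j) ≤ 4 := by
        rcases eq_or_ne j 0 with rfl | hj
        · rw [pow_zero, cubeRatio_one]; norm_num
        · refine (cubeRatio_prime_pow_le hq hq3 hj).trans ?_
          rw [show (8 : ℝ) / q = 8 * (1 / q) by ring]; linarith
      have hF' := hF.prime_pow_le q hq j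
      calc _ ≤ ((j : ℝ) + 1) * 4 / ((q ^ j : ℕ) : ℝ) := by
            gcongr
            linarith [one_le_cubeRatio (q ^ j)]
        _ = _ := by rw [hx, _root_.one_div_pow]; push_cast; field_simp
    have hnn : ∀ j : ℕ, 0 ≤ F (q ^ j) * cubeRatio (q ^ j) / ((q ^ j : ℕ) : ℝ) := fun j =>
      div_nonneg (mul_nonneg (hF.nonneg _) (zero_le_one.trans (one_le_cubeRatio _)))
        (Nat.cast_nonneg _)
    have hS := Summable.of_nonneg_of_le hnn hterm (hs.mul_left 4)
    refine ⟨hS, ?_⟩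
    have ht2 : ∑' j : ℕ, 4 * ((((j + 2 : ℕ) : ℝ) + 1) * x ^ (j + 2)) =
        4 * (1 / (1 - x) ^ 2 - 1 - 2 * x) := by
      rw [tsum_mul_left]
      have := hs.sum_add_tsum_nat_add 2
      rw [hsum.tsum_eq, Finset.sum_range_succ, Finset.sum_range_one] at this
      norm_num at this ⊢
      linarith
    rw [← hS.sum_add_tsum_nat_add 2, Finset.sum_range_succ, Finset.sum_range_one]
    have hT : ∑' j : ℕ, F (q ^ (j + 2)) * cubeRatio (q ^ (j + 2)) / ((q ^ (j + 2) : ℕ) : ℝ) ≤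
        4 * (1 / (1 - x) ^ 2 - 1 - 2 * x) := by
      rw [← ht2]
      exact ((summable_nat_add_iff 2).2 hS).tsum_le_tsum (fun j => hterm (j + 2))
        ((summable_nat_add_iff 2).2 (hs.mul_left 4))
    have hq4 : 1 / (1 - x) ^ 2 - 1 - 2 * x ≤ 7 * x ^ 2 := by
      rw [sub_sub, sub_le_iff_le_add, div_le_iff₀ (pow_pos (by linarith) 2)]
      nlinarith [mul_nonneg hx0.le (sub_nonneg.2 hx3), mul_nonneg (mul_nonneg hx0.le hx0.le)
        (sub_nonneg.2 hx3), mul_nonneg (mul_nonneg (mul_nonneg hx0.le hx0.le) hx0.le)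
        (sub_nonneg.2 hx3)]
    have h1 : F (q ^ 1) * cubeRatio (q ^ 1) / ((q ^ 1 : ℕ) : ℝ) ≤ F q / q + 16 * x ^ 2 := by
      have hc := cubeRatio_prime_pow_le hq hq3 one_ne_zero
      have hF1 := hF.prime_pow_le q hq 1
      have hF0 := hF.nonneg q
      rw [pow_one] at hc hF1 ⊢
      rw [show (8 : ℝ) / q = 8 * x by rw [hx]; ring] at hc
      norm_num at hF1
      rw [div_eq_mul_one_div, div_eq_mul_one_div (F q), ← hx]
      have : F q * cubeRatio q ≤ F q + 16 * x := by nlinarith [mul_nonneg hF0 hx0.le]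
      nlinarith
    have e0 : F (q ^ 0) * cubeRatio (q ^ 0) / ((q ^ 0 : ℕ) : ℝ) = 1 := by
      simp [hF.map_one, cubeRatio_one]
    have hx2 : 1 / (q : ℝ) ^ 2 = x ^ 2 := by rw [hx, div_pow, one_pow]
    rw [e0, hx2]
    have := Real.add_one_le_exp (F q / q + 50 * x ^ 2)
    nlinarith [sq_nonneg x]

theorem IsTame.exists_sum_smooth_le {F : ℕ → ℝ} {α : ℝ} (hF : IsTame F α) :
    ∃ C : ℝ, 0 < C ∧ ∀ z : ℕ, 3 ≤ z → ∀ A : Finset ℕ, (∀ a ∈ A, a ∈ Nat.smoothNumbers z) →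
      ∑ a ∈ A, F a * cubeRatio a / a ≤ C * Real.log z ^ α := by
  obtain ⟨C, hC⟩ := hF.sum_le
  refine ⟨Real.exp (C + 50), Real.exp_pos _, fun z hz A hA => ?_⟩
  have hlog : 0 < Real.log z := Real.log_pos (by exact_mod_cast (by omega : 1 < z))
  set f : ℕ → ℝ := fun a => F a * cubeRatio a / a with hf
  have hnn : ∀ a, 0 ≤ f a := fun j =>
      div_nonneg (mul_nonneg (hF.nonneg _) (zero_le_one.trans (one_le_cubeRatio _)))
        (Nat.cast_nonneg _)
  have hf1 : f 1 = 1 := by simp [hf, hF.map_one, cubeRatio_one]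
  have hmul : ∀ {m n : ℕ}, m.Coprime n → f (m * n) = f m * f n := by
    intro m n hmn
    rcases eq_or_ne m 0 with rfl | hm
    · have : f 0 = 0 := by simp [hf]
      rw [zero_mul, this, zero_mul]
    rcases eq_or_ne n 0 with rfl | hn
    · have : f 0 = 0 := by simp [hf]
      rw [mul_zero, this, mul_zero]
    simp only [hf, hF.map_mul m n hm hn hmn, cubeRatio_mul hmn]
    push_cast
    rw [mul_mul_mul_comm, mul_div_mul_comm]
  obtain ⟨h1, h2⟩ := EulerProduct.summable_and_hasSum_smoothNumbers_prod_primesBelow_tsum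
    (f := f) hf1 hmul (fun {p} hp => by
      have := (hF.local_factor_le hp).1.norm
      exact this) z
  have h3 : ∑ a ∈ A, f a ≤ ∏ p ∈ z.primesBelow, ∑' n : ℕ, f (p ^ n) := by
    rw [← h2.tsum_eq]
    have e : ∑ a ∈ A, f a = ∑ a ∈ A.subtype (· ∈ Nat.smoothNumbers z), f a := by
      rw [Finset.sum_subtype_of_mem (f := f) hA]
    rw [e]
    exact h2.summable.sum_le_tsum _ fun a _ => hnn a
  refine h3.trans ?_
  calc ∏ p ∈ z.primesBelow, ∑' n : ℕ, f (p ^ n)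
      ≤ ∏ p ∈ z.primesBelow, Real.exp (F p / p + 50 * (1 / (p : ℝ) ^ 2)) :=
        Finset.prod_le_prod (fun p _ => tsum_nonneg fun n => hnn _) fun p hp =>
          (hF.local_factor_le (Nat.prime_of_mem_primesBelow hp)).2
    _ = Real.exp (∑ p ∈ z.primesBelow, F p / p + 50 * ∑ p ∈ z.primesBelow, 1 / (p : ℝ) ^ 2) := by
        rw [← Real.exp_sum, Finset.sum_add_distrib, Finset.mul_sum]
    _ ≤ Real.exp (α * Real.log (Real.log z) + C + 50) := by
        apply Real.exp_le_exp.2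
        linarith [hC z hz, sum_primesBelow_inv_sq_le z]
    _ = _ := by
        rw [add_assoc, Real.exp_add, mul_comm, Real.rpow_def_of_pos hlog, mul_comm α]

theorem one_le_log_of_three_le {z : ℕ} (hz : 3 ≤ z) : 1 ≤ Real.log z := by
  rw [Real.le_log_iff_exp_le (by exact_mod_cast (by omega : 0 < z))]
  have : (3 : ℝ) ≤ z := by exact_mod_cast hz
  linarith [Real.exp_one_lt_d9]

theorem exists_prod_inv_one_sub_rpow_le {B : ℝ} (hB : 0 < B) :
    ∃ C : ℝ, 0 < C ∧ ∀ z : ℕ, 3 ≤ z → 4 * B ≤ Real.log z →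
      ∏ q ∈ z.primesBelow, (1 - (q : ℝ) ^ (B / Real.log z - 1))⁻¹ ≤ C * Real.log z := by
  obtain ⟨C, hC⟩ := exists_sum_inv_primesBelow_le
  refine ⟨Real.exp (C + 3 * B * Real.exp B + 3 * Real.exp B ^ 2), Real.exp_pos _,
    fun z hz hBz => ?_⟩
  have hl1 := one_le_log_of_three_le hz
  set η := B / Real.log z with hη
  have hη0 : 0 < η := by positivity
  have hη4 : η ≤ 1 / 4 := by rw [hη, div_le_iff₀ (by linarith)]; linarith
  have key : ∀ q ∈ z.primesBelow, 0 ≤ (1 - (q : ℝ) ^ (η - 1))⁻¹ ∧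
      (1 - (q : ℝ) ^ (η - 1))⁻¹ ≤ Real.exp (1 / q + η * Real.exp B * (Real.log q / q) +
        3 * Real.exp B ^ 2 * (1 / (q : ℝ) ^ 2)) := by
    intro q hq
    have hqp := Nat.prime_of_mem_primesBelow hq
    have hq2 : (2 : ℝ) ≤ q := by exact_mod_cast hqp.two_le
    have hq0 : (0 : ℝ) < q := by linarith
    have hlq : 0 < Real.log q := Real.log_pos (by linarith)
    have hqz : Real.log q ≤ Real.log z :=
      Real.log_le_log hq0 (by exact_mod_cast (Nat.lt_of_mem_primesBelow hq).le)
    set x := (q : ℝ) ^ (η - 1) with hx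
    have hx0 : 0 < x := Real.rpow_pos_of_pos hq0 _
    have hx1 : x ≤ 5 / 8 := by
      calc x ≤ (q : ℝ) ^ (-(3 / 4) : ℝ) :=
            Real.rpow_le_rpow_of_exponent_le (by linarith) (by linarith)
        _ ≤ (2 : ℝ) ^ (-(3 / 4) : ℝ) :=
            Real.rpow_le_rpow_of_nonpos (by norm_num) hq2 (by norm_num)
        _ = (1 / 2 : ℝ) ^ (3 / 4 : ℝ) := by
            rw [one_div, Real.inv_rpow (by norm_num), Real.rpow_neg (by norm_num)]
        _ ≤ 1 - (3 / 4) / 2 := half_rpow_le (by norm_num) (by norm_num)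
        _ = 5 / 8 := by norm_num
    have ht : η * Real.log q ≤ B := by
      calc η * Real.log q ≤ η * Real.log z := by gcongr
        _ = B := by rw [hη]; field_simp
    have hxe : x = Real.exp (η * Real.log q) / q := by
      rw [hx, Real.rpow_sub hq0, Real.rpow_one, Real.rpow_def_of_pos hq0, mul_comm]
    have hx2 : x ≤ 1 / q + η * Real.exp B * (Real.log q / q) := by
      have h1 : Real.exp (η * Real.log q) ≤ 1 + η * Real.log q * Real.exp B := by
        have h2 := Real.add_one_le_exp (-(η * Real.log q))
        have h3 : Real.exp (η * Real.log q) * Real.exp (-(η * Real.log q)) = 1 := by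
          rw [← Real.exp_add, add_neg_cancel, Real.exp_zero]
        have h4 : Real.exp (η * Real.log q) ≤ Real.exp B := Real.exp_le_exp.2 ht
        have h5 : 0 < η * Real.log q := by positivity
        nlinarith [Real.exp_pos (η * Real.log q)]
      rw [hxe]
      calc _ ≤ (1 + η * Real.log q * Real.exp B) / q := by gcongr
        _ = _ := by ring
    have hx3 : x ^ 2 ≤ Real.exp B ^ 2 * (1 / (q : ℝ) ^ 2) := by
      rw [hxe, div_pow, mul_one_div]
      gcongr
    have h1x : 0 < 1 - x := by linarith
    refine ⟨inv_nonneg.2 h1x.le, ?_⟩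
    have e1 : (1 - x)⁻¹ = x / (1 - x) + 1 := by field_simp; ring
    have e2 : x / (1 - x) ≤ x + 3 * x ^ 2 := by
      rw [div_le_iff₀ h1x]
      nlinarith [sq_nonneg x, mul_nonneg (sq_nonneg x) (sub_nonneg.2 hx1)]
    rw [e1]
    refine (Real.add_one_le_exp _).trans (Real.exp_le_exp.2 ?_)
    linarith
  refine (Finset.prod_le_prod (fun q hq => (key q hq).1) fun q hq => (key q hq).2).trans ?_
  rw [← Real.exp_sum]
  have hE : 0 < Real.exp B := Real.exp_pos B
  have h1 := hC z hz
  have h2 := sum_log_div_primesBelow_le (by omega : 1 ≤ z)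
  have h3 := sum_primesBelow_inv_sq_le z
  have h4 : η * Real.exp B * ∑ q ∈ z.primesBelow, Real.log q / q ≤ 3 * B * Real.exp B := by
    have hl4 : Real.log 4 ≤ 2 := by
      rw [show (4 : ℝ) = 2 ^ 2 by norm_num, Real.log_pow]; push_cast
      linarith [Real.log_two_lt_d9]
    calc _ ≤ η * Real.exp B * (3 * Real.log z) := by gcongr; linarith
      _ = _ := by rw [hη]; field_simp
  have h5 : 3 * Real.exp B ^ 2 * ∑ q ∈ z.primesBelow, 1 / (q : ℝ) ^ 2 ≤ 3 * Real.exp B ^ 2 := by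
    have := mul_le_mul_of_nonneg_left h3 (by positivity : (0 : ℝ) ≤ 3 * Real.exp B ^ 2)
    linarith
  rw [Finset.sum_add_distrib, Finset.sum_add_distrib, ← Finset.mul_sum, ← Finset.mul_sum]
  calc _ ≤ Real.exp (Real.log (Real.log z) + (C + 3 * B * Real.exp B + 3 * Real.exp B ^ 2)) := by
        apply Real.exp_le_exp.2; linarith
    _ = _ := by rw [Real.exp_add, Real.exp_log (by linarith), mul_comm]

theorem card_multiples_le (N a : ℕ) :
    (((Finset.Icc 1 N).filter fun n => a ∣ n).card : ℝ) ≤ N / a := by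
  have : ((Finset.Icc 1 N).filter fun n => a ∣ n).card = N / a := by
    have := Nat.Ioc_filter_dvd_card_eq_div N a
    rw [← this]
    rfl
  rw [this]
  exact Nat.cast_div_le

open scoped Classical in
/-- Rankin's bound for the number of integers with a large smooth divisor. -/
theorem exists_card_large_smooth_divisor_le {B : ℝ} (hB : 0 < B) :
    ∃ C : ℝ, 0 < C ∧ ∀ z N Y : ℕ, 3 ≤ z → 4 * B ≤ Real.log z → 1 ≤ Y →
      (((Finset.Icc 1 N).filter fun n => ∃ a ∈ Nat.smoothNumbers z, Y < a ∧ a ∣ n).card : ℝ) ≤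
        C * N * Real.log z * Real.exp (-(B * Real.log Y / Real.log z)) := by
  obtain ⟨C, hC0, hC⟩ := exists_prod_inv_one_sub_rpow_le hB
  refine ⟨C, hC0, fun z N Y hz hBz hY => ?_⟩
  have hl1 := one_le_log_of_three_le hz
  set η := B / Real.log z with hη
  have hη0 : 0 < η := by positivity
  have hη4 : η ≤ 1 / 4 := by rw [hη, div_le_iff₀ (by linarith)]; linarith
  have hY0 : (0 : ℝ) < Y := by exact_mod_cast hY
  set A := (Finset.Icc 1 N).filter fun a => a ∈ Nat.smoothNumbers z with hA
  have h1 : (((Finset.Icc 1 N).filter fun n => ∃ a ∈ Nat.smoothNumbers z, Y < a ∧ a ∣ n).card : ℝ)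
      ≤ ∑ n ∈ Finset.Icc 1 N, ∑ a ∈ A, if a ∣ n then ((a : ℝ) / Y) ^ η else 0 := by
    rw [Finset.card_filter]
    push_cast
    refine Finset.sum_le_sum fun n hn => ?_
    have hnn : ∀ a ∈ A, 0 ≤ (if a ∣ n then ((a : ℝ) / Y) ^ η else 0) := fun a _ => by
      split_ifs
      · positivity
      · exact le_rfl
    split_ifs with h
    · obtain ⟨a, ha, hYa, han⟩ := h
      obtain ⟨hn1, hnN⟩ := Finset.mem_Icc.1 hn
      have haA : a ∈ A := by
        rw [hA, Finset.mem_filter, Finset.mem_Icc]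
        exact ⟨⟨by omega, (Nat.le_of_dvd (by omega) han).trans hnN⟩, ha⟩
      refine le_trans ?_ (Finset.single_le_sum hnn haA)
      rw [if_pos han]
      apply Real.one_le_rpow _ hη0.le
      rw [one_le_div hY0]; exact_mod_cast hYa.le
    · exact Finset.sum_nonneg hnn
  have h2 : ∑ n ∈ Finset.Icc 1 N, ∑ a ∈ A, (if a ∣ n then ((a : ℝ) / Y) ^ η else 0) ≤
      ∑ a ∈ A, N * (Y : ℝ) ^ (-η) * (a : ℝ) ^ (η - 1) := by
    rw [Finset.sum_comm]
    refine Finset.sum_le_sum fun a ha => ?_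
    have ha0 : (0 : ℝ) < a := by
      exact_mod_cast (Finset.mem_Icc.1 (Finset.mem_filter.1 ha).1).1
    rw [← Finset.sum_filter, Finset.sum_const, nsmul_eq_mul]
    calc _ ≤ (N : ℝ) / a * ((a : ℝ) / Y) ^ η := by
          gcongr
          convert card_multiples_le N a
      _ = _ := by
          rw [Real.div_rpow ha0.le hY0.le, Real.rpow_neg hY0.le, Real.rpow_sub ha0, Real.rpow_one]
          field_simp
  let f : ℕ →* ℝ :=
    { toFun := fun n => (n : ℝ) ^ (η - 1)
      map_one' := by simp
      map_mul' := fun m n => by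
        push_cast
        exact Real.mul_rpow (Nat.cast_nonneg m) (Nat.cast_nonneg n) }
  have hf : ∀ {p : ℕ}, p.Prime → ‖f p‖ < 1 := fun {p} hp => by
    have hp1 : (1 : ℝ) < p := by exact_mod_cast hp.one_lt
    change ‖(p : ℝ) ^ (η - 1)‖ < 1
    rw [Real.norm_of_nonneg (by positivity)]
    exact Real.rpow_lt_one_of_one_lt_of_neg hp1 (by linarith)
  obtain ⟨_, h4⟩ := EulerProduct.summable_and_hasSum_smoothNumbers_prod_primesBelow_geometric hf z
  have h5 : ∑ a ∈ A, (a : ℝ) ^ (η - 1) ≤ C * Real.log z := by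
    refine le_trans ?_ (hC z hz hBz)
    have h6 := h4.tsum_eq
    change _ ≤ ∏ p ∈ z.primesBelow, (1 - f p)⁻¹
    rw [← h6]
    have e : ∑ a ∈ A, (a : ℝ) ^ (η - 1) = ∑ a ∈ A.subtype (· ∈ Nat.smoothNumbers z), f a := by
      rw [Finset.sum_subtype_of_mem (f := fun a => f a) fun a ha => (Finset.mem_filter.1 ha).2]
      rfl
    rw [e]
    exact h4.summable.sum_le_tsum _ fun a _ => Real.rpow_nonneg (Nat.cast_nonneg _) _
  refine h1.trans (h2.trans ?_)
  rw [← Finset.mul_sum]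
  have e : (Y : ℝ) ^ (-η) = Real.exp (-(B * Real.log Y / Real.log z)) := by
    rw [Real.rpow_def_of_pos hY0, hη]
    congr 1; ring
  calc _ ≤ (N : ℝ) * (Y : ℝ) ^ (-η) * (C * Real.log z) := by gcongr
    _ = _ := by rw [e]; ring

/-- `m` is divisible by `b`, `m + 4` by `a`, and `m, m + 2, m + 4` have no further odd prime factor
below `W`. -/
def IsSifted (W a b m : ℕ) : Prop :=
  b ∣ m ∧ a ∣ m + 4 ∧ ∀ q ∈ W.primesBelow.filter (fun q => q ≠ 2 ∧ ¬ q ∣ a * b),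
    ¬ q ∣ m * (m + 2) * (m + 4)

theorem exists_modEq_iff_dvd {a b : ℕ} (ha : 0 < a) (hab : a.Coprime b) :
    ∃ c, ∀ m, (b ∣ m ∧ a ∣ m + 4) ↔ m ≡ c [MOD a * b] := by
  obtain ⟨c, h1, h2⟩ := Nat.chineseRemainder hab (4 * a - 4) 0
  have key : ∀ m, a ∣ m + 4 ↔ m ≡ 4 * a - 4 [MOD a] := fun m => by
    rw [← Nat.modEq_zero_iff_dvd]
    have e : 4 * a - 4 + 4 = 4 * a := by omega
    have e2 : 4 * a ≡ 0 [MOD a] := by simp [Nat.ModEq]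
    constructor
    · intro h
      apply Nat.ModEq.add_right_cancel' 4
      rw [e]; exact h.trans e2.symm
    · intro h
      have := h.add_right 4
      rw [e] at this; exact this.trans e2
  refine ⟨c, fun m => ?_⟩
  rw [key, ← Nat.modEq_zero_iff_dvd, and_comm]
  constructor
  · rintro ⟨h3, h4⟩
    exact (Nat.modEq_and_modEq_iff_modEq_mul hab).1 ⟨h3.trans h1.symm, h4.trans h2.symm⟩
  · intro h
    exact ⟨(Nat.ModEq.of_mul_right b h).trans h1, (Nat.ModEq.of_mul_left a h).trans h2⟩

open scoped Classical in
theorem exists_card_isSifted_le : ∃ C : ℝ, 0 < C ∧ ∀ X k W a b : ℕ, 0 < a → 0 < b →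
    a.Coprime b → 3 ≤ W → 12 * Real.log (Real.log W) ≤ 2 * k →
    (((Finset.range X).filter fun m => IsSifted W a b m).card : ℝ) ≤
      C * X / Real.log W ^ 3 * (cubeRatio a / a) * (cubeRatio b / b) +
        Real.exp 3 * (W : ℝ) ^ (2 * k) := by
  obtain ⟨C, hC0, hC⟩ := exists_card_sifted_primesBelow_le
  refine ⟨C, hC0, fun X k W a b ha hb hab hW hk => ?_⟩
  obtain ⟨c, hc⟩ := exists_modEq_iff_dvd ha hab
  have h := hC X (a * b) c k W (Nat.mul_pos ha hb) hW hk
  have e : (Finset.range X).filter (fun m => IsSifted W a b m) =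
      (Finset.range X).filter fun m => m ≡ c [MOD a * b] ∧
        ∀ q ∈ W.primesBelow.filter (fun q => q ≠ 2 ∧ ¬ q ∣ a * b),
          ¬ q ∣ m * (m + 2) * (m + 4) := by
    ext m
    simp only [Finset.mem_filter, IsSifted, ← hc, and_assoc]
  rw [e]
  refine h.trans (le_of_eq ?_)
  rw [cubeRatio_mul hab]
  push_cast
  congr 1
  have : (a : ℝ) ≠ 0 := by positivity
  have : (b : ℝ) ≠ 0 := by positivity
  field_simp

/-- `n` has a `z`-smooth divisor exceeding `Y`. -/
def HasLargeSmoothDivisor (z Y n : ℕ) : Prop := ∃ a ∈ Nat.smoothNumbers z, Y < a ∧ a ∣ n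

theorem IsTame.exists_smooth_part {F : ℕ → ℝ} {α : ℝ} (hF : IsTame F α) {z Y n N : ℕ} (hz : 2 ≤ z)
    (hn : n ≠ 0) (hnN : n ≤ N) (h : ¬ HasLargeSmoothDivisor z Y n) {Δ : ℝ}
    (hΔ : Real.exp (Real.log 2 * (Real.log N / Real.log z)) ≤ Δ) :
    ∃ a ∈ (Finset.Icc 1 Y), a ∈ Nat.smoothNumbers z ∧ a ∣ n ∧ F n ≤ F a * Δ ∧
      ∀ q, q.Prime → q < z → q ∣ n → q ∣ a := by
  obtain ⟨a, u, rfl, ha, hu, hr, hau⟩ := exists_smooth_mul_rough z hn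
  have ha0 : a ≠ 0 := left_ne_zero_of_mul hn
  have haY : a ≤ Y := by
    by_contra hY
    exact h ⟨a, ha, by omega, dvd_mul_right a u⟩
  refine ⟨a, Finset.mem_Icc.2 ⟨by omega, haY⟩, ha, dvd_mul_right a u, ?_, ?_⟩
  · rw [hF.map_mul a u ha0 hu hau]
    refine mul_le_mul_of_nonneg_left ?_ (hF.nonneg a)
    refine (hF.le_card_divisors u).trans ((card_divisors_le_of_rough hz hu hr).trans ?_)
    refine le_trans (Real.exp_le_exp.2 ?_) hΔ
    have huN : u ≤ N := le_trans (Nat.le_mul_of_pos_left u (by omega)) hnN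
    have hl2 : 0 ≤ Real.log 2 := Real.log_nonneg (by norm_num)
    have hlz : 0 ≤ Real.log z := Real.log_natCast_nonneg z
    have : Real.log u ≤ Real.log N :=
      Real.log_le_log (by exact_mod_cast Nat.pos_of_ne_zero hu) (by exact_mod_cast huN)
    gcongr
  · intro q hq hqz hqn
    rcases hq.dvd_mul.1 hqn with h | h
    · exact h
    · have := hr q hq h; omega

open scoped Classical in
theorem prime_pair_term_le {F G : ℕ → ℝ} {α β : ℝ} (hF : IsTame F α) (hG : IsTame G β)
    {X z W Y : ℕ} (hW : 3 ≤ W) (hWz : W ≤ z) {Δ T : ℝ} (hT : 0 < T)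
    (hΔ : Real.exp (Real.log 2 * (Real.log (X + 4 : ℕ) / Real.log z)) ≤ Δ)
    {m : ℕ} (hm : m < X) (hp : (m + 2).Prime) :
    F (m + 4) * G m ≤ (if m < W then ((W : ℝ) + 4) ^ 2 else 0) +
      Δ ^ 2 * (∑ a ∈ (Finset.Icc 1 Y).filter (· ∈ Nat.smoothNumbers z),
        ∑ b ∈ (Finset.Icc 1 Y).filter (· ∈ Nat.smoothNumbers z),
          if a.Coprime b ∧ IsSifted W a b m then F a * G b else 0) +
      ((if HasLargeSmoothDivisor z Y (m + 4) then T else 0) +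
        (if m ≠ 0 ∧ HasLargeSmoothDivisor z Y m then T else 0)) +
      (((m + 4).divisors.card : ℝ) ^ 4 + (m.divisors.card : ℝ) ^ 4) / T := by
  set t1 : ℝ := if m < W then ((W : ℝ) + 4) ^ 2 else 0 with ht1
  set S := (Finset.Icc 1 Y).filter (· ∈ Nat.smoothNumbers z) with hS
  set t2 : ℝ := Δ ^ 2 * (∑ a ∈ S, ∑ b ∈ S,
          if a.Coprime b ∧ IsSifted W a b m then F a * G b else 0) with ht2
  set t3 : ℝ := if HasLargeSmoothDivisor z Y (m + 4) then T else 0 with ht3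
  set t4 : ℝ := if m ≠ 0 ∧ HasLargeSmoothDivisor z Y m then T else 0 with ht4
  set t5 : ℝ := (((m + 4).divisors.card : ℝ) ^ 4 + (m.divisors.card : ℝ) ^ 4) / T with ht5
  have n1 : 0 ≤ t1 := by rw [ht1]; split_ifs <;> positivity
  have nn : ∀ a b, 0 ≤ (if a.Coprime b ∧ IsSifted W a b m then F a * G b else 0) := fun a b => by
    split_ifs
    · exact mul_nonneg (hF.nonneg _) (hG.nonneg _)
    · exact le_rfl
  have n2 : 0 ≤ t2 := mul_nonneg (sq_nonneg _)
    (Finset.sum_nonneg fun a _ => Finset.sum_nonneg fun b _ => nn a b)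
  have n3 : 0 ≤ t3 := by rw [ht3]; split_ifs <;> linarith
  have n4 : 0 ≤ t4 := by rw [ht4]; split_ifs <;> linarith
  have n5 : 0 ≤ t5 := div_nonneg (add_nonneg (pow_nonneg (Nat.cast_nonneg _) _)
    (pow_nonneg (Nat.cast_nonneg _) _)) hT.le
  have hFd := hF.le_card_divisors (m + 4)
  have hGd := hG.le_card_divisors m
  have hF0 := hF.nonneg (m + 4)
  have hG0 := hG.nonneg m
  have hFG : F (m + 4) * G m ≤ ((m + 4).divisors.card : ℝ) * m.divisors.card :=
    mul_le_mul hFd hGd hG0 (Nat.cast_nonneg _)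
  by_cases hmW : m < W
  · have h1 : t1 = ((W : ℝ) + 4) ^ 2 := if_pos hmW
    have h2 : ((m + 4).divisors.card : ℝ) ≤ W + 4 := by
      exact_mod_cast (Nat.card_divisors_le_self _).trans (by omega)
    have h3 : (m.divisors.card : ℝ) ≤ W + 4 := by
      exact_mod_cast (Nat.card_divisors_le_self _).trans (by omega)
    have : ((m + 4).divisors.card : ℝ) * m.divisors.card ≤ (W + 4) * (W + 4) :=
      mul_le_mul h2 h3 (Nat.cast_nonneg _) (add_nonneg (Nat.cast_nonneg _) (by norm_num))
    nlinarith
  have hm0 : m ≠ 0 := by omega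
  by_cases hexc : HasLargeSmoothDivisor z Y (m + 4) ∨ HasLargeSmoothDivisor z Y m
  · have h34 : T ≤ t3 + t4 := by
      rcases hexc with h | h
      · have : t3 = T := if_pos h
        linarith
      · have : t4 = T := if_pos ⟨hm0, h⟩
        linarith
    have h5 : F (m + 4) * G m ≤ T + t5 := by
      rcases le_or_gt (F (m + 4) * G m) T with h | h
      · linarith
      · have h6 : F (m + 4) * G m ≤ t5 := by
          rw [ht5, le_div_iff₀ hT]
          set x : ℝ := ((m + 4).divisors.card : ℝ)
          set y : ℝ := (m.divisors.card : ℝ)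
          have h7 : F (m + 4) * G m * T ≤ (F (m + 4) * G m) * (F (m + 4) * G m) :=
            mul_le_mul_of_nonneg_left h.le (mul_nonneg hF0 hG0)
          have h8 : (F (m + 4) * G m) * (F (m + 4) * G m) ≤ (x * y) * (x * y) :=
            mul_le_mul hFG hFG (mul_nonneg hF0 hG0)
              (mul_nonneg (Nat.cast_nonneg _) (Nat.cast_nonneg _))
          nlinarith [sq_nonneg (x ^ 2 - y ^ 2), sq_nonneg (x ^ 2 + y ^ 2)]
        linarith
    linarith
  · rw [not_or] at hexc
    have : F (m + 4) * G m ≤ t2 := by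
      rcases Nat.even_or_odd m with he | ho
      · rw [hG.map_even m he, mul_zero]; exact n2
      have hz : 2 ≤ z := by omega
      obtain ⟨a, haY, haS, ham, hFa, hqa⟩ :=
        hF.exists_smooth_part (N := X + 4) hz (by omega : m + 4 ≠ 0) (by omega) hexc.1 hΔ
      obtain ⟨b, hbY, hbS, hbm, hGb, hqb⟩ :=
        hG.exists_smooth_part (N := X + 4) hz hm0 (by omega) hexc.2 hΔ
      have hab : a.Coprime b := by
        rw [Nat.coprime_iff_gcd_eq_one]
        by_contra hg
        obtain ⟨p, hpp, hpg⟩ := Nat.exists_prime_and_dvd hg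
        have h1 : p ∣ m := (hpg.trans (Nat.gcd_dvd_right _ _)).trans hbm
        have h2 : p ∣ m + 4 := (hpg.trans (Nat.gcd_dvd_left _ _)).trans ham
        have h3 : p ∣ 4 := (Nat.dvd_add_right h1).1 h2
        have h4 : p = 2 := by
          by_contra hne
          exact (not_dvd_two_four hpp hne).2 h3
        rw [h4] at h1
        exact (Nat.not_even_iff_odd.2 ho) (even_iff_two_dvd.2 h1)
      have hsift : IsSifted W a b m := by
        refine ⟨hbm, ham, fun q hq hdvd => ?_⟩
        obtain ⟨hq1, hq2, hq3⟩ := Finset.mem_filter.1 hq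
        have hqp := Nat.prime_of_mem_primesBelow hq1
        have hqW := Nat.lt_of_mem_primesBelow hq1
        rcases hqp.dvd_mul.1 hdvd with h | h
        · rcases hqp.dvd_mul.1 h with h | h
          · exact hq3 ((hqb q hqp (by omega) h).mul_left a)
          · have := (Nat.prime_dvd_prime_iff_eq hqp hp).1 h
            omega
        · exact hq3 ((hqa q hqp (by omega) h).mul_right b)
      have haS' : a ∈ S := Finset.mem_filter.2 ⟨haY, haS⟩
      have hbS' : b ∈ S := Finset.mem_filter.2 ⟨hbY, hbS⟩
      have hΔ0 : 0 ≤ Δ := (Real.exp_pos _).le.trans hΔ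
      calc F (m + 4) * G m ≤ (F a * Δ) * (G b * Δ) :=
            mul_le_mul hFa hGb hG0 (mul_nonneg (hF.nonneg _) hΔ0)
        _ = Δ ^ 2 * (if a.Coprime b ∧ IsSifted W a b m then F a * G b else 0) := by
            rw [if_pos ⟨hab, hsift⟩]; ring
        _ ≤ t2 := by
            refine mul_le_mul_of_nonneg_left ?_ (sq_nonneg _)
            exact (Finset.single_le_sum (f := fun b => if a.Coprime b ∧ IsSifted W a b m then
              F a * G b else 0) (fun b _ => nn a b) hbS').trans
              (Finset.single_le_sum (f := fun a => ∑ b ∈ S, if a.Coprime b ∧ IsSifted W a b m then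
              F a * G b else 0) (fun a _ => Finset.sum_nonneg fun b _ => nn a b) haS')
    linarith

theorem sum_range_add_four_le (g : ℕ → ℝ) (hg : ∀ n, 0 ≤ g n) (X : ℕ) :
    ∑ m ∈ Finset.range X, g (m + 4) ≤ ∑ n ∈ Finset.Icc 1 (X + 4), g n := by
  rw [← Finset.sum_image (s := Finset.range X) (g := fun m => m + 4) (f := g)
    (fun a _ b _ h => by simpa using h)]
  refine Finset.sum_le_sum_of_subset_of_nonneg ?_ fun n _ _ => hg n
  intro n hn
  obtain ⟨m, hm, rfl⟩ := Finset.mem_image.1 hn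
  rw [Finset.mem_range] at hm
  exact Finset.mem_Icc.2 ⟨by omega, by omega⟩

theorem sum_range_le_sum_Icc (g : ℕ → ℝ) (hg : ∀ n, 0 ≤ g n) (h0 : g 0 = 0) (X : ℕ) :
    ∑ m ∈ Finset.range X, g m ≤ ∑ n ∈ Finset.Icc 1 (X + 4), g n := by
  have : ∑ m ∈ Finset.range X, g m = ∑ m ∈ (Finset.range X).erase 0, g m := by
    rw [Finset.sum_erase _ h0]
  rw [this]
  refine Finset.sum_le_sum_of_subset_of_nonneg ?_ fun n _ _ => hg n
  intro n hn
  obtain ⟨h1, h2⟩ := Finset.mem_erase.1 hn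
  rw [Finset.mem_range] at h2
  exact Finset.mem_Icc.2 ⟨by omega, by omega⟩

theorem IsTame.sum_Icc_le {F : ℕ → ℝ} {α : ℝ} (hF : IsTame F α) (Y : ℕ) (S : Finset ℕ)
    (hS : S ⊆ Finset.Icc 1 Y) : ∑ a ∈ S, F a ≤ (Y : ℝ) ^ 2 := by
  calc ∑ a ∈ S, F a ≤ ∑ a ∈ Finset.Icc 1 Y, F a :=
        Finset.sum_le_sum_of_subset_of_nonneg hS fun a _ _ => hF.nonneg a
    _ ≤ ∑ a ∈ Finset.Icc 1 Y, (Y : ℝ) := by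
        refine Finset.sum_le_sum fun a ha => (hF.le_card_divisors a).trans ?_
        exact_mod_cast (Nat.card_divisors_le_self a).trans (Finset.mem_Icc.1 ha).2
    _ = _ := by rw [Finset.sum_const, Nat.card_Icc]; simp [sq]

open scoped Classical in
theorem exists_sum_prime_pairs_le {F G : ℕ → ℝ} {α β : ℝ} (hF : IsTame F α) (hG : IsTame G β)
    {B : ℝ} (hB : 0 < B) :
    ∃ C : ℝ, 0 < C ∧ ∀ (X z W k Y : ℕ) (Δ T : ℝ), 3 ≤ W → W ≤ z → 1 ≤ Y → 0 < T →
      12 * Real.log (Real.log W) ≤ 2 * k → 4 * B ≤ Real.log z →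
      Real.exp (Real.log 2 * (Real.log (X + 4 : ℕ) / Real.log z)) ≤ Δ →
      ∑ m ∈ (Finset.range X).filter (fun m => (m + 2).Prime), F (m + 4) * G m ≤
        W * ((W : ℝ) + 4) ^ 2 +
        Δ ^ 2 * (C * X / Real.log W ^ 3 * (Real.log z ^ α * Real.log z ^ β) +
          Real.exp 3 * (W : ℝ) ^ (2 * k) * (Y : ℝ) ^ 4) +
        2 * T * (C * (X + 4 : ℕ) * Real.log z * Real.exp (-(B * Real.log Y / Real.log z))) +
        2 * ((X + 4 : ℕ) * (1 + Real.log (X + 4 : ℕ)) ^ 16) / T := by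
  obtain ⟨C1, hC1, h1⟩ := exists_card_isSifted_le
  obtain ⟨C2, hC2, h2⟩ := hF.exists_sum_smooth_le
  obtain ⟨C3, hC3, h3⟩ := hG.exists_sum_smooth_le
  obtain ⟨C4, hC4, h4⟩ := exists_card_large_smooth_divisor_le hB
  refine ⟨C1 * C2 * C3 + C4, by positivity, fun X z W k Y Δ T hW hWz hY hT hk hBz hΔ => ?_⟩
  have hz3 : 3 ≤ z := hW.trans hWz
  have hlz := one_le_log_of_three_le hz3
  have hlW := one_le_log_of_three_le hW
  set S := (Finset.Icc 1 Y).filter (· ∈ Nat.smoothNumbers z) with hS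
  have hSY : S ⊆ Finset.Icc 1 Y := Finset.filter_subset _ _
  have hSz : ∀ a ∈ S, a ∈ Nat.smoothNumbers z := fun a ha => (Finset.mem_filter.1 ha).2
  have hterm : ∀ m ∈ (Finset.range X).filter (fun m => (m + 2).Prime), F (m + 4) * G m ≤ _ :=
    fun m hm => prime_pair_term_le (Y := Y) hF hG hW hWz hT hΔ
      (Finset.mem_range.1 (Finset.mem_filter.1 hm).1) (Finset.mem_filter.1 hm).2
  refine (Finset.sum_le_sum hterm).trans ?_
  have nn : ∀ a b m, 0 ≤ (if a.Coprime b ∧ IsSifted W a b m then F a * G b else 0) :=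
    fun a b m => by
      split_ifs
      · exact mul_nonneg (hF.nonneg _) (hG.nonneg _)
      · exact le_rfl
  refine (Finset.sum_le_sum_of_subset_of_nonneg (Finset.filter_subset _ _) fun m _ _ => ?_).trans ?_
  · refine add_nonneg (add_nonneg (add_nonneg ?_ ?_) (add_nonneg ?_ ?_)) ?_
    · split_ifs <;> positivity
    · exact mul_nonneg (sq_nonneg _)
        (Finset.sum_nonneg fun a _ => Finset.sum_nonneg fun b _ => nn a b m)
    · split_ifs <;> linarith
    · split_ifs <;> linarith
    · positivity
  rw [Finset.sum_add_distrib, Finset.sum_add_distrib, Finset.sum_add_distrib]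
  refine add_le_add (add_le_add (add_le_add ?_ ?_) ?_) ?_
  · rw [← Finset.sum_filter, Finset.sum_const, nsmul_eq_mul]
    gcongr
    have : ((Finset.range X).filter fun m => m < W) ⊆ Finset.range W := fun m hm => by
      rw [Finset.mem_range]; exact (Finset.mem_filter.1 hm).2
    calc _ ≤ _ := Finset.card_le_card this
      _ = W := Finset.card_range W
  · rw [← Finset.mul_sum]
    refine mul_le_mul_of_nonneg_left ?_ (sq_nonneg _)
    rw [Finset.sum_comm]
    calc _ = ∑ a ∈ S, ∑ b ∈ S, ∑ m ∈ Finset.range X,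
          (if a.Coprime b ∧ IsSifted W a b m then F a * G b else 0) :=
          Finset.sum_congr rfl fun a _ => Finset.sum_comm
      _ ≤ ∑ a ∈ S, ∑ b ∈ S, (C1 * X / Real.log W ^ 3 * ((F a * cubeRatio a / a) *
            (G b * cubeRatio b / b)) + Real.exp 3 * (W : ℝ) ^ (2 * k) * (F a * G b)) := by
          refine Finset.sum_le_sum fun a ha => Finset.sum_le_sum fun b hb => ?_
          have ha1 := (Finset.mem_Icc.1 (hSY ha)).1
          have hb1 := (Finset.mem_Icc.1 (hSY hb)).1
          have hFG : 0 ≤ F a * G b := mul_nonneg (hF.nonneg _) (hG.nonneg _)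
          have hca := zero_le_one.trans (one_le_cubeRatio a)
          have hcb := zero_le_one.trans (one_le_cubeRatio b)
          by_cases hab : a.Coprime b
          · have h := h1 X k W a b ha1 hb1 hab hW hk
            have e : ∑ m ∈ Finset.range X, (if a.Coprime b ∧ IsSifted W a b m then F a * G b
                else 0) = (((Finset.range X).filter fun m => IsSifted W a b m).card : ℝ) *
                  (F a * G b) := by
              rw [Finset.sum_congr rfl fun m _ => if_congr (and_iff_right hab) rfl rfl,
                ← Finset.sum_filter, Finset.sum_const, nsmul_eq_mul]
            rw [e]
            refine (mul_le_mul_of_nonneg_right h hFG).trans (le_of_eq ?_)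
            ring
          · rw [Finset.sum_eq_zero fun m _ => if_neg fun h => hab h.1]
            have := hF.nonneg a
            have := hG.nonneg b
            positivity
      _ = C1 * X / Real.log W ^ 3 * ((∑ a ∈ S, F a * cubeRatio a / a) *
            (∑ b ∈ S, G b * cubeRatio b / b)) +
            Real.exp 3 * (W : ℝ) ^ (2 * k) * ((∑ a ∈ S, F a) * ∑ b ∈ S, G b) := by
          rw [Finset.sum_mul_sum, Finset.sum_mul_sum, Finset.mul_sum, Finset.mul_sum,
            ← Finset.sum_add_distrib]
          refine Finset.sum_congr rfl fun a _ => ?_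
          rw [Finset.mul_sum, Finset.mul_sum, ← Finset.sum_add_distrib]
      _ ≤ C1 * X / Real.log W ^ 3 * ((C2 * Real.log z ^ α) * (C3 * Real.log z ^ β)) +
            Real.exp 3 * (W : ℝ) ^ (2 * k) * ((Y : ℝ) ^ 2 * (Y : ℝ) ^ 2) := by
          have i1 := h2 z hz3 S hSz
          have i2 := h3 z hz3 S hSz
          have i3 := hF.sum_Icc_le Y S hSY
          have i4 := hG.sum_Icc_le Y S hSY
          have i5 : 0 ≤ ∑ b ∈ S, G b * cubeRatio b / b := Finset.sum_nonneg fun b _ =>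
            div_nonneg (mul_nonneg (hG.nonneg b) (zero_le_one.trans (one_le_cubeRatio b)))
              (Nat.cast_nonneg b)
          have i6 : 0 ≤ ∑ b ∈ S, G b := Finset.sum_nonneg fun b _ => hG.nonneg b
          gcongr
      _ = (C1 * C2 * C3) * X / Real.log W ^ 3 * (Real.log z ^ α * Real.log z ^ β) +
          Real.exp 3 * (W : ℝ) ^ (2 * k) * (Y : ℝ) ^ 4 := by ring
      _ ≤ _ := by
          gcongr
          linarith
  · have hc := h4 z (X + 4) Y hz3 hBz hY
    have hnn : ∀ n, 0 ≤ (if HasLargeSmoothDivisor z Y n then T else 0) := fun n => by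
      split_ifs <;> linarith
    have hnn' : ∀ n, 0 ≤ (if n ≠ 0 ∧ HasLargeSmoothDivisor z Y n then T else 0) := fun n => by
      split_ifs <;> linarith
    have j1 := sum_range_add_four_le (fun n => if HasLargeSmoothDivisor z Y n then T else 0) hnn X
    have j2 := sum_range_le_sum_Icc
      (fun n => if n ≠ 0 ∧ HasLargeSmoothDivisor z Y n then T else 0) hnn' (by simp) X
    have j3 : ∑ n ∈ Finset.Icc 1 (X + 4), (if HasLargeSmoothDivisor z Y n then T else 0) =
        (((Finset.Icc 1 (X + 4)).filter fun n => ∃ a ∈ Nat.smoothNumbers z, Y < a ∧ a ∣ n).card : ℝ)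
          * T := by
      rw [← Finset.sum_filter, Finset.sum_const, nsmul_eq_mul]
      rfl
    have j4 : ∑ n ∈ Finset.Icc 1 (X + 4), (if n ≠ 0 ∧ HasLargeSmoothDivisor z Y n then T else 0) ≤
        ∑ n ∈ Finset.Icc 1 (X + 4), (if HasLargeSmoothDivisor z Y n then T else 0) := by
      refine Finset.sum_le_sum fun n _ => ?_
      split_ifs with u v v
      · exact le_rfl
      · exact absurd u.2 v
      · exact hT.le
      · exact le_rfl
    rw [Finset.sum_add_distrib]
    have j5 : (((Finset.Icc 1 (X + 4)).filter fun n =>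
        ∃ a ∈ Nat.smoothNumbers z, Y < a ∧ a ∣ n).card : ℝ) * T ≤
        (C4 * (X + 4 : ℕ) * Real.log z * Real.exp (-(B * Real.log Y / Real.log z))) * T :=
      mul_le_mul_of_nonneg_right hc hT.le
    have j6 : (C4 * (X + 4 : ℕ) * Real.log z * Real.exp (-(B * Real.log Y / Real.log z))) * T ≤
        ((C1 * C2 * C3 + C4) * (X + 4 : ℕ) * Real.log z *
          Real.exp (-(B * Real.log Y / Real.log z))) * T := by
      have : 0 ≤ C1 * C2 * C3 := by positivity
      gcongr
      linarith
    linarith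
  · rw [← Finset.sum_div, Finset.sum_add_distrib]
    gcongr
    have j1 := sum_range_add_four_le (fun n => (n.divisors.card : ℝ) ^ 4) (fun n => by positivity) X
    have j2 := sum_range_le_sum_Icc (fun n => (n.divisors.card : ℝ) ^ 4)
      (fun n => by positivity) (by simp) X
    have j3 := sum_card_divisors_pow_le 4 (X + 4)
    norm_num at j1 j2 j3 ⊢
    linarith

theorem natCeil_exp_le {t : ℝ} (ht : 0 ≤ t) : (⌈Real.exp t⌉₊ : ℝ) ≤ 2 * Real.exp t := by
  have := (Nat.ceil_lt_add_one (Real.exp_pos t).le).le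
  have := Real.one_le_exp ht
  linarith

theorem le_log_natCeil_exp (t : ℝ) : t ≤ Real.log ⌈Real.exp t⌉₊ :=
  (Real.le_log_iff_exp_le ((Real.exp_pos t).trans_le (Nat.le_ceil _))).2 (Nat.le_ceil _)

theorem log_natCeil_exp_le {t : ℝ} (ht : 0 ≤ t) : Real.log ⌈Real.exp t⌉₊ ≤ t + 1 := by
  refine (Real.log_le_iff_le_exp ((Real.exp_pos t).trans_le (Nat.le_ceil _))).2
    ((natCeil_exp_le ht).trans ?_)
  rw [Real.exp_add, mul_comm]
  refine mul_le_mul_of_nonneg_left ?_ (Real.exp_pos t).le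
  have := Real.add_one_le_exp (1 : ℝ)
  linarith

theorem eventually_rpow_mul_log_le :
    ∀ᶠ L : ℝ in atTop, (L ^ (39 / 40 : ℝ) + 1) * (12 * Real.log L + 3) ≤ L / 10 := by
  have h1 := (isLittleO_log_rpow_atTop (show (0 : ℝ) < 1 / 40 by norm_num)).def
    (show (0 : ℝ) < 1 / 300 by norm_num)
  filter_upwards [h1, eventually_ge_atTop (1 : ℝ),
    Real.tendsto_log_atTop.eventually_ge_atTop 1] with L h hL hl
  have hL0 : 0 < L := by linarith
  have e1 : L ^ (39 / 40 : ℝ) * L ^ (1 / 40 : ℝ) = L := by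
    rw [← Real.rpow_add hL0]; norm_num
  have e2 : 1 ≤ L ^ (39 / 40 : ℝ) := Real.one_le_rpow hL (by norm_num)
  have e3 : 0 ≤ L ^ (1 / 40 : ℝ) := by positivity
  rw [Real.norm_of_nonneg (by linarith), Real.norm_of_nonneg e3] at h
  calc (L ^ (39 / 40 : ℝ) + 1) * (12 * Real.log L + 3)
      ≤ (2 * L ^ (39 / 40 : ℝ)) * (15 * (1 / 300 * L ^ (1 / 40 : ℝ))) := by
        gcongr <;> linarith
    _ = (L ^ (39 / 40 : ℝ) * L ^ (1 / 40 : ℝ)) / 10 := by ring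
    _ = L / 10 := by rw [e1]

theorem tendsto_rpow_mul_exp_neg_of_le {f : ℝ → ℝ} {s c : ℝ} (hc : 0 < c)
    (hf : ∀ᶠ L : ℝ in atTop, f L ≤ -(c * L)) :
    Tendsto (fun L : ℝ => L ^ s * Real.exp (f L)) atTop (nhds 0) := by
  have h := tendsto_rpow_mul_exp_neg_mul_atTop_nhds_zero s c hc
  refine squeeze_zero' ?_ ?_ h
  · filter_upwards [eventually_ge_atTop (0 : ℝ)] with L hL
    positivity
  · filter_upwards [hf, eventually_ge_atTop (0 : ℝ)] with L h hL
    have : f L ≤ -c * L := by linarith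
    gcongr

theorem tendsto_error_terms (C : ℝ) :
    Tendsto (fun L : ℝ => L * (72 * Real.exp (3 * L ^ (39 / 40 : ℝ) - L) + C * L ^ (-(43 / 40) : ℝ) +
      16 * Real.exp 3 * (L ^ (1 / 10 : ℝ) * Real.exp (-(L / 2))) +
      4 * C * L ^ (-4 : ℝ) + 4 * 3 ^ 16 * L ^ (-4 : ℝ))) atTop (nhds 0) := by
  have h1 : Tendsto (fun L : ℝ => L ^ (1 : ℝ) * Real.exp (3 * L ^ (39 / 40 : ℝ) - L)) atTop
      (nhds 0) := by
    refine tendsto_rpow_mul_exp_neg_of_le (c := 1 / 2) (by norm_num) ?_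
    filter_upwards [eventually_rpow_mul_log_le, Real.tendsto_log_atTop.eventually_ge_atTop 1,
      eventually_ge_atTop (0 : ℝ)] with L h hl hL
    have : 0 ≤ L ^ (39 / 40 : ℝ) := by positivity
    nlinarith
  have h2 : Tendsto (fun L : ℝ => L ^ (-(3 / 40) : ℝ)) atTop (nhds 0) :=
    tendsto_rpow_neg_atTop (by norm_num)
  have h3 : Tendsto (fun L : ℝ => L ^ (11 / 10 : ℝ) * Real.exp (-(L / 2))) atTop (nhds 0) :=
    tendsto_rpow_mul_exp_neg_of_le (c := 1 / 2) (by norm_num)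
      (Eventually.of_forall fun L => by linarith)
  have h4 : Tendsto (fun L : ℝ => L ^ (-3 : ℝ)) atTop (nhds 0) :=
    tendsto_rpow_neg_atTop (by norm_num)
  have h := ((((h1.const_mul 72).add (h2.const_mul C)).add (h3.const_mul (16 * Real.exp 3))).add
    (h4.const_mul (4 * C))).add (h4.const_mul (4 * 3 ^ 16))
  simp only [mul_zero, add_zero] at h
  refine h.congr' ?_
  filter_upwards [eventually_gt_atTop (0 : ℝ)] with L hL
  have e1 : L ^ (-(3 / 40) : ℝ) = L * L ^ (-(43 / 40) : ℝ) := by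
    rw [← Real.rpow_one_add' hL.le (by norm_num)]; norm_num
  have e2 : L ^ (11 / 10 : ℝ) = L * L ^ (1 / 10 : ℝ) := by
    rw [← Real.rpow_one_add' hL.le (by norm_num)]; norm_num
  have e3 : L ^ (-3 : ℝ) = L * L ^ (-4 : ℝ) := by
    rw [← Real.rpow_one_add' hL.le (by norm_num)]; norm_num
  rw [e1, e2, e3, Real.rpow_one]
  ring

set_option maxHeartbeats 1000000 in
theorem eventually_sum_prime_pairs_le_mul {F G : ℕ → ℝ} {α β : ℝ} (hF : IsTame F α)
    (hG : IsTame G β) (hαβ : α + β ≤ 7 / 4) :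
    ∃ C : ℝ, ∀ᶠ X : ℕ in atTop,
      ∑ m ∈ (Finset.range X).filter (fun m => (m + 2).Prime), F (m + 4) * G m ≤
        X * (72 * Real.exp (3 * Real.log X ^ (39 / 40 : ℝ) - Real.log X) +
          C * Real.log X ^ (-(43 / 40) : ℝ) +
          16 * Real.exp 3 * (Real.log X ^ (1 / 10 : ℝ) * Real.exp (-(Real.log X / 2))) +
          4 * C * Real.log X ^ (-4 : ℝ) + 4 * 3 ^ 16 * Real.log X ^ (-4 : ℝ)) := by
  classical
  obtain ⟨C, hC, h⟩ := exists_sum_prime_pairs_le hF hG (B := 20000) (by norm_num)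
  refine ⟨C, ?_⟩
  have hlog : Tendsto (fun X : ℕ => Real.log X) atTop atTop :=
    Real.tendsto_log_atTop.comp tendsto_natCast_atTop_atTop
  filter_upwards [hlog.eventually eventually_rpow_mul_log_le,
    hlog.eventually (eventually_ge_atTop (4000 ^ 2 : ℝ)),
    hlog.eventually (Real.tendsto_log_atTop.eventually_ge_atTop 80),
    eventually_ge_atTop 4] with X hr hL hl hX
  set L := Real.log X with hLdef
  have hL0 : 0 < L := by linarith
  have hl0 : 0 < Real.log L := by linarith
  have hX0 : (0 : ℝ) < X := by positivity
  have hXL : Real.exp L = X := Real.exp_log hX0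
  have hL4 : Real.log (X + 4 : ℕ) ≤ 2 * L := by
    have : (X + 4 : ℕ) ≤ X ^ 2 := by nlinarith
    calc Real.log (X + 4 : ℕ) ≤ Real.log ((X ^ 2 : ℕ) : ℝ) := by
          gcongr
      _ = 2 * L := by rw [Nat.cast_pow, Real.log_pow, hLdef, Nat.cast_ofNat]
  have hX4 : ((X + 4 : ℕ) : ℝ) ≤ 2 * X := by exact_mod_cast (by omega : X + 4 ≤ 2 * X)
  set w : ℝ := L ^ (39 / 40 : ℝ) with hw
  have hw1 : 4 ≤ w := by
    have : (4000 ^ 2 : ℝ) ^ (1 / 2 : ℝ) ≤ w := by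
      calc (4000 ^ 2 : ℝ) ^ (1 / 2 : ℝ) ≤ L ^ (1 / 2 : ℝ) := by gcongr
        _ ≤ w := Real.rpow_le_rpow_of_exponent_le (by linarith) (by norm_num)
    rw [← Real.sqrt_eq_rpow, Real.sqrt_sq (by norm_num)] at this
    linarith
  set W := ⌈Real.exp w⌉₊ with hW
  set t := 40 * L / Real.log L with ht
  have ht2 : t ≤ L / 2 := by
    rw [ht, div_le_iff₀ hl0]; nlinarith
  have hwt : w ≤ t := by
    rw [ht, le_div_iff₀ hl0]
    nlinarith
  have htB : 4 * 20000 ≤ t := by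
    rw [ht, le_div_iff₀ hl0]
    have h1 := Real.log_le_rpow_div hL0.le (show (0 : ℝ) < 1 / 2 by norm_num)
    rw [← Real.sqrt_eq_rpow] at h1
    have h2 : 4000 ≤ √L := Real.le_sqrt_of_sq_le hL
    have h3 := Real.sq_sqrt hL0.le
    nlinarith
  set z := ⌈Real.exp t⌉₊ with hz
  have hlz1 : t ≤ Real.log z := le_log_natCeil_exp t
  have hlz2 : Real.log z ≤ t + 1 := log_natCeil_exp_le (by linarith)
  have hlW1 : w ≤ Real.log W := le_log_natCeil_exp w
  have hlW2 : Real.log W ≤ w + 1 := log_natCeil_exp_le (by linarith)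
  have hW3 : 3 ≤ W := by
    have h1 := Real.add_one_le_exp w
    have h2 : Real.exp w ≤ W := Nat.le_ceil _
    exact_mod_cast (by linarith : (3 : ℝ) ≤ W)
  have hWz : W ≤ z := Nat.ceil_mono (Real.exp_le_exp.2 hwt)
  set Y := ⌈Real.exp (L / 10)⌉₊ with hY
  have hlY : L / 10 ≤ Real.log Y := le_log_natCeil_exp _
  have hY1 : 1 ≤ Y := Nat.one_le_ceil_iff.2 (Real.exp_pos _)
  have hY2 : (Y : ℝ) ≤ 2 * Real.exp (L / 10) := natCeil_exp_le (by linarith)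
  set k := ⌈6 * Real.log L⌉₊ with hk
  have hk1 : 6 * Real.log L ≤ k := Nat.le_ceil _
  have hk2 : (k : ℝ) ≤ 6 * Real.log L + 1 := (Nat.ceil_lt_add_one (by linarith)).le
  have hwL : w + 1 ≤ L := by nlinarith
  have hzL : Real.log z ≤ L := by linarith
  have hkW : 12 * Real.log (Real.log W) ≤ 2 * k := by
    have : Real.log (Real.log W) ≤ Real.log L :=
      Real.log_le_log (by linarith) (by linarith)
    linarith
  have hΔ : Real.exp (Real.log 2 * (Real.log (X + 4 : ℕ) / Real.log z)) ≤ L ^ (1 / 20 : ℝ) := by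
    rw [Real.rpow_def_of_pos hL0]
    refine Real.exp_le_exp.2 ?_
    have h2 : Real.log 2 ≤ 1 := by have := Real.log_two_lt_d9; linarith
    have h20 : 0 ≤ Real.log 2 := Real.log_nonneg (by norm_num)
    have h3 : Real.log (X + 4 : ℕ) / Real.log z ≤ Real.log L / 20 := by
      calc Real.log (X + 4 : ℕ) / Real.log z ≤ 2 * L / t := by
            have : 0 < t := by linarith
            gcongr
        _ = Real.log L / 20 := by
            rw [ht]; field_simp; norm_num
    calc _ ≤ 1 * (Real.log L / 20) :=
          mul_le_mul h2 h3 (div_nonneg (Real.log_natCast_nonneg _) (Real.log_natCast_nonneg _))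
            zero_le_one
      _ = _ := by ring
  have hT : 0 < L ^ (20 : ℝ) := by positivity
  refine (h X z W k Y _ _ hW3 hWz hY1 hT hkW (htB.trans hlz1) hΔ).trans ?_
  have i1 : (W : ℝ) * ((W : ℝ) + 4) ^ 2 ≤ X * (72 * Real.exp (3 * w - L)) := by
    have h1 : (W : ℝ) ≤ 2 * Real.exp w := natCeil_exp_le (by linarith)
    have h2 : (W : ℝ) + 4 ≤ 6 * Real.exp w := by
      have := Real.one_le_exp (show 0 ≤ w by linarith)
      linarith
    calc (W : ℝ) * ((W : ℝ) + 4) ^ 2 ≤ (2 * Real.exp w) * (6 * Real.exp w) ^ 2 := by gcongr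
      _ = 72 * (Real.exp w) ^ 3 := by ring
      _ = X * (72 * Real.exp (3 * w - L)) := by
          rw [Real.exp_sub, hXL, ← Real.exp_nat_mul]
          push_cast
          field_simp
  have i2 : (L ^ (1 / 20 : ℝ)) ^ 2 * (C * X / Real.log W ^ 3 * (Real.log z ^ α * Real.log z ^ β)) ≤
      X * (C * L ^ (-(43 / 40) : ℝ)) := by
    have hz0 : 0 < Real.log z := by linarith
    have h1 : Real.log z ^ α * Real.log z ^ β ≤ L ^ (7 / 4 : ℝ) := by
      rw [← Real.rpow_add hz0]
      calc Real.log z ^ (α + β) ≤ Real.log z ^ (7 / 4 : ℝ) :=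
            Real.rpow_le_rpow_of_exponent_le (by linarith) hαβ
        _ ≤ L ^ (7 / 4 : ℝ) := Real.rpow_le_rpow hz0.le hzL (by norm_num)
    have h2 : L ^ (117 / 40 : ℝ) ≤ Real.log W ^ 3 := by
      have : L ^ (117 / 40 : ℝ) = w ^ 3 := by
        rw [hw, ← Real.rpow_mul_natCast hL0.le]; norm_num
      rw [this]
      gcongr
    have h3 : (L ^ (1 / 20 : ℝ)) ^ 2 = L ^ (1 / 10 : ℝ) := by
      rw [← Real.rpow_mul_natCast hL0.le]; norm_num
    rw [h3]
    have h0 : 0 ≤ Real.log z ^ α * Real.log z ^ β := by positivity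
    calc L ^ (1 / 10 : ℝ) * (C * X / Real.log W ^ 3 * (Real.log z ^ α * Real.log z ^ β))
        ≤ L ^ (1 / 10 : ℝ) * (C * X / L ^ (117 / 40 : ℝ) * L ^ (7 / 4 : ℝ)) := by gcongr
      _ = X * (C * (L ^ (1 / 10 : ℝ) * L ^ (7 / 4 : ℝ) / L ^ (117 / 40 : ℝ))) := by ring
      _ = _ := by
          rw [← Real.rpow_add hL0, ← Real.rpow_sub hL0]; norm_num
  have i3 : (L ^ (1 / 20 : ℝ)) ^ 2 * (Real.exp 3 * (W : ℝ) ^ (2 * k) * (Y : ℝ) ^ 4) ≤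
      X * (16 * Real.exp 3 * (L ^ (1 / 10 : ℝ) * Real.exp (-(L / 2)))) := by
    have h3 : (L ^ (1 / 20 : ℝ)) ^ 2 = L ^ (1 / 10 : ℝ) := by
      rw [← Real.rpow_mul_natCast hL0.le]; norm_num
    have hW0 : (0 : ℝ) < W := by positivity
    have h1 : (W : ℝ) ^ (2 * k) ≤ Real.exp (L / 10) := by
      rw [← Real.rpow_natCast, Real.rpow_def_of_pos hW0]
      refine Real.exp_le_exp.2 (le_trans ?_ hr)
      push_cast
      refine mul_le_mul hlW2 ?_ (by positivity) (by linarith)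
      linarith
    have h2 : (Y : ℝ) ^ 4 ≤ 16 * Real.exp (4 * L / 10) := by
      calc (Y : ℝ) ^ 4 ≤ (2 * Real.exp (L / 10)) ^ 4 := by gcongr
        _ = 16 * Real.exp (4 * L / 10) := by
          rw [mul_pow, ← Real.exp_nat_mul]; push_cast; ring_nf
    rw [h3]
    calc L ^ (1 / 10 : ℝ) * (Real.exp 3 * (W : ℝ) ^ (2 * k) * (Y : ℝ) ^ 4)
        ≤ L ^ (1 / 10 : ℝ) * (Real.exp 3 * Real.exp (L / 10) * (16 * Real.exp (4 * L / 10))) := by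
          gcongr
      _ = 16 * Real.exp 3 * (L ^ (1 / 10 : ℝ) * (Real.exp (L / 10) * Real.exp (4 * L / 10))) := by
          ring
      _ = 16 * Real.exp 3 * (L ^ (1 / 10 : ℝ) * (Real.exp L * Real.exp (-(L / 2)))) := by
          rw [← Real.exp_add, ← Real.exp_add]; ring_nf
      _ = _ := by rw [hXL]; ring
  have i4 : 2 * L ^ (20 : ℝ) * (C * (X + 4 : ℕ) * Real.log z *
      Real.exp (-(20000 * Real.log Y / Real.log z))) ≤ X * (4 * C * L ^ (-4 : ℝ)) := by
    have h1 : Real.exp (-(20000 * Real.log Y / Real.log z)) ≤ L ^ (-25 : ℝ) := by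
      rw [Real.rpow_def_of_pos hL0]
      refine Real.exp_le_exp.2 ?_
      have : 25 * Real.log L ≤ 20000 * Real.log Y / Real.log z := by
        rw [le_div_iff₀ (by linarith)]
        have h2 : Real.log z ≤ 2 * t := by linarith
        have h3 : t * Real.log L = 40 * L := by rw [ht]; field_simp
        nlinarith
      linarith
    have hz0 : 0 ≤ Real.log z := by linarith
    calc _ ≤ 2 * L ^ (20 : ℝ) * (C * (2 * X) * L * L ^ (-25 : ℝ)) := by gcongr
      _ = X * (4 * C * (L ^ (20 : ℝ) * (L ^ (1 : ℝ) * L ^ (-25 : ℝ)))) := by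
          rw [Real.rpow_one]; ring
      _ = _ := by
          rw [← Real.rpow_add hL0, ← Real.rpow_add hL0,
            show (20 : ℝ) + (1 + -25) = -4 by norm_num]
  have i5 : 2 * ((X + 4 : ℕ) * (1 + Real.log (X + 4 : ℕ)) ^ 16) / L ^ (20 : ℝ) ≤
      X * (4 * 3 ^ 16 * L ^ (-4 : ℝ)) := by
    have h1 : 1 + Real.log (X + 4 : ℕ) ≤ 3 * L := by linarith
    have h0 : 0 ≤ Real.log (X + 4 : ℕ) := Real.log_natCast_nonneg _
    calc _ ≤ 2 * ((2 * X) * (3 * L) ^ 16) / L ^ (20 : ℝ) := by gcongr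
      _ = X * (4 * 3 ^ 16 * (L ^ (16 : ℝ) / L ^ (20 : ℝ))) := by
          have : L ^ (16 : ℝ) = L ^ 16 := by exact_mod_cast Real.rpow_natCast L 16
          rw [this, mul_pow]; ring
      _ = _ := by rw [← Real.rpow_sub hL0]; norm_num
  rw [mul_add ((L ^ (1 / 20 : ℝ)) ^ 2)]
  linarith

theorem IsTame.eventually_sum_prime_pairs_le {F G : ℕ → ℝ} {α β : ℝ} (hF : IsTame F α)
    (hG : IsTame G β) (hαβ : α + β ≤ 7 / 4) {δ : ℝ} (hδ : 0 < δ) :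
    ∀ᶠ X : ℕ in atTop,
      ∑ m ∈ (Finset.range X).filter (fun m => (m + 2).Prime), F (m + 4) * G m ≤
        δ * X / Real.log X := by
  obtain ⟨C, h⟩ := eventually_sum_prime_pairs_le_mul hF hG hαβ
  have hlog : Tendsto (fun X : ℕ => Real.log X) atTop atTop :=
    Real.tendsto_log_atTop.comp tendsto_natCast_atTop_atTop
  filter_upwards [h, hlog.eventually ((tendsto_error_terms C).eventually_le_const hδ),
    hlog.eventually_gt_atTop 0] with X h1 h2 h3
  refine h1.trans ?_
  rw [le_div_iff₀ h3, mul_assoc, mul_comm δ]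
  refine mul_le_mul_of_nonneg_left ?_ (Nat.cast_nonneg X)
  rw [mul_comm]
  exact h2

theorem norm_z1 (γ : SL2Z) : (z1 γ).norm = nuH γ + 2 := by
  have h : γ.1 0 0 * γ.1 1 1 - γ.1 0 1 * γ.1 1 0 = 1 := by
    rw [← Matrix.det_fin_two]; exact γ.2
  rw [norm_eq_re_sq_add_im_sq]
  simp only [z1, nuH]
  linear_combination 2 * h

theorem norm_z2 (γ : SL2Z) : (z2 γ).norm = nuH γ - 2 := by
  have h : γ.1 0 0 * γ.1 1 1 - γ.1 0 1 * γ.1 1 0 = 1 := by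
    rw [← Matrix.det_fin_two]; exact γ.2
  rw [norm_eq_re_sq_add_im_sq]
  simp only [z2, nuH]
  linear_combination -2 * h

theorem z1_z2_injective : Function.Injective fun γ : SL2Z => (z1 γ, z2 γ) := by
  intro γ δ h
  simp only [Prod.mk.injEq, z1, z2, Zsqrtd.mk.injEq] at h
  obtain ⟨⟨h1, h2⟩, h3, h4⟩ := h
  ext i j
  fin_cases i <;> fin_cases j <;> simp only [Fin.zero_eta, Fin.mk_one] <;> lia

theorem two_le_nuH (γ : SL2Z) : 2 ≤ nuH γ := by
  have := GaussianInt.norm_nonneg (z2 γ)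
  rw [norm_z2] at this
  linarith

theorem finite_setOf_nuH_eq (n : ℕ) : {γ : SL2Z | nuH γ = n}.Finite := by
  refine Set.Finite.of_injOn (f := fun γ => (z1 γ, z2 γ))
    (t := ((normFiber (n + 2) ×ˢ normFiber (n - 2) : Finset (GaussianInt × GaussianInt)) :
      Set (GaussianInt × GaussianInt))) ?_ z1_z2_injective.injOn (Finset.finite_toSet _)
  intro γ hγ
  have hγ : nuH γ = n := hγ
  have := two_le_nuH γ
  simp only [Finset.coe_product, Set.mem_prod, Finset.mem_coe, mem_normFiber, norm_z1, norm_z2]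
  omega

/-- The elements of `SL₂(ℤ)` with `ν(γ) = n`. -/
def cartanFiber (n : ℕ) : Finset SL2Z := (finite_setOf_nuH_eq n).toFinset

theorem mem_cartanFiber {n : ℕ} {γ : SL2Z} : γ ∈ cartanFiber n ↔ nuH γ = n := by
  simp [cartanFiber]

theorem sum_cartanFiber (φ ψ : GaussianInt → ℂ) (m : ℕ) :
    ∑ γ ∈ cartanFiber (m + 2), φ (z1 γ) * ψ (z2 γ) =
      ∑ p ∈ (normFiber (m + 4) ×ˢ normFiber m).filter (fun p => Even (p.1.re - p.2.re)),
        φ p.1 * ψ p.2 := by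
  refine Finset.sum_nbij (fun γ => (z1 γ, z2 γ)) ?_ z1_z2_injective.injOn ?_ fun _ _ => rfl
  · intro γ hγ
    rw [mem_cartanFiber] at hγ
    push_cast at hγ
    simp only [Finset.mem_filter, Finset.mem_product, mem_normFiber, norm_z1, norm_z2]
    refine ⟨⟨by push_cast; omega, by omega⟩, γ.1 1 1, ?_⟩
    simp only [z1, z2]
    ring
  · rintro ⟨z, w⟩ h
    simp only [Finset.coe_filter, Finset.mem_product, mem_normFiber, Set.mem_ofPred_eq] at h
    obtain ⟨⟨hz, hw⟩, d, hd⟩ := h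
    rw [norm_eq_re_sq_add_im_sq] at hz hw
    push_cast at hz
    have hev : Even (z.im - w.im) := by
      have h1 : Even ((z.re + z.im) ^ 2 - (w.re + w.im) ^ 2) :=
        ⟨2 + z.re * z.im - w.re * w.im, by linear_combination hz - hw⟩
      have h2 : Even (z.re - w.re) := ⟨d, hd⟩
      simp only [parity_simps] at h1 h2 ⊢
      simp only [ne_eq, OfNat.ofNat_ne_zero, not_false_eq_true, and_true] at h1
      tauto
    obtain ⟨b, hb⟩ := hev
    obtain ⟨γ, hγ⟩ : ∃ γ : SL2Z, γ.1 = !![d + w.re, b; -(b + w.im), d] := by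
      refine ⟨⟨_, ?_⟩, rfl⟩
      rw [Matrix.det_fin_two_of]
      have e1 : z.re = w.re + (d + d) := by linarith
      have e2 : z.im = w.im + (b + b) := by linarith
      rw [e1, e2] at hz
      nlinarith
    have e1 : z1 γ = z := by
      ext <;> simp [z1, hγ] <;> linarith
    have e2 : z2 γ = w := by
      ext <;> simp [z2, hγ]
    refine ⟨γ, ?_, ?_⟩
    · rw [Finset.mem_coe, mem_cartanFiber]
      have := norm_z2 γ
      rw [e2, norm_eq_re_sq_add_im_sq, hw] at this
      push_cast
      linarith
    · simp only [e1, e2]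

theorem ite_even_eq_parityChar {z w : GaussianInt} (hz : Odd z.norm) (hw : Odd w.norm) :
    (if Even (z.re - w.re) then 1 else 0 : ℂ) =
      (parityChar 1 z * parityChar 1 w + parityChar (-1) z * parityChar (-1) w) / 2 := by
  have hodd : ∀ z : GaussianInt, Odd z.norm → ¬ Even (z.re + z.im) := fun z h => by
    rw [norm_eq_re_sq_add_im_sq, ← Int.not_even_iff_odd] at h
    simpa [parity_simps] using h
  have h1 := hodd z hz
  have h2 := hodd w hw
  unfold parityChar
  by_cases a : Even z.re <;> by_cases b : Even w.re <;> simp [Int.even_sub, h1, h2, a, b]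

theorem sum_cartanFiber_angChar (k l : ℤ) {m : ℕ} (hm : Odd m) :
    ∑ γ ∈ cartanFiber (m + 2), angChar k (z1 γ) * angChar l (z2 γ) =
      (normSum (twistChar 1 k) (m + 4) * normSum (twistChar 1 l) m +
        normSum (twistChar (-1) k) (m + 4) * normSum (twistChar (-1) l) m) / 2 := by
  rw [sum_cartanFiber, Finset.sum_filter]
  simp only [normSum]
  rw [Finset.sum_mul_sum, Finset.sum_mul_sum, ← Finset.sum_add_distrib, Finset.sum_product,
    Finset.sum_div]
  refine Finset.sum_congr rfl fun z hz => ?_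
  rw [← Finset.sum_add_distrib, Finset.sum_div]
  refine Finset.sum_congr rfl fun w hw => ?_
  rw [mem_normFiber] at hz hw
  have h := ite_even_eq_parityChar (z := z) (w := w)
    (by rw [hz]; exact_mod_cast hm.add_even (by decide)) (by rw [hw]; exact_mod_cast hm)
  simp only [twistChar]
  calc _ = (if Even (z.re - w.re) then 1 else 0 : ℂ) * (angChar k z * angChar l w) := by
        rw [ite_mul, one_mul, zero_mul]
    _ = _ := by rw [h]; ring

theorem norm_sum_cartanFiber_angChar_le (k l : ℤ) {m : ℕ} (hm : Odd m) :
    ‖∑ γ ∈ cartanFiber (m + 2), angChar k (z1 γ) * angChar l (z2 γ)‖ ≤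
      8 * (twistSum 1 k (m + 4) * twistSum 1 l m +
        twistSum (-1) k (m + 4) * twistSum (-1) l m) := by
  rw [sum_cartanFiber_angChar k l hm, norm_div, Complex.norm_ofNat]
  refine (div_le_div_of_nonneg_right (norm_add_le _ _) zero_le_two).trans (le_of_eq ?_)
  rw [norm_mul, norm_mul]
  simp only [twistSum]
  ring

theorem eventually_sum_twistSum_le {ε : ℝ} (hε : ε ^ 2 = 1) {k l : ℤ} (h : k ≠ 0 ∨ l ≠ 0) {δ : ℝ}
    (hδ : 0 < δ) :
    ∀ᶠ X : ℕ in atTop,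
      ∑ m ∈ (Finset.range X).filter (fun m => (m + 2).Prime),
        twistSum ε k (m + 4) * twistSum ε l m ≤ δ * X / Real.log X := by
  have hzero : ∀ X : ℕ, 0 ≤ δ * X / Real.log X := fun X =>
    div_nonneg (by positivity) (Real.log_natCast_nonneg X)
  rcases h with hk | hl
  · rcases twistSum_eq_zero_or_isTame hε hk with h | h
    · refine Eventually.of_forall fun X => le_trans (le_of_eq ?_) (hzero X)
      exact Finset.sum_eq_zero fun m _ => by rw [h _ (by omega), zero_mul]
    · filter_upwards [h.eventually_sum_prime_pairs_le isTame_twistSum_one_zero (by norm_num) hδ]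
        with X hX
      refine le_trans (Finset.sum_le_sum fun m _ => ?_) hX
      exact mul_le_mul_of_nonneg_left (twistSum_le hε l m) (twistSum_nonneg _ _ _)
  · rcases twistSum_eq_zero_or_isTame hε hl with h | h
    · refine Eventually.of_forall fun X => le_trans (le_of_eq ?_) (hzero X)
      refine Finset.sum_eq_zero fun m hm => ?_
      rcases eq_or_ne m 0 with rfl | h0
      · rw [twistSum, twistSum, normSum_twistChar_even _ l Even.zero, norm_zero, zero_div, mul_zero]
      · rw [h _ h0, mul_zero]
    · filter_upwards [isTame_twistSum_one_zero.eventually_sum_prime_pairs_le h (by norm_num) hδ]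
        with X hX
      refine le_trans (Finset.sum_le_sum fun m _ => ?_) hX
      exact mul_le_mul_of_nonneg_right (twistSum_le hε k _) (twistSum_nonneg _ _ _)

theorem sum_cartanFiber_two_or_odd {m : ℕ} (h : (m + 2).Prime) : m = 0 ∨ Odd m := by
  rcases h.eq_two_or_odd' with h | h
  · exact Or.inl (by omega)
  · exact Or.inr (by simpa [parity_simps] using h)

/-- The elements of `SL₂(ℤ)` with `ν(γ)` a prime at most `N + 1`. -/
def cartanSet (N : ℕ) : Finset SL2Z :=
  ((Finset.range N).filter fun m => (m + 2).Prime).biUnion fun m => cartanFiber (m + 2)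

theorem mem_cartanSet_floor {x : ℝ} {γ : SL2Z} :
    γ ∈ cartanSet (⌊x⌋₊ - 1) ↔ ∃ p : ℕ, p.Prime ∧ (p : ℝ) ≤ x ∧ nuH γ = (p : ℤ) := by
  simp only [cartanSet, Finset.mem_biUnion, Finset.mem_filter, Finset.mem_range, mem_cartanFiber]
  constructor
  · rintro ⟨m, ⟨hm, hp⟩, h⟩
    exact ⟨m + 2, hp, (Nat.le_floor_iff' (by omega)).1 (by omega), h⟩
  · rintro ⟨p, hp, hx, h⟩
    have h1 := (Nat.le_floor_iff' hp.ne_zero).2 hx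
    have h2 := hp.two_le
    refine ⟨p - 2, ⟨by omega, ?_⟩, ?_⟩ <;> rw [Nat.sub_add_cancel h2] <;> assumption

theorem piE_eq_card (x : ℝ) : piE x = (cartanSet (⌊x⌋₊ - 1)).card :=
  Nat.subtype_card _ fun _ => mem_cartanSet_floor

theorem finsum_eq_sum_cartanSet (g : SL2Z → ℂ) (x : ℝ) :
    ∑ᶠ γ : {γ : SL2Z // ∃ p : ℕ, p.Prime ∧ (p : ℝ) ≤ x ∧ nuH γ = (p : ℤ)}, g γ.1 =
      ∑ γ ∈ cartanSet (⌊x⌋₊ - 1), g γ := by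
  rw [← finsum_mem_coe_finset, ← finsum_set_coe_eq_finsum_mem]
  have e : {γ : SL2Z | ∃ p : ℕ, p.Prime ∧ (p : ℝ) ≤ x ∧ nuH γ = (p : ℤ)} =
      (cartanSet (⌊x⌋₊ - 1) : Set SL2Z) := by
    ext γ
    exact mem_cartanSet_floor.symm
  rw [← e]
  rfl

theorem sum_cartanSet (g : SL2Z → ℂ) (N : ℕ) :
    ∑ γ ∈ cartanSet N, g γ =
      ∑ m ∈ (Finset.range N).filter (fun m => (m + 2).Prime), ∑ γ ∈ cartanFiber (m + 2), g γ := by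
  refine Finset.sum_biUnion fun a _ b _ hab => ?_
  refine Finset.disjoint_left.2 fun γ ha hb => hab ?_
  rw [mem_cartanFiber] at ha hb
  rw [ha] at hb
  exact_mod_cast (by simpa using hb)

theorem fourier_arg_div (k : ℤ) {w : ℂ} (hw : w ≠ 0) :
    fourier k ((Complex.arg w / (2 * Real.pi) : ℝ) : UnitAddCircle) = (w / ‖w‖) ^ k := by
  have h1 : w / ‖w‖ = Complex.exp (Complex.arg w * Complex.I) := by
    rw [div_eq_iff (by exact_mod_cast (norm_ne_zero_iff.2 hw)), mul_comm,
      Complex.norm_mul_exp_arg_mul_I]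
  rw [h1, fourier_coe_apply, ← Complex.exp_int_mul]
  congr 1
  push_cast
  have : (Real.pi : ℂ) ≠ 0 := by exact_mod_cast Real.pi_ne_zero
  field_simp

theorem fourier_theta (k l : ℤ) {γ : SL2Z} (h1 : z1 γ ≠ 0) (h2 : z2 γ ≠ 0) :
    fourier k (theta γ).1 * fourier l (theta γ).2 =
      angChar (k + l) (z1 γ) * angChar (k - l) (z2 γ) := by
  have c1 := toComplex_ne_zero h1
  have c2 := toComplex_ne_zero h2
  have c3 : (starRingEnd ℂ) (z2 γ : ℂ) ≠ 0 := by simpa using h2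
  have n1 : ((‖(z1 γ : ℂ)‖ : ℝ) : ℂ) ≠ 0 := by exact_mod_cast norm_ne_zero_iff.2 c1
  have n2 : ((‖(z2 γ : ℂ)‖ : ℝ) : ℂ) ≠ 0 := by exact_mod_cast norm_ne_zero_iff.2 c2
  have hc : (starRingEnd ℂ) (z2 γ : ℂ) / ‖(z2 γ : ℂ)‖ = ((z2 γ : ℂ) / ‖(z2 γ : ℂ)‖)⁻¹ := by
    rw [inv_div, div_eq_div_iff n2 c2, mul_comm, Complex.mul_conj, Complex.normSq_eq_norm_sq]
    push_cast
    ring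
  rw [theta, fourier_arg_div k (mul_ne_zero c1 c2), fourier_arg_div l (mul_ne_zero c1 c3),
    angChar_apply h1, angChar_apply h2, norm_mul, norm_mul, RCLike.norm_conj, Complex.ofReal_mul,
    mul_div_mul_comm, mul_div_mul_comm, hc, mul_zpow, mul_zpow, _root_.inv_zpow',
    zpow_add₀ (div_ne_zero c1 n1), sub_eq_add_neg, zpow_add₀ (div_ne_zero c2 n2)]
  ring

theorem sum_cartanFiber_fourier_theta (k l : ℤ) {m : ℕ} (hm : Odd m) :
    ∑ γ ∈ cartanFiber (m + 2), fourier k (theta γ).1 * fourier l (theta γ).2 =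
      ∑ γ ∈ cartanFiber (m + 2), angChar (k + l) (z1 γ) * angChar (k - l) (z2 γ) := by
  refine Finset.sum_congr rfl fun γ hγ => fourier_theta k l ?_ ?_ <;> intro h
  · have := norm_z1 γ
    rw [h, mem_cartanFiber.1 hγ, Zsqrtd.norm_zero] at this
    omega
  · have := norm_z2 γ
    rw [h, mem_cartanFiber.1 hγ, Zsqrtd.norm_zero] at this
    have := hm.pos
    omega

theorem eventually_norm_sum_cartanSet_le {k l : ℤ} (h : k ≠ 0 ∨ l ≠ 0) {δ : ℝ} (hδ : 0 < δ) :
    ∀ᶠ N : ℕ in atTop,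
      ‖∑ γ ∈ cartanSet N, fourier k (theta γ).1 * fourier l (theta γ).2‖ ≤
        δ * N / Real.log N := by
  have h' : k + l ≠ 0 ∨ k - l ≠ 0 := by omega
  set K := ‖∑ γ ∈ cartanFiber 2, fourier k (theta γ).1 * fourier l (theta γ).2‖ with hK
  have hK0 : 0 ≤ K := _root_.norm_nonneg _
  have hlog := Real.isLittleO_log_id_atTop.def (show 0 < δ / (2 * (K + 1)) by positivity)
  have hlog' := tendsto_natCast_atTop_atTop (R := ℝ) |>.eventually hlog
  have hpos : ∀ᶠ N : ℕ in atTop, 0 < Real.log N :=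
    (Real.tendsto_log_atTop.comp (tendsto_natCast_atTop_atTop (R := ℝ))).eventually_gt_atTop 0
  filter_upwards [eventually_sum_twistSum_le (ε := 1) (by norm_num) h'
      (show 0 < δ / 32 by positivity),
    eventually_sum_twistSum_le (ε := -1) (by norm_num) h' (show 0 < δ / 32 by positivity),
    hlog', hpos] with N h1 h2 h3 h4
  have hterm : ∀ m ∈ (Finset.range N).filter (fun m => (m + 2).Prime),
      ‖∑ γ ∈ cartanFiber (m + 2), fourier k (theta γ).1 * fourier l (theta γ).2‖ ≤
        (if m = 0 then K else 0) + 8 * (twistSum 1 (k + l) (m + 4) * twistSum 1 (k - l) m +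
          twistSum (-1) (k + l) (m + 4) * twistSum (-1) (k - l) m) := by
    intro m hm
    have hnn : ∀ ε : ℝ, 0 ≤ twistSum ε (k + l) (m + 4) * twistSum ε (k - l) m := fun ε =>
      mul_nonneg (twistSum_nonneg _ _ _) (twistSum_nonneg _ _ _)
    rcases sum_cartanFiber_two_or_odd (Finset.mem_filter.1 hm).2 with rfl | hodd
    · have := hnn 1
      have := hnn (-1)
      rw [if_pos rfl]
      linarith
    · rw [if_neg hodd.pos.ne', zero_add, sum_cartanFiber_fourier_theta k l hodd]
      exact norm_sum_cartanFiber_angChar_le _ _ hodd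
  have hite : ∑ m ∈ (Finset.range N).filter (fun m => (m + 2).Prime), (if m = 0 then K else 0) ≤
      K := by
    rw [Finset.sum_ite_eq']
    split_ifs
    · exact le_rfl
    · exact hK0
  rw [sum_cartanSet]
  refine (norm_sum_le _ _).trans ((Finset.sum_le_sum hterm).trans ?_)
  rw [Finset.sum_add_distrib, ← Finset.mul_sum, Finset.sum_add_distrib]
  have hKN : K ≤ δ / 2 * N / Real.log N := by
    rw [le_div_iff₀ h4]
    rw [Real.norm_of_nonneg h4.le, id, Real.norm_of_nonneg (Nat.cast_nonneg N)] at h3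
    calc K * Real.log N ≤ (K + 1) * (δ / (2 * (K + 1)) * N) := by gcongr; linarith
      _ = δ / 2 * N := by field_simp
  have e1 : δ / 32 * N / Real.log N = δ * N / Real.log N / 32 := by ring
  have e2 : δ / 2 * N / Real.log N = δ * N / Real.log N / 2 := by ring
  rw [e1] at h1 h2
  rw [e2] at hKN
  linarith

theorem tendsto_average_fourier {c x₀ : ℝ} (hc : 0 < c)
    (h : ∀ x : ℝ, x₀ ≤ x → c * x / Real.log x ≤ (piE x : ℝ)) {k l : ℤ} (hkl : k ≠ 0 ∨ l ≠ 0) :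
    Tendsto (fun x : ℝ => (piE x : ℂ)⁻¹ * ∑ γ ∈ cartanSet (⌊x⌋₊ - 1),
      fourier k (theta γ).1 * fourier l (theta γ).2) atTop (nhds 0) := by
  rw [NormedAddGroup.tendsto_nhds_zero]
  intro ε hε
  have hfl : Tendsto (fun x : ℝ => ⌊x⌋₊ - 1) atTop atTop :=
    (tendsto_sub_atTop_nat 1).comp tendsto_nat_floor_atTop
  filter_upwards [hfl.eventually (eventually_norm_sum_cartanSet_le hkl
    (show 0 < c * ε / 4 by positivity)), eventually_ge_atTop x₀, eventually_ge_atTop 16]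
    with x h1 h2 h3
  have hx0 : 0 < x := by linarith
  set N := ⌊x⌋₊ - 1 with hN
  have hNx : (N : ℝ) ≤ x :=
    (Nat.cast_le.2 (Nat.sub_le _ _)).trans (Nat.floor_le hx0.le)
  have hNx' : √x ≤ N := by
    have e1 : x < ⌊x⌋₊ + 1 := Nat.lt_floor_add_one x
    have e2 : ⌊x⌋₊ ≤ N + 1 := by omega
    have e3 : (⌊x⌋₊ : ℝ) ≤ N + 1 := by exact_mod_cast e2
    have e4 : 4 ≤ √x := Real.le_sqrt_of_sq_le (by linarith)
    have e5 := Real.sq_sqrt hx0.le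
    nlinarith
  have hlx : 0 < Real.log x := Real.log_pos (by linarith)
  have hlN : Real.log x / 2 ≤ Real.log N := by
    rw [← Real.log_sqrt hx0.le]
    exact Real.log_le_log (Real.sqrt_pos.2 hx0) hNx'
  have hp := h x h2
  have hp0 : 0 < c * x / Real.log x := by positivity
  rw [norm_mul, norm_inv, Complex.norm_natCast]
  have h4 : c * ε / 4 * N / Real.log N ≤ c * ε / 4 * x / (Real.log x / 2) := by gcongr
  calc (piE x : ℝ)⁻¹ * _ ≤ (c * x / Real.log x)⁻¹ * (c * ε / 4 * x / (Real.log x / 2)) := by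
        gcongr
        exact h1.trans h4
    _ = ε / 2 := by field_simp; norm_num
    _ < ε := by linarith

theorem integral_fourier_mul_fourier {k l : ℤ} (h : k ≠ 0 ∨ l ≠ 0) :
    ∫ t : UnitAddCircle × UnitAddCircle, (fourier k t.1 * fourier l t.2 : ℂ) = 0 := by
  have h0 : ∀ n : ℤ, n ≠ 0 → ∫ t : UnitAddCircle, (fourier n t : ℂ) = 0 := fun n hn =>
    integral_eq_zero_of_add_right_eq_neg (fourier_add_half_inv_index hn one_pos)
  have e := integral_prod_mul (μ := (volume : Measure UnitAddCircle))
    (ν := (volume : Measure UnitAddCircle)) (fun t => (fourier k t : ℂ)) fun t => fourier l t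
  rw [Measure.volume_eq_prod, e]
  rcases h with h | h <;> rw [h0 _ h] <;> simp

theorem tendsto_of_tendsto_mFourier {ι d : Type*} [Fintype d] {p : Filter ι}
    {A : ι → C(UnitAddTorus d, ℂ) →ₗ[ℂ] ℂ} {I : C(UnitAddTorus d, ℂ) →ₗ[ℂ] ℂ}
    (hA : ∀ i φ, ‖A i φ‖ ≤ ‖φ‖) (hI : ∀ φ, ‖I φ‖ ≤ ‖φ‖)
    (h : ∀ n : d → ℤ, Tendsto (fun i => A i (UnitAddTorus.mFourier n)) p
      (nhds (I (UnitAddTorus.mFourier n)))) (φ : C(UnitAddTorus d, ℂ)) :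
    Tendsto (fun i => A i φ) p (nhds (I φ)) := by
  have hspan : ∀ ψ ∈ Submodule.span ℂ (Set.range (UnitAddTorus.mFourier (d := d))),
      Tendsto (fun i => A i ψ) p (nhds (I ψ)) := by
    intro ψ hψ
    induction hψ using Submodule.span_induction with
    | mem x hx => obtain ⟨n, rfl⟩ := hx; exact h n
    | zero => simpa using tendsto_const_nhds
    | add x y _ _ hx hy => simpa using hx.add hy
    | smul a x _ hx => simpa using hx.const_mul a
  have hφ : φ ∈ closure (Submodule.span ℂ (Set.range (UnitAddTorus.mFourier (d := d))) :
      Set C(UnitAddTorus d, ℂ)) := by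
    rw [← Submodule.topologicalClosure_coe, UnitAddTorus.span_mFourier_closure_eq_top]
    trivial
  rw [Metric.tendsto_nhds]
  intro ε hε
  obtain ⟨ψ, hψ, hd⟩ := Metric.mem_closure_iff.1 hφ (ε / 3) (by positivity)
  rw [dist_eq_norm] at hd
  filter_upwards [Metric.tendsto_nhds.1 (hspan ψ hψ) (ε / 3) (by positivity)] with i hi
  rw [dist_eq_norm] at hi ⊢
  have e : A i φ - I φ = A i (φ - ψ) + (A i ψ - I ψ) - I (φ - ψ) := by
    rw [map_sub, map_sub]; ring
  rw [e]
  have h1 := hA i (φ - ψ)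
  have h2 := hI (φ - ψ)
  have h3 := norm_sub_le (A i (φ - ψ) + (A i ψ - I ψ)) (I (φ - ψ))
  have h4 := norm_add_le (A i (φ - ψ)) (A i ψ - I ψ)
  linarith

/-- The average of a continuous function on the torus over the Cartan angles of the `γ` with
`ν(γ)` a prime at most `x`. -/
def cartanAverage (x : ℝ) : C(UnitAddTorus (Fin 2), ℂ) →ₗ[ℂ] ℂ where
  toFun φ := (piE x : ℂ)⁻¹ * ∑ γ ∈ cartanSet (⌊x⌋₊ - 1), φ ![(theta γ).1, (theta γ).2]
  map_add' φ ψ := by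
    simp only [ContinuousMap.add_apply, Finset.sum_add_distrib, mul_add]
  map_smul' a φ := by
    simp only [ContinuousMap.smul_apply, smul_eq_mul, ← Finset.mul_sum, RingHom.id_apply]
    ring

theorem norm_cartanAverage_le (x : ℝ) (φ : C(UnitAddTorus (Fin 2), ℂ)) :
    ‖cartanAverage x φ‖ ≤ ‖φ‖ := by
  have h : ‖∑ γ ∈ cartanSet (⌊x⌋₊ - 1), φ ![(theta γ).1, (theta γ).2]‖ ≤ piE x * ‖φ‖ := by
    refine (norm_sum_le_of_le _ fun γ _ => φ.norm_coe_le_norm _).trans (le_of_eq ?_)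
    rw [Finset.sum_const, nsmul_eq_mul, piE_eq_card]
  change ‖(piE x : ℂ)⁻¹ * _‖ ≤ _
  rw [norm_mul, norm_inv, Complex.norm_natCast]
  calc _ ≤ (piE x : ℝ)⁻¹ * (piE x * ‖φ‖) := by gcongr
    _ = ((piE x : ℝ)⁻¹ * piE x) * ‖φ‖ := by ring
    _ ≤ 1 * ‖φ‖ := by gcongr; exact inv_mul_le_one
    _ = ‖φ‖ := one_mul _

theorem integrable_torus (φ : C(UnitAddTorus (Fin 2), ℂ)) :
    Integrable fun t : UnitAddCircle × UnitAddCircle => φ ![t.1, t.2] :=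
  (by fun_prop : Continuous fun t : UnitAddCircle × UnitAddCircle =>
    φ ![t.1, t.2]).integrable_of_hasCompactSupport (HasCompactSupport.of_compactSpace _)

/-- The mean of a continuous function on the torus. -/
def torusMean : C(UnitAddTorus (Fin 2), ℂ) →ₗ[ℂ] ℂ where
  toFun φ := ∫ t : UnitAddCircle × UnitAddCircle, φ ![t.1, t.2]
  map_add' φ ψ := integral_add (integrable_torus φ) (integrable_torus ψ)
  map_smul' a _ := integral_const_mul a _

theorem volume_torus_univ : (volume : Measure (UnitAddCircle × UnitAddCircle)) Set.univ = 1 := by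
  rw [Measure.volume_eq_prod, ← Set.univ_prod_univ, Measure.prod_prod, UnitAddCircle.measure_univ,
    one_mul]

theorem norm_torusMean_le (φ : C(UnitAddTorus (Fin 2), ℂ)) : ‖torusMean φ‖ ≤ ‖φ‖ := by
  refine (norm_integral_le_of_norm_le_const (C := ‖φ‖)
    (Eventually.of_forall fun t => φ.norm_coe_le_norm _)).trans (le_of_eq ?_)
  rw [measureReal_def, volume_torus_univ]
  simp

theorem mFourier_fin_two (n : Fin 2 → ℤ) (s t : UnitAddCircle) :
    UnitAddTorus.mFourier n ![s, t] = fourier (n 0) s * fourier (n 1) t := by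
  simp [UnitAddTorus.mFourier, Fin.prod_univ_two]

theorem tendsto_cartanAverage_mFourier {c x₀ : ℝ} (hc : 0 < c)
    (h : ∀ x : ℝ, x₀ ≤ x → c * x / Real.log x ≤ (piE x : ℝ)) (n : Fin 2 → ℤ) :
    Tendsto (fun x => cartanAverage x (UnitAddTorus.mFourier n)) atTop
      (nhds (torusMean (UnitAddTorus.mFourier n))) := by
  by_cases hn : n 0 ≠ 0 ∨ n 1 ≠ 0
  · have e : torusMean (UnitAddTorus.mFourier n) = 0 := by
      change ∫ t : UnitAddCircle × UnitAddCircle, UnitAddTorus.mFourier n ![t.1, t.2] = 0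
      simp only [mFourier_fin_two]
      exact integral_fourier_mul_fourier hn
    rw [e]
    refine (tendsto_average_fourier hc h hn).congr fun x => ?_
    change _ = (piE x : ℂ)⁻¹ * ∑ γ ∈ _, UnitAddTorus.mFourier n ![(theta γ).1, (theta γ).2]
    simp only [mFourier_fin_two]
  · have hn0 : n = 0 := by
      rw [not_or, not_not, not_not] at hn
      ext i
      fin_cases i
      · exact hn.1
      · exact hn.2
    rw [hn0, UnitAddTorus.mFourier_zero]
    have e : torusMean 1 = 1 := by
      change ∫ t : UnitAddCircle × UnitAddCircle, (1 : ℂ) = 1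
      rw [integral_const, measureReal_def, volume_torus_univ]
      simp
    rw [e]
    refine tendsto_const_nhds.congr' ?_
    filter_upwards [eventually_ge_atTop x₀, eventually_gt_atTop 1] with x h1 h2
    have hp : (0 : ℝ) < piE x :=
      (div_pos (mul_pos hc (by linarith)) (Real.log_pos h2)).trans_le (h x h1)
    have hp' : (piE x : ℂ) ≠ 0 := by exact_mod_cast hp.ne'
    change _ = (piE x : ℂ)⁻¹ * ∑ γ ∈ cartanSet (⌊x⌋₊ - 1), (1 : ℂ)
    rw [Finset.sum_const, nsmul_eq_mul, ← piE_eq_card, mul_one, inv_mul_cancel₀ hp']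

end CartanAngles

theorem stmt7
    (h : ∃ c₁ c₂ x₀ : ℝ, 0 < c₁ ∧ c₁ ≤ c₂ ∧ ∀ x : ℝ, x₀ ≤ x →
      c₁ * x / Real.log x ≤ (piE x : ℝ) ∧ (piE x : ℝ) ≤ c₂ * x / Real.log x) :
    ∀ f : UnitAddCircle × UnitAddCircle → ℂ, Continuous f →
      Tendsto
        (fun x : ℝ => (piE x : ℂ)⁻¹ *
          ∑ᶠ γ : {γ : SL2Z // ∃ p : ℕ, p.Prime ∧ (p : ℝ) ≤ x ∧ nuH γ = (p : ℤ)},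
            f (theta γ.1))
        atTop (nhds (∫ t, f t)) := by
  intro f hf
  obtain ⟨c, c₂, x₀, hc, -, hx⟩ := h
  have key := CartanAngles.tendsto_of_tendsto_mFourier CartanAngles.norm_cartanAverage_le
    CartanAngles.norm_torusMean_le
    (CartanAngles.tendsto_cartanAverage_mFourier hc fun x h => (hx x h).1)
    ⟨fun v => f (v 0, v 1), by fun_prop⟩
  refine key.congr fun x => ?_
  rw [CartanAngles.finsum_eq_sum_cartanSet (fun γ => f (theta γ)) x]
  rfl

end
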